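/- arXiv:2510.00364 — 3 statements merged into one kernel-verified Lean document; each statement's English description precedes it below -/
import Mathlib

section
/- Let 3 ≤ m < k be integers and let h_1 = h_2 = … = h_m ≥ h_{m+1} ≥ … ≥ h_k > 0 be integers satisfying (m−1)(h_1 + h_{m+1}) < h_{m+1} + h_{m+2} + … + h_k. Then there exists a realization of the partition (h_1^m h_{m+1} … h_k). -/
/-- A latin square of order `n`: an `n × n` array with symbols from a set of
size `n` (encoded as `Fin n`) such that every symbol occurs exactly once in
every row and every column. -/
def IsLatinSquare {n : ℕ} (L : Fin n → Fin n → Fin n) : Prop :=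
  (∀ i, Function.Bijective fun j => L i j) ∧ (∀ j, Function.Bijective fun i => L i j)

/-- `L` has pairwise disjoint subsquares of orders `h 0, …, h (k-1)`:
for each `i` there are sets `R i` of rows, `C i` of columns and `S i` of
symbols, each of size `h i`, pairwise disjoint (no shared rows, columns or
symbols), such that the subarray on rows `R i` and columns `C i` only uses
the symbols `S i` (given that `L` is a latin square, this subarray is then
itself a latin square of order `h i` on the symbol set `S i`). -/
def HasDisjointSubsquares {n k : ℕ} (L : Fin n → Fin n → Fin n) (h : Fin k → ℕ) : Prop :=
  ∃ R C S : Fin k → Finset (Fin n),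
    (∀ i, (R i).card = h i) ∧ (∀ i, (C i).card = h i) ∧ (∀ i, (S i).card = h i) ∧
    (∀ i j, i ≠ j → Disjoint (R i) (R j)) ∧
    (∀ i j, i ≠ j → Disjoint (C i) (C j)) ∧
    (∀ i j, i ≠ j → Disjoint (S i) (S j)) ∧
    (∀ i, ∀ x ∈ R i, ∀ y ∈ C i, L x y ∈ S i)

/-- An incomplete latin square `ILS(n; h_1 … h_k)`: a latin square of order `n`
with pairwise disjoint subsquares of orders `h_1, …, h_k`. -/
def HasILS (n : ℕ) {k : ℕ} (h : Fin k → ℕ) : Prop :=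
  ∃ L : Fin n → Fin n → Fin n, IsLatinSquare L ∧ HasDisjointSubsquares L h

/-- A realization of the partition `(h_1 … h_k)` of `n = h_1 + … + h_k`:
a latin square of order `n` with pairwise disjoint subsquares of orders
`h_1, …, h_k`. -/
def HasRealization {k : ℕ} (h : Fin k → ℕ) : Prop :=
  HasILS (∑ i, h i) h

section Realization

open Finset

/-- König's edge-colouring theorem for regular bipartite multigraphs: if every vertex of `A` and of
`B` lies on exactly `n` edges of `s`, then the edges can be coloured with `n` colours so that every
vertex sees every colour exactly once. -/
theorem exists_proper_coloring {E L R : Type*} [DecidableEq E] [DecidableEq L] [DecidableEq R]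
    (φ : E → L) (ψ : E → R) (A : Finset L) (B : Finset R) (n : ℕ) (s : Finset E)
    (hφ : ∀ e ∈ s, φ e ∈ A) (hψ : ∀ e ∈ s, ψ e ∈ B)
    (hA : ∀ l ∈ A, #{e ∈ s | φ e = l} = n) (hB : ∀ r ∈ B, #{e ∈ s | ψ e = r} = n) :
    ∃ col : E → ℕ, (∀ e ∈ s, col e < n) ∧ ∀ t < n,
      (∀ l ∈ A, #{e ∈ s | φ e = l ∧ col e = t} = 1) ∧
      (∀ r ∈ B, #{e ∈ s | ψ e = r ∧ col e = t} = 1) := by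
  induction n generalizing s with
  | zero =>
    refine ⟨fun _ => 0, fun e he => ?_, fun t ht => absurd ht (by omega)⟩
    have := hA (φ e) (hφ e he)
    rw [card_eq_zero, filter_eq_empty_iff] at this
    exact absurd rfl (this he)
  | succ n ih =>
    have count_A : ∀ T ⊆ A, #{e ∈ s | φ e ∈ T} = #T * (n + 1) := by
      intro T hT
      rw [card_eq_sum_card_fiberwise (f := φ) (t := T) (by intro e he; simp_all)]
      rw [sum_const_nat]
      intro l hl
      rw [← hA l (hT hl), filter_filter]
      congr 1; ext e; simp only [mem_filter]
      constructor
      · tauto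
      · rintro ⟨h, rfl⟩; exact ⟨h, hl, rfl⟩
    have count_B : ∀ T ⊆ B, #{e ∈ s | ψ e ∈ T} = #T * (n + 1) := by
      intro T hT
      rw [card_eq_sum_card_fiberwise (f := ψ) (t := T) (by intro e he; simp_all)]
      rw [sum_const_nat]
      intro l hl
      rw [← hB l (hT hl), filter_filter]
      congr 1; ext e; simp only [mem_filter]
      constructor
      · tauto
      · rintro ⟨h, rfl⟩; exact ⟨h, hl, rfl⟩
    obtain ⟨f, hfinj, hf⟩ := (Finset.all_card_le_biUnion_card_iff_exists_injective
      (fun l : A => {e ∈ s | φ e = l}.image ψ)).1 (by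
        intro T
        have h1 := count_A (T.map (Function.Embedding.subtype _)) (by
          intro l hl; simp only [mem_map, Function.Embedding.subtype_apply] at hl
          obtain ⟨x, -, rfl⟩ := hl; exact x.2)
        have h2 := count_B (T.biUnion fun l : A => {e ∈ s | φ e = l}.image ψ) (by
          intro r hr; simp only [mem_biUnion, mem_image, mem_filter] at hr
          obtain ⟨x, -, e, ⟨he, -⟩, rfl⟩ := hr; exact hψ e he)
        rw [card_map] at h1
        refine Nat.le_of_mul_le_mul_right (c := n + 1) ?_ (by omega)
        rw [← h1, ← h2]
        refine card_le_card fun e he => ?_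
        simp only [mem_filter, mem_map, Function.Embedding.subtype_apply, mem_biUnion,
          mem_image] at he ⊢
        obtain ⟨hes, x, hx, hxe⟩ := he
        exact ⟨hes, x, hx, e, ⟨hes, hxe.symm⟩, rfl⟩)
    simp only [mem_image, mem_filter] at hf
    choose g hg hgf using hf
    have hginj : Function.Injective g := fun x y h => by
      apply Subtype.ext; rw [← (hg x).2, ← (hg y).2, h]
    set M : Finset E := univ.image g with hM
    have hMs : M ⊆ s := by
      intro e he; simp only [hM, mem_image, mem_univ, true_and] at he
      obtain ⟨x, rfl⟩ := he; exact (hg x).1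
    have hMcard : #M = #A := by
      rw [hM, card_image_of_injective _ hginj]; simp
    have hAB : #A = #B := by
      have h1 := count_A A subset_rfl
      have h2 := count_B B subset_rfl
      rw [filter_true_of_mem hφ] at h1
      rw [filter_true_of_mem hψ] at h2
      exact Nat.eq_of_mul_eq_mul_right (by omega : 0 < n + 1) (h1 ▸ h2)
    have hψM : Set.InjOn ψ M := by
      intro e he e' he' h
      simp only [hM, coe_image, coe_univ, Set.image_univ, Set.mem_range] at he he'
      obtain ⟨x, rfl⟩ := he; obtain ⟨y, rfl⟩ := he'
      rw [hgf, hgf] at h; rw [hfinj h]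
    have hψim : M.image ψ = B := by
      apply eq_of_subset_of_card_le
      · intro r hr; obtain ⟨e, he, rfl⟩ := mem_image.1 hr; exact hψ e (hMs he)
      · rw [card_image_of_injOn hψM]; omega
    have hMA : ∀ l ∈ A, #{e ∈ M | φ e = l} = 1 := by
      intro l hl
      rw [card_eq_one]
      refine ⟨g ⟨l, hl⟩, ?_⟩
      ext e
      simp only [hM, mem_filter, mem_image, mem_univ, true_and, mem_singleton]
      constructor
      · rintro ⟨⟨x, rfl⟩, h⟩
        congr 1; apply Subtype.ext; rw [← (hg x).2]; exact h
      · rintro rfl; exact ⟨⟨_, rfl⟩, (hg _).2⟩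
    have hMB : ∀ r ∈ B, #{e ∈ M | ψ e = r} = 1 := by
      intro r hr
      rw [← hψim] at hr
      obtain ⟨e, he, rfl⟩ := mem_image.1 hr
      rw [card_eq_one]
      refine ⟨e, ?_⟩
      ext e'
      simp only [mem_filter, mem_singleton]
      constructor
      · rintro ⟨h, h'⟩; exact hψM h he h'
      · rintro rfl; exact ⟨he, rfl⟩
    have split : ∀ P : E → Prop, [DecidablePred P] →
        #{e ∈ s \ M | P e} + #{e ∈ M | P e} = #{e ∈ s | P e} := by
      intro P _
      rw [← card_union_of_disjoint (disjoint_filter_filter sdiff_disjoint), ← filter_union,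
        sdiff_union_of_subset hMs]
    obtain ⟨col, hcol, hc⟩ := ih (s \ M) (fun e he => hφ e (mem_sdiff.1 he).1)
      (fun e he => hψ e (mem_sdiff.1 he).1)
      (fun l hl => by have := split (fun e => φ e = l); have := hMA l hl; have := hA l hl; omega)
      (fun r hr => by have := split (fun e => ψ e = r); have := hMB r hr; have := hB r hr; omega)
    refine ⟨fun e => if e ∈ M then n else col e, fun e he => ?_, fun t ht => ?_⟩
    · dsimp only
      split_ifs with h
      · omega
      · have := hcol e (mem_sdiff.2 ⟨he, h⟩); omega
    · have main : ∀ P : E → Prop, [DecidablePred P] → #{e ∈ M | P e} = 1 →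
          (t < n → #{e ∈ s \ M | P e ∧ col e = t} = 1) →
          #{e ∈ s | P e ∧ (if e ∈ M then n else col e) = t} = 1 := by
        intro P _ h1 h2
        rcases Nat.lt_or_ge t n with htn | htn
        · rw [← h2 htn]
          congr 1; ext e
          simp only [mem_filter, mem_sdiff]
          by_cases heM : e ∈ M
          · simp [heM]; omega
          · simp [heM]
        · obtain rfl : t = n := by omega
          rw [← h1]
          congr 1; ext e
          simp only [mem_filter]
          by_cases heM : e ∈ M
          · simp [heM, hMs heM]
          · simp only [heM, if_false, false_and, iff_false]
            rintro ⟨hes, -, h⟩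
            have := hcol e (mem_sdiff.2 ⟨hes, heM⟩); omega
      exact ⟨fun l hl => main (fun e => φ e = l) (hMA l hl) fun htn => (hc t htn).1 l hl,
        fun r hr => main (fun e => ψ e = r) (hMB r hr) fun htn => (hc t htn).2 r hr⟩

/-- A finite set of `n * a` elements can be cut into `a` blocks of size `n`. -/
theorem exists_blocks {E : Type*} [DecidableEq E] (n a : ℕ) (s : Finset E) (hs : #s = n * a) :
    ∃ g : E → ℕ, (∀ e ∈ s, g e < a) ∧ ∀ k < a, #{e ∈ s | g e = k} = n := by
  induction a generalizing s with
  | zero =>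
    rw [mul_zero, card_eq_zero] at hs
    exact ⟨fun _ => 0, by simp [hs], by simp⟩
  | succ a ih =>
    obtain ⟨M, hM, hMc⟩ := exists_subset_card_eq (s := s) (n := n) (by rw [hs]; nlinarith)
    obtain ⟨g, hg, hgc⟩ := ih (s \ M) (by
      rw [card_sdiff_of_subset hM, hs, hMc, mul_add, mul_one, Nat.add_sub_cancel])
    refine ⟨fun e => if e ∈ M then a else g e, fun e he => ?_, fun k hk => ?_⟩
    · dsimp only
      split_ifs with h
      · omega
      · have := hg e (mem_sdiff.2 ⟨he, h⟩); omega
    · rcases Nat.lt_or_ge k a with hka | hka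
      · rw [← hgc k hka]
        congr 1; ext e
        simp only [mem_filter, mem_sdiff]
        by_cases heM : e ∈ M
        · simp [heM]; omega
        · simp [heM]
      · obtain rfl : k = a := by omega
        rw [← hMc]
        congr 1; ext e
        simp only [mem_filter]
        by_cases heM : e ∈ M
        · simp [heM, hM heM]
        · simp only [heM, if_false, iff_false]
          rintro ⟨hes, h⟩
          have := hg e (mem_sdiff.2 ⟨hes, heM⟩); omega

/-- Exact splitting: a bipartite multigraph whose degrees are `n * α x` and `n * β y` decomposes
into `n` subgraphs with degrees `α x` and `β y`. -/
theorem exists_split {E X Y : Type*} [DecidableEq E] [DecidableEq X] [DecidableEq Y]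
    [Fintype X] [Fintype Y] (p : E → X) (q : E → Y) (n : ℕ) (α : X → ℕ) (β : Y → ℕ) (s : Finset E)
    (hp : ∀ x, #{e ∈ s | p e = x} = n * α x) (hq : ∀ y, #{e ∈ s | q e = y} = n * β y) :
    ∃ col : E → ℕ, (∀ e ∈ s, col e < n) ∧ ∀ t < n,
      (∀ x, #{e ∈ s | p e = x ∧ col e = t} = α x) ∧
      (∀ y, #{e ∈ s | q e = y ∧ col e = t} = β y) := by
  choose f hf hfc using fun x => exists_blocks n (α x) {e ∈ s | p e = x} (hp x)
  choose g hg hgc using fun y => exists_blocks n (β y) {e ∈ s | q e = y} (hq y)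
  simp only [mem_filter, and_imp] at hf hg
  obtain ⟨col, hcol, hc⟩ := exists_proper_coloring (fun e => (⟨p e, f (p e) e⟩ : Σ _ : X, ℕ))
    (fun e => (⟨q e, g (q e) e⟩ : Σ _ : Y, ℕ))
    (univ.sigma fun x => range (α x)) (univ.sigma fun y => range (β y)) n s
    (fun e he => by simpa using hf (p e) e he rfl)
    (fun e he => by simpa using hg (q e) e he rfl)
    (by
      rintro ⟨x, k⟩ hk
      simp only [mem_sigma, mem_univ, mem_range, true_and] at hk
      rw [← hfc x k hk, filter_filter]
      congr 1; ext e
      simp only [mem_filter, Sigma.mk.injEq, heq_eq_eq]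
      constructor
      · rintro ⟨h, rfl, h'⟩; exact ⟨h, rfl, h'⟩
      · rintro ⟨h, rfl, h'⟩; exact ⟨h, rfl, h'⟩)
    (by
      rintro ⟨x, k⟩ hk
      simp only [mem_sigma, mem_univ, mem_range, true_and] at hk
      rw [← hgc x k hk, filter_filter]
      congr 1; ext e
      simp only [mem_filter, Sigma.mk.injEq, heq_eq_eq]
      constructor
      · rintro ⟨h, rfl, h'⟩; exact ⟨h, rfl, h'⟩
      · rintro ⟨h, rfl, h'⟩; exact ⟨h, rfl, h'⟩)
  refine ⟨col, hcol, fun t ht => ⟨fun x => ?_, fun y => ?_⟩⟩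
  · rw [card_eq_sum_card_fiberwise (f := f x) (t := range (α x))
      (by intro e he; simp only [coe_filter, Set.mem_ofPred_eq] at he
          simpa using hf x e he.1 he.2.1)]
    rw [sum_const_nat (m := 1), card_range, mul_one]
    intro k hk
    rw [← (hc t ht).1 ⟨x, k⟩ (by simpa using hk), filter_filter]
    congr 1; ext e
    simp only [mem_filter, Sigma.mk.injEq, heq_eq_eq]
    constructor
    · rintro ⟨h, ⟨rfl, h1⟩, h2⟩; exact ⟨h, ⟨rfl, h2⟩, h1⟩
    · rintro ⟨h, ⟨rfl, h2⟩, h1⟩; exact ⟨h, ⟨rfl, h1⟩, h2⟩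
  · rw [card_eq_sum_card_fiberwise (f := g y) (t := range (β y))
      (by intro e he; simp only [coe_filter, Set.mem_ofPred_eq] at he
          simpa using hg y e he.1 he.2.1)]
    rw [sum_const_nat (m := 1), card_range, mul_one]
    intro k hk
    rw [← (hc t ht).2 ⟨y, k⟩ (by simpa using hk), filter_filter]
    congr 1; ext e
    simp only [mem_filter, Sigma.mk.injEq, heq_eq_eq]
    constructor
    · rintro ⟨h, ⟨rfl, h1⟩, h2⟩; exact ⟨h, ⟨rfl, h2⟩, h1⟩
    · rintro ⟨h, ⟨rfl, h2⟩, h1⟩; exact ⟨h, ⟨rfl, h1⟩, h2⟩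

/-- Splitting every fibre of `k`: each vertex `i` is replaced by `h i` copies, and the degrees are
shared evenly among the copies. -/
theorem exists_refinement {E ι X Y : Type*} [DecidableEq E] [DecidableEq ι] [DecidableEq X]
    [DecidableEq Y] [Fintype E] [Fintype X] [Fintype Y] (k : E → ι) (p : E → X) (q : E → Y)
    (h : ι → ℕ) (α : X → ℕ) (β : Y → ℕ)
    (hp : ∀ i x, #{e | k e = i ∧ p e = x} = h i * α x)
    (hq : ∀ i y, #{e | k e = i ∧ q e = y} = h i * β y) :
    ∃ K : E → Σ i, Fin (h i), (∀ e, (K e).1 = k e) ∧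
      (∀ κ x, #{e | K e = κ ∧ p e = x} = α x) ∧ (∀ κ y, #{e | K e = κ ∧ q e = y} = β y) := by
  choose col hcol hc using fun i => exists_split p q (h i) α β {e | k e = i}
    (by simpa only [filter_filter] using hp i) (by simpa only [filter_filter] using hq i)
  simp only [mem_filter, mem_univ, true_and] at hcol
  have key : ∀ (i : ι) (t : Fin (h i)) (e : E),
      ((⟨k e, col (k e) e, hcol _ e rfl⟩ : Σ i, Fin (h i)) = ⟨i, t⟩) ↔
        k e = i ∧ col i e = t := by
    intro i t e
    constructor
    · intro H
      obtain ⟨rfl, H⟩ := Sigma.mk.inj_iff.1 H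
      exact ⟨rfl, congrArg Fin.val (eq_of_heq H)⟩
    · rintro ⟨rfl, H⟩
      simp [H]
  refine ⟨fun e => ⟨k e, col (k e) e, hcol _ e rfl⟩, fun e => rfl, ?_, ?_⟩
  · rintro ⟨i, t⟩ x
    rw [← (hc i t t.2).1 x, filter_filter]
    congr 1; ext e
    simp only [key, mem_filter, mem_univ, true_and]
    tauto
  · rintro ⟨i, t⟩ x
    rw [← (hc i t t.2).2 x, filter_filter]
    congr 1; ext e
    simp only [key, mem_filter, mem_univ, true_and]
    tauto

/-- Given nonnegative integers `F i j l` whose pair margins are the products of the weights `h`,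
there is a latin square on the disjoint union of blocks of sizes `h i` in which block `(i, j)`
contains exactly `F i j l` symbols of class `l`; in particular the diagonal blocks are closed when
`F i i l = 0` for `l ≠ i`. -/
theorem exists_latin_of_margins {ι : Type*} [Fintype ι] [DecidableEq ι] (h : ι → ℕ)
    (F : ι → ι → ι → ℕ) (hij : ∀ i j, ∑ l, F i j l = h i * h j)
    (hil : ∀ i l, ∑ j, F i j l = h i * h l) (hjl : ∀ j l, ∑ i, F i j l = h j * h l)
    (hdiag : ∀ i l, l ≠ i → F i i l = 0) :
    ∃ L : (Σ i, Fin (h i)) → (Σ i, Fin (h i)) → Σ i, Fin (h i),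
      (∀ x, Function.Bijective fun y => L x y) ∧ (∀ y, Function.Bijective fun x => L x y) ∧
      ∀ x y, x.1 = y.1 → (L x y).1 = x.1 := by
  let E := Σ t : ι × ι × ι, Fin (F t.1 t.2.1 t.2.2)
  let fi : E → ι := fun e => e.1.1
  let fj : E → ι := fun e => e.1.2.1
  let fl : E → ι := fun e => e.1.2.2
  have card_filter_E : ∀ P : ι × ι × ι → Prop, [DecidablePred P] →
      #{e : E | P e.1} = ∑ i, ∑ j, ∑ l, if P (i, j, l) then F i j l else 0 := by
    intro P _
    have : ({e : E | P e.1} : Finset E) = (univ.filter P).sigma fun _ => univ := by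
      ext e; refine Iff.trans ?_ mem_sigma.symm; simp
    rw [this, card_sigma, sum_filter, Fintype.sum_prod_type]
    simp_rw [Fintype.sum_prod_type, card_univ, Fintype.card_fin]
  have cij : ∀ i j, #{e : E | fi e = i ∧ fj e = j} = h i * h j := by
    intro i j
    rw [card_filter_E (fun t => t.1 = i ∧ t.2.1 = j), ← hij,
      sum_eq_single i (by intros; simp_all) (by simp), sum_eq_single j (by intros; simp_all)
      (by simp)]
    simp
  have cil : ∀ i l, #{e : E | fi e = i ∧ fl e = l} = h i * h l := by
    intro i l
    rw [card_filter_E (fun t => t.1 = i ∧ t.2.2 = l), ← hil,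
      sum_eq_single i (by intros; simp_all) (by simp)]
    simp
  have cjl : ∀ j l, #{e : E | fj e = j ∧ fl e = l} = h j * h l := by
    intro j l
    rw [card_filter_E (fun t => t.2.1 = j ∧ t.2.2 = l), ← hjl]
    refine sum_congr rfl fun i _ => ?_
    rw [sum_eq_single j (by intros; simp_all) (by simp)]
    simp
  obtain ⟨r, hr, hrj, hrl⟩ := exists_refinement fi fj fl h h h cij cil
  obtain ⟨c, hc, hcr, hcl⟩ := exists_refinement fj r fl h (fun _ => 1) h
    (fun j ρ => by simp_rw [and_comm (a := fj _ = j), hrj, mul_one]) cjl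
  obtain ⟨s, hs, hsr, hsc⟩ := exists_refinement fl r c h (fun _ => 1) (fun _ => 1)
    (fun l ρ => by simp_rw [and_comm (a := fl _ = l), hrl, mul_one])
    (fun l χ => by simp_rw [and_comm (a := fl _ = l), hcl, mul_one])
  have uniq : ∀ {P : E → Prop} [DecidablePred P], #{e | P e} = 1 → ∃! e, P e := by
    intro P _ hP
    obtain ⟨e, he⟩ := card_eq_one.1 hP
    have : ∀ e', P e' ↔ e' = e := fun e' => by
      rw [← mem_singleton, ← he]; simp
    exact ⟨e, (this e).2 rfl, fun e' h' => (this e').1 h'⟩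
  choose f hf hfu using fun ρ χ => uniq (hcr χ ρ)
  choose g hg hgu using fun ρ σ => uniq (hsr σ ρ)
  choose k hk hku using fun χ σ => uniq (hsc σ χ)
  refine ⟨fun ρ χ => s (f ρ χ), fun ρ => ?_, fun χ => ?_, fun ρ χ hρχ => ?_⟩
  · refine Function.bijective_iff_has_inverse.2 ⟨fun σ => c (g ρ σ), fun χ => ?_, fun σ => ?_⟩
    · dsimp only
      rw [← hgu ρ _ (f ρ χ) ⟨rfl, (hf ρ χ).2⟩, (hf ρ χ).1]
    · dsimp only
      rw [← hfu ρ _ (g ρ σ) ⟨rfl, (hg ρ σ).2⟩, (hg ρ σ).1]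
  · refine Function.bijective_iff_has_inverse.2 ⟨fun σ => r (k χ σ), fun ρ => ?_, fun σ => ?_⟩
    · dsimp only
      rw [← hku χ _ (f ρ χ) ⟨rfl, (hf ρ χ).1⟩, (hf ρ χ).2]
    · dsimp only
      rw [← hfu _ χ (k χ σ) ⟨(hk χ σ).2, rfl⟩, (hk χ σ).1]
  · dsimp only
    obtain ⟨h1, h2⟩ := hf ρ χ
    generalize f ρ χ = e at h1 h2
    rw [hs]
    by_contra hne
    have e1 : fi e = ρ.1 := by rw [← hr, h2]
    have e2 : fj e = ρ.1 := by rw [← hc, h1, hρχ]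
    obtain ⟨⟨i, j, l⟩, x⟩ := e
    dsimp only [fi, fj, fl] at e1 e2 hne
    subst e1
    subst e2
    exact absurd x.2 (by simp [hdiag _ _ hne])

theorem hasRealization_of_margins {k : ℕ} (h : Fin k → ℕ)
    (F : Fin k → Fin k → Fin k → ℕ) (hij : ∀ i j, ∑ l, F i j l = h i * h j)
    (hil : ∀ i l, ∑ j, F i j l = h i * h l) (hjl : ∀ j l, ∑ i, F i j l = h j * h l)
    (hdiag : ∀ i l, l ≠ i → F i i l = 0) : HasRealization h := by
  obtain ⟨L, hrow, hcol, hL⟩ := exists_latin_of_margins h F hij hil hjl hdiag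
  let ε : (Σ i, Fin (h i)) ≃ Fin (∑ i, h i) := finSigmaFinEquiv
  let T : Fin k → Finset (Fin (∑ i, h i)) := fun i => {x | (ε.symm x).1 = i}
  have hT : ∀ i, #(T i) = h i := by
    intro i
    have : T i = (univ : Finset (Fin (h i))).map
        ((Function.Embedding.sigmaMk i).trans ε.toEmbedding) := by
      ext x
      simp only [T, mem_filter, mem_univ, true_and, mem_map, Function.Embedding.trans_apply,
        Function.Embedding.sigmaMk_apply, Equiv.coe_toEmbedding]
      constructor
      · rintro rfl; exact ⟨(ε.symm x).2, by simp⟩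
      · rintro ⟨a, rfl⟩; simp
    rw [this, card_map, card_univ, Fintype.card_fin]
  have hdisj : ∀ i j, i ≠ j → Disjoint (T i) (T j) := fun i j hne =>
    disjoint_filter.2 fun x _ h1 h2 => hne (h1.symm.trans h2)
  refine ⟨fun x y => ε (L (ε.symm x) (ε.symm y)), ⟨fun x => ?_, fun y => ?_⟩,
    T, T, T, hT, hT, hT, hdisj, hdisj, hdisj, fun i x hx y hy => ?_⟩
  · exact ε.bijective.comp ((hrow _).comp ε.symm.bijective)
  · exact ε.bijective.comp ((hcol (ε.symm y)).comp ε.symm.bijective)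
  · simp only [T, mem_filter, mem_univ, true_and, Equiv.symm_apply_apply] at hx hy ⊢
    rw [hL _ _ (hx.trans hy.symm), hx]

/-- A sum of natural numbers can be lowered termwise to reach any smaller total. -/
theorem exists_le_sum_eq {ι : Type*} [DecidableEq ι] (s : Finset ι) (f : ι → ℕ) (t : ℕ)
    (ht : t ≤ ∑ i ∈ s, f i) : ∃ g : ι → ℕ, (∀ i, g i ≤ f i) ∧ ∑ i ∈ s, g i = t := by
  induction s using Finset.induction_on generalizing t with
  | empty => exact ⟨f, fun _ => le_rfl, by simp at ht ⊢; omega⟩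
  | insert j s hj ih =>
    rw [sum_insert hj] at ht
    obtain ⟨g, hg, hgs⟩ := ih (t - min t (f j)) (by omega)
    refine ⟨Function.update g j (min t (f j)), fun i => ?_, ?_⟩
    · rcases eq_or_ne i j with rfl | hne
      · simp
      · simpa [hne] using hg i
    · rw [sum_insert hj, sum_update_of_notMem hj, hgs, Function.update_self]
      omega

/-- The pairs left over by `Z` and by the diagonal split evenly into three parts. -/
theorem exists_three_split {ι : Type*} [Fintype ι] [DecidableEq ι] (b : ι → ℕ) (Z : ι → ι → ℕ)
    (κ η : ℕ) (hN : ∑ i, b i = κ + 3 * η) (hle : ∀ i j, Z i j ≤ b i * b j) (hdiag : ∀ i, Z i i = 0)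
    (hrow : ∀ i, ∑ j, Z i j + b i * b i = b i * κ)
    (hcol : ∀ j, ∑ i, Z i j + b j * b j = b j * κ) :
    ∃ D : Fin 3 → ι → ι → ℕ,
      (∀ i j, ∑ p, D p i j + Z i j + (if i = j then b i * b i else 0) = b i * b j) ∧
      (∀ p i, ∑ j, D p i j = η * b i) ∧ (∀ p j, ∑ i, D p i j = η * b j) := by
  let K : ι → ι → ℕ := fun i j => if i = j then 0 else b i * b j - Z i j
  have hK : ∀ i j, K i j + Z i j + (if i = j then b i * b i else 0) = b i * b j := by
    intro i j
    have := hle i j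
    by_cases hij : i = j
    · subst hij; simp [K, hdiag]
    · simp only [K, hij, if_false]; omega
  have hKrow : ∀ i, ∑ j, K i j = 3 * (η * b i) := by
    intro i
    have h1 : ∑ j, (K i j + Z i j + (if i = j then b i * b i else 0)) = ∑ j, b i * b j :=
      sum_congr rfl fun j _ => hK i j
    rw [sum_add_distrib, sum_add_distrib, ← mul_sum, hN] at h1
    simp only [sum_ite_eq, mem_univ, if_true] at h1
    have := hrow i
    nlinarith
  have hKcol : ∀ j, ∑ i, K i j = 3 * (η * b j) := by
    intro j
    have h1 : ∑ i, (K i j + Z i j + (if i = j then b i * b i else 0)) = ∑ i, b i * b j :=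
      sum_congr rfl fun i _ => hK i j
    rw [sum_add_distrib, sum_add_distrib, ← sum_mul, hN] at h1
    simp only [sum_ite_eq', mem_univ, if_true] at h1
    have := hcol j
    nlinarith
  have card_filter_E : ∀ P : ι × ι → Prop, [DecidablePred P] →
      #{e : Σ t : ι × ι, Fin (K t.1 t.2) | P e.1} = ∑ i, ∑ j, if P (i, j) then K i j else 0 := by
    intro P _
    have : ({e : Σ t : ι × ι, Fin (K t.1 t.2) | P e.1} : Finset _) =
        (univ.filter P).sigma fun _ => univ := by
      ext e; simp
    rw [this, card_sigma, sum_filter, Fintype.sum_prod_type]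
    simp_rw [card_univ, Fintype.card_fin]
  obtain ⟨col, hcol3, hc⟩ := exists_split (fun e : Σ t : ι × ι, Fin (K t.1 t.2) => e.1.1)
    (fun e => e.1.2) 3 (fun i => η * b i) (fun j => η * b j) univ
    (fun i => by
      rw [card_filter_E (fun t => t.1 = i), ← hKrow,
        sum_eq_single i (by intros; simp_all) (by simp)]
      simp)
    (fun j => by
      rw [card_filter_E (fun t => t.2 = j), ← hKcol]
      simp)
  refine ⟨fun p i j => #{e | e.1 = (i, j) ∧ col e = p}, fun i j => ?_, fun p i => ?_, fun p j => ?_⟩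
  · rw [← hK i j]
    congr 2
    have h1 := card_filter_E (fun t => t = (i, j))
    rw [sum_eq_single i (by intros; simp_all) (by simp),
      sum_eq_single j (by intros; simp_all) (by simp), if_pos rfl] at h1
    rw [← h1, card_eq_sum_card_fiberwise (f := fun e => (⟨col e, hcol3 e (mem_univ _)⟩ : Fin 3))
      (t := univ) (by simp)]
    refine sum_congr rfl fun p _ => ?_
    rw [filter_filter]
    refine congrArg card ?_; ext e; simp [Fin.ext_iff]
  · rw [← (hc p p.2).1 i, card_eq_sum_card_fiberwise (f := fun e => e.1.2) (t := univ) (by simp)]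
    refine sum_congr rfl fun j _ => ?_
    rw [filter_filter]
    refine congrArg card ?_; ext e; simp [Prod.ext_iff]; tauto
  · rw [← (hc p p.2).2 j, card_eq_sum_card_fiberwise (f := fun e => e.1.1) (t := univ) (by simp)]
    refine sum_congr rfl fun i _ => ?_
    rw [filter_filter]
    refine congrArg card ?_; ext e; simp [Prod.ext_iff]; tauto

/-- Class counts of the latin square: three large classes of weight `a` (left summand) and the
remaining classes (right summand). `g₁`, `g₂` count the small-class entries among two large classes,
`y₁`, `y₂` the entries of three distinct large classes, and `D₁₂`, `D₁₃`, `D₂₃`, `T` the entries with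
at least two small coordinates. -/
def outline {ι : Type*} [DecidableEq ι] (a y₁ y₂ : ℕ) (g₁ g₂ : ι → ℕ)
    (D₁₂ D₁₃ D₂₃ : Fin 3 → ι → ι → ℕ) (T : ι → ι → ι → ℕ) :
    Fin 3 ⊕ ι → Fin 3 ⊕ ι → Fin 3 ⊕ ι → ℕ
  | .inl p, .inl q, .inl r =>
    if q = p ∧ r = p then a * a else if q = p + 1 ∧ r = p + 2 then y₁
    else if q = p + 2 ∧ r = p + 1 then y₂ else 0
  | .inl p, .inl q, .inr i => if q = p + 1 then g₁ i else if q = p + 2 then g₂ i else 0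
  | .inl p, .inr i, .inl r => if r = p + 2 then g₁ i else if r = p + 1 then g₂ i else 0
  | .inr i, .inl q, .inl r => if r = q + 1 then g₁ i else if r = q + 2 then g₂ i else 0
  | .inl p, .inr i, .inr j => D₂₃ p i j
  | .inr i, .inl p, .inr j => D₁₃ p i j
  | .inr i, .inr j, .inl p => D₁₂ p i j
  | .inr i, .inr j, .inr l => T i j l

/-- The weights of a system with three large classes of weight `a = η + ω`, given a family `Ev` of
off-diagonal triples of small classes that covers `κ` transversals minus the diagonal. -/
theorem exists_margins_of_triples {ι Ev : Type*} [Fintype ι] [DecidableEq ι] [Fintype Ev]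
    (a η ω κ : ℕ) (b : ι → ℕ) (ha : a = η + ω) (hN : ∑ i, b i = κ + 3 * η)
    (hω : ω * ∑ i, b i ≤ 2 * (a * a)) (x y s : Ev → ι)
    (hxy : ∀ e, x e ≠ y e) (hxs : ∀ e, x e ≠ s e) (hys : ∀ e, y e ≠ s e)
    (hx : ∀ i, #{e | x e = i} + b i * b i = b i * κ)
    (hy : ∀ i, #{e | y e = i} + b i * b i = b i * κ)
    (hs : ∀ i, #{e | s e = i} + b i * b i = b i * κ)
    (hxy' : ∀ i j, #{e | x e = i ∧ y e = j} ≤ b i * b j)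
    (hxs' : ∀ i j, #{e | x e = i ∧ s e = j} ≤ b i * b j)
    (hys' : ∀ i j, #{e | y e = i ∧ s e = j} ≤ b i * b j) :
    ∃ F : Fin 3 ⊕ ι → Fin 3 ⊕ ι → Fin 3 ⊕ ι → ℕ,
      (∀ i j, ∑ l, F i j l = Sum.elim (fun _ => a) b i * Sum.elim (fun _ => a) b j) ∧
      (∀ i l, ∑ j, F i j l = Sum.elim (fun _ => a) b i * Sum.elim (fun _ => a) b l) ∧
      (∀ j l, ∑ i, F i j l = Sum.elim (fun _ => a) b j * Sum.elim (fun _ => a) b l) ∧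
      (∀ i l, l ≠ i → F i i l = 0) := by
  have pair_row : ∀ (u v : Ev → ι) (i : ι), ∑ j, #{e | u e = i ∧ v e = j} = #{e | u e = i} := by
    intro u v i
    rw [card_eq_sum_card_fiberwise (f := v) (t := univ) (by simp)]
    simp_rw [filter_filter]
  have pair_col : ∀ (u v : Ev → ι) (j : ι), ∑ i, #{e | u e = i ∧ v e = j} = #{e | v e = j} := by
    intro u v j
    simp_rw [and_comm (a := u _ = _)]
    exact pair_row v u j
  have pair_diag : ∀ u v : Ev → ι, (∀ e, u e ≠ v e) → ∀ i, #{e | u e = i ∧ v e = i} = 0 := by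
    intro u v huv i
    rw [card_eq_zero, filter_eq_empty_iff]
    rintro e - ⟨h1, h2⟩
    exact huv e (h1.trans h2.symm)
  have split : ∀ u v : Ev → ι, (∀ e, u e ≠ v e) → (∀ i, #{e | u e = i} + b i * b i = b i * κ) →
      (∀ i, #{e | v e = i} + b i * b i = b i * κ) → (∀ i j, #{e | u e = i ∧ v e = j} ≤ b i * b j) →
      ∃ D : Fin 3 → ι → ι → ℕ,
      (∀ i j, ∑ p, D p i j + #{e | u e = i ∧ v e = j} + (if i = j then b i * b i else 0)
        = b i * b j) ∧
      (∀ p i, ∑ j, D p i j = η * b i) ∧ (∀ p j, ∑ i, D p i j = η * b j) := by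
    intro u v huv hu hv hle
    refine exists_three_split b (fun i j => #{e | u e = i ∧ v e = j}) κ η hN hle
      (pair_diag u v huv) (fun i => ?_) (fun j => ?_)
    · rw [pair_row]; exact hu i
    · rw [pair_col]; exact hv j
  obtain ⟨D₁₂, h₁₂, h₁₂r, h₁₂c⟩ := split x y hxy hx hy hxy'
  obtain ⟨D₁₃, h₁₃, h₁₃r, h₁₃c⟩ := split x s hxs hx hs hxs'
  obtain ⟨D₂₃, h₂₃, h₂₃r, h₂₃c⟩ := split y s hys hy hs hys'
  obtain ⟨g₁, hg₁, hg₁s⟩ := exists_le_sum_eq univ (fun i => ω * b i) (min (a * a) (ω * ∑ i, b i))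
    (by rw [← mul_sum]; exact min_le_right _ _)
  obtain ⟨g₂, hg⟩ : ∃ g₂ : ι → ℕ, ∀ i, g₁ i + g₂ i = ω * b i :=
    ⟨fun i => ω * b i - g₁ i, fun i => by have := hg₁ i; dsimp only at this ⊢; omega⟩
  have hgs : ∑ i, g₁ i + ∑ i, g₂ i = ω * ∑ i, b i := by
    rw [← sum_add_distrib, mul_sum]; exact sum_congr rfl fun i _ => hg i
  obtain ⟨y₁, hy₁⟩ : ∃ y₁, y₁ + ∑ i, g₁ i = a * a := ⟨a * a - ∑ i, g₁ i, by omega⟩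
  obtain ⟨y₂, hy₂⟩ : ∃ y₂, y₂ + ∑ i, g₂ i = a * a := ⟨a * a - ∑ i, g₂ i, by omega⟩
  let T : ι → ι → ι → ℕ := fun i j l =>
    #{e | (x e = i ∧ y e = j) ∧ s e = l} + if i = j ∧ j = l then b i * b i else 0
  have hT₁₂ : ∀ i j, ∑ l, T i j l =
      #{e | x e = i ∧ y e = j} + if i = j then b i * b i else 0 := by
    intro i j
    rw [sum_add_distrib, card_eq_sum_card_fiberwise (f := s) (t := univ) (by simp)]
    simp_rw [filter_filter]
    congr 1
    by_cases h : i = j <;> simp [h]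
  have hT₁₃ : ∀ i l, ∑ j, T i j l =
      #{e | x e = i ∧ s e = l} + if i = l then b i * b i else 0 := by
    intro i l
    rw [sum_add_distrib, card_eq_sum_card_fiberwise (f := y) (t := univ) (by simp)]
    simp_rw [filter_filter]
    congr 1
    · refine sum_congr rfl fun j _ => congrArg card (filter_congr fun e _ => by tauto)
    · by_cases h : i = l
      · subst h; simp only [if_true]
        rw [sum_eq_single i (by intro j _ hj; simp [hj]) (by simp)]; simp
      · rw [if_neg h]; refine sum_eq_zero fun j _ => if_neg ?_
        rintro ⟨rfl, rfl⟩; exact h rfl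
  have hT₂₃ : ∀ j l, ∑ i, T i j l =
      #{e | y e = j ∧ s e = l} + if j = l then b j * b j else 0 := by
    intro j l
    rw [sum_add_distrib, card_eq_sum_card_fiberwise (f := x) (t := univ) (by simp)]
    simp_rw [filter_filter]
    congr 1
    · refine sum_congr rfl fun j _ => congrArg card (filter_congr fun e _ => by tauto)
    · by_cases h : j = l <;> simp [h]
  have hagg : ∀ i, a * b i = g₁ i + g₂ i + η * b i := fun i => by rw [hg, ha]; ring
  refine ⟨outline a y₁ y₂ g₁ g₂ D₁₂ D₁₃ D₂₃ T, ?_, ?_, ?_, ?_⟩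
  · rintro (p | i) (q | j) <;> simp only [Fintype.sum_sum_type, Sum.elim_inl, Sum.elim_inr, outline]
    · rw [Fin.sum_univ_three]; fin_cases p <;> fin_cases q <;> simp [hy₁, hy₂]
    · rw [h₂₃r, hagg, Fin.sum_univ_three]; fin_cases p <;> simp [add_comm]
    · rw [h₁₃r, mul_comm (b i), hagg, Fin.sum_univ_three]; fin_cases q <;> simp [add_comm]
    · rw [hT₁₂, ← add_assoc, h₁₂]
  · rintro (p | i) (q | j) <;> simp only [Fintype.sum_sum_type, Sum.elim_inl, Sum.elim_inr, outline]
    · rw [Fin.sum_univ_three]; fin_cases p <;> fin_cases q <;> simp [hy₁, hy₂]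
    · rw [h₂₃c, hagg, Fin.sum_univ_three]; fin_cases p <;> simp [add_comm]
    · rw [h₁₂r, mul_comm (b i), hagg, Fin.sum_univ_three]; fin_cases q <;> simp [add_comm]
    · rw [hT₁₃, ← add_assoc, h₁₃]
  · rintro (p | i) (q | j) <;> simp only [Fintype.sum_sum_type, Sum.elim_inl, Sum.elim_inr, outline]
    · rw [Fin.sum_univ_three]; fin_cases p <;> fin_cases q <;> simp [hy₁, hy₂]
    · rw [h₁₃c, hagg, Fin.sum_univ_three]; fin_cases p <;> simp [add_comm]
    · rw [h₁₂c, mul_comm (b i), hagg, Fin.sum_univ_three]; fin_cases q <;> simp [add_comm]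
    · rw [hT₂₃, ← add_assoc, h₂₃]
  · rintro (p | i) (q | j) hne <;> simp only [outline]
    · have : q ≠ p := fun h => hne (h ▸ rfl)
      simp [this]
    · simp
    · have := h₁₂ i i
      rw [if_pos rfl] at this
      exact (sum_eq_zero_iff.1 (by omega : ∑ p, D₁₂ p i i = 0)) q (mem_univ _)
    · have : i ≠ j := fun h => hne (h ▸ rfl)
      simp only [T, this, and_false, if_false, add_zero]
      rw [card_eq_zero, filter_eq_empty_iff]
      rintro e - ⟨⟨h1, h2⟩, -⟩
      exact hxy e (h1.trans h2.symm)

/-- Starting point of the `i`-th arc on a circle cut into consecutive arcs of lengths `m 0, m 1, …`. -/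
def arcStart (m : ℕ → ℕ) (i : ℕ) : ℕ := ∑ h ∈ range i, m h

/-- Index of the arc containing the point `n` on the circle formed by the arcs `0, …, r - 1`. -/
def arcIndex (m : ℕ → ℕ) (r n : ℕ) : ℕ :=
  Nat.findGreatest (fun i => arcStart m i ≤ n % arcStart m r) r

/-- Position of the point `n` within its arc. -/
def arcOffset (m : ℕ → ℕ) (r n : ℕ) : ℕ := n % arcStart m r - arcStart m (arcIndex m r n)

/-- Arcs met strictly between arc `i` and arc `j`, going forward. -/
def arcsBetween (r i j : ℕ) : Finset ℕ :=
  if i < j then Ico (i + 1) j else Ico (i + 1) r ∪ range j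

section Arcs

variable {m : ℕ → ℕ} {r : ℕ}

theorem arcStart_succ (m : ℕ → ℕ) (i : ℕ) : arcStart m (i + 1) = arcStart m i + m i :=
  sum_range_succ m i

theorem arcStart_mono (m : ℕ → ℕ) : Monotone (arcStart m) :=
  monotone_nat_of_le_succ fun i => by rw [arcStart_succ]; omega

theorem arcIndex_spec (hr : 0 < arcStart m r) (n : ℕ) :
    arcIndex m r n < r ∧ n % arcStart m r = arcStart m (arcIndex m r n) + arcOffset m r n ∧
      arcOffset m r n < m (arcIndex m r n) := by
  have hlt := Nat.mod_lt n hr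
  have h0 : arcStart m (arcIndex m r n) ≤ n % arcStart m r :=
    Nat.findGreatest_spec (P := fun i => arcStart m i ≤ n % arcStart m r) (Nat.zero_le r)
      (by simp [arcStart])
  have h1 : arcIndex m r n < r := by
    rcases (Nat.findGreatest_le (P := fun i => arcStart m i ≤ n % arcStart m r) r).lt_or_eq with h | h
    · exact h
    · have h' : arcIndex m r n = r := h
      rw [h'] at h0; omega
  have h2 : ¬ arcStart m (arcIndex m r n + 1) ≤ n % arcStart m r :=
    Nat.findGreatest_is_greatest (P := fun i => arcStart m i ≤ n % arcStart m r)
      (Nat.lt_succ_self _) h1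
  rw [arcStart_succ] at h2
  have : arcOffset m r n = n % arcStart m r - arcStart m (arcIndex m r n) := rfl
  omega

theorem arcIndex_eq_iff {n i : ℕ} (hr : 0 < arcStart m r) :
    arcIndex m r n = i ↔ arcStart m i ≤ n % arcStart m r ∧ n % arcStart m r < arcStart m (i + 1) := by
  obtain ⟨h1, h2, h3⟩ := arcIndex_spec hr n
  have h4 := arcStart_succ m (arcIndex m r n)
  constructor
  · rintro rfl; omega
  · rintro ⟨ha, hb⟩
    by_contra hne
    rcases lt_or_gt_of_ne hne with h | h
    · have := arcStart_mono m h; simp only [Nat.succ_eq_add_one] at this; omega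
    · have := arcStart_mono m h; simp only [Nat.succ_eq_add_one] at this; omega

theorem card_arcIndex_eq {i : ℕ} (hi : i < r) (d : ℕ) :
    #{n ∈ range (arcStart m r) | arcIndex m r (n + d) = i} = m i := by
  rcases Nat.eq_zero_or_pos (arcStart m r) with h0 | hr
  · have := arcStart_mono m hi
    simp only [Nat.succ_eq_add_one, arcStart_succ] at this
    simp [h0]; omega
  have hper : Function.Periodic (fun n => arcIndex m r n = i) (arcStart m r) := by
    intro n; simp [arcIndex]
  have h1 := Nat.filter_Ico_card_eq_of_periodic d (arcStart m r) _ hper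
  rw [Nat.count_eq_card_filter_range] at h1
  have h2 : ({n ∈ Ico d (d + arcStart m r) | arcIndex m r n = i} : Finset ℕ) =
      ({n ∈ range (arcStart m r) | arcIndex m r (n + d) = i}).map (addRightEmbedding d) := by
    ext n
    simp only [mem_filter, mem_Ico, mem_map, mem_range, addRightEmbedding_apply]
    constructor
    · rintro ⟨⟨ha, hb⟩, hc⟩
      exact ⟨n - d, ⟨by omega, by rwa [Nat.sub_add_cancel ha]⟩, by omega⟩
    · rintro ⟨k, ⟨ha, hb⟩, rfl⟩
      exact ⟨by omega, hb⟩
  rw [h2, card_map] at h1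
  rw [h1]
  have h3 : ({n ∈ range (arcStart m r) | arcIndex m r n = i} : Finset ℕ) =
      Ico (arcStart m i) (arcStart m (i + 1)) := by
    ext n
    have := arcStart_mono m (Nat.succ_le_of_lt hi)
    simp only [Nat.succ_eq_add_one] at this
    simp only [mem_filter, mem_range, mem_Ico]
    rw [arcIndex_eq_iff hr]
    constructor
    · rintro ⟨ha, hb⟩; rwa [Nat.mod_eq_of_lt ha] at hb
    · rintro ⟨ha, hb⟩
      have hn : n < arcStart m r := by omega
      rw [Nat.mod_eq_of_lt hn]; omega
  rw [h3, Nat.card_Ico, arcStart_succ]; omega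

theorem arcStart_add_sum_arcsBetween_of_lt (m : ℕ → ℕ) {i j : ℕ} (hij : i < j) :
    arcStart m i + m i + ∑ h ∈ arcsBetween r i j, m h = arcStart m j := by
  rw [arcsBetween, if_pos hij, ← arcStart_succ]
  exact sum_range_add_sum_Ico m hij

theorem arcStart_add_sum_arcsBetween_of_gt (m : ℕ → ℕ) {i j : ℕ} (hij : j < i) (hi : i < r) :
    arcStart m i + m i + ∑ h ∈ arcsBetween r i j, m h = arcStart m r + arcStart m j := by
  rw [arcsBetween, if_neg (by omega), ← arcStart_succ, sum_union, ← add_assoc]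
  · congr 1
    exact sum_range_add_sum_Ico m hi
  · rw [disjoint_left]; intro x; simp; omega

theorem sum_arcsBetween_add (m : ℕ → ℕ) {i j : ℕ} (hi : i < r) (hj : j < r) (hij : i ≠ j) :
    ∑ h ∈ arcsBetween r i j, m h + ∑ h ∈ arcsBetween r j i, m h + m i + m j = arcStart m r := by
  rcases lt_or_gt_of_ne hij with h | h
  · have := arcStart_add_sum_arcsBetween_of_lt (r := r) m h
    have := arcStart_add_sum_arcsBetween_of_gt m h hj
    omega
  · have := arcStart_add_sum_arcsBetween_of_lt (r := r) m h
    have := arcStart_add_sum_arcsBetween_of_gt m h hi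
    omega

theorem mod_add_cases (x : ℕ) {d k : ℕ} (hd : d < k) :
    (x + d) % k = x % k + d ∨ (x + d) % k + k = x % k + d := by
  have hx := Nat.mod_lt x (by omega : 0 < k)
  rw [Nat.add_mod, Nat.mod_eq_of_lt hd]
  rcases Nat.lt_or_ge (x % k + d) k with h | h
  · left; exact Nat.mod_eq_of_lt h
  · right; rw [Nat.mod_eq_sub_mod h, Nat.mod_eq_of_lt (by omega)]; omega

/-- A jump of length at least that of the current arc, and short of a full turn by at least as much,
leaves the arc. -/
theorem arcIndex_ne_of_jump {n d : ℕ} (hr : 0 < arcStart m r)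
    (h1 : m (arcIndex m r n) ≤ d) (h2 : d + m (arcIndex m r n) ≤ arcStart m r) :
    arcIndex m r n ≠ arcIndex m r (n + d) := by
  intro h
  obtain ⟨-, ha, hb⟩ := arcIndex_spec hr n
  obtain ⟨-, hc, hd⟩ := arcIndex_spec hr (n + d)
  rw [← h] at hc hd
  have := mod_add_cases n (show d < arcStart m r by omega)
  omega

/-- Length of a jump from arc `i` to a different arc `j`. -/
theorem jump_eq {n d : ℕ} (hr : 0 < arcStart m r) (hd : d < arcStart m r)
    (hne : arcIndex m r n ≠ arcIndex m r (n + d)) :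
    d + arcOffset m r n = m (arcIndex m r n) +
      ∑ h ∈ arcsBetween r (arcIndex m r n) (arcIndex m r (n + d)), m h + arcOffset m r (n + d) := by
  obtain ⟨ha, hb, hc⟩ := arcIndex_spec hr n
  obtain ⟨ha', hb', hc'⟩ := arcIndex_spec hr (n + d)
  have := mod_add_cases n hd
  have hlt := Nat.mod_lt n hr
  have hlt' := Nat.mod_lt (n + d) hr
  rcases lt_or_gt_of_ne hne with h | h
  · have := arcStart_add_sum_arcsBetween_of_lt (r := r) m h
    omega
  · have := arcStart_add_sum_arcsBetween_of_gt m h ha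
    have := arcStart_add_sum_arcsBetween_of_lt (r := r) m h
    omega

end Arcs

/-- Raising the cap `c` raises a capped sum lying below `μ * c` more slowly than `μ * c`. -/
theorem sum_min_growth (B : Finset ℕ) (b : ℕ → ℕ) {μ c c' : ℕ} (hcc : c < c')
    (hlt : ∑ h ∈ B, min c (b h) < μ * c) :
    ∑ h ∈ B, min c' (b h) + μ * c < ∑ h ∈ B, min c (b h) + μ * c' := by
  set q := #{h ∈ B | c < b h}
  have h1 : q * c ≤ ∑ h ∈ B, min c (b h) := by
    rw [← smul_eq_mul]
    refine (card_nsmul_le_sum _ _ c fun h hh => ?_).trans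
      (sum_le_sum_of_subset (filter_subset (fun h => c < b h) B))
    rw [mem_filter] at hh; omega
  have h2 : q < μ := lt_of_mul_lt_mul_right (h1.trans_lt hlt) (Nat.zero_le c)
  have h3 : ∑ h ∈ B, min c' (b h) ≤ ∑ h ∈ B, min c (b h) + q * (c' - c) := by
    have : q * (c' - c) = ∑ h ∈ B, if c < b h then c' - c else 0 := by
      rw [← sum_filter, sum_const, smul_eq_mul]
    rw [this, ← sum_add_distrib]
    refine sum_le_sum fun h _ => ?_
    split_ifs <;> omega
  obtain ⟨t, rfl⟩ := Nat.exists_eq_add_of_lt hcc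
  rw [show c + t + 1 - c = t + 1 by omega] at h3
  nlinarith [Nat.mul_le_mul_right (t + 1) (Nat.succ_le_of_lt h2)]

/-- The jump length in layer `c`. -/
def jumpLength (β μ ε c : ℕ) : ℕ := μ * c + if β ≤ c then ε else 0

theorem sum_min_eq_of_le {B : Finset ℕ} {b : ℕ → ℕ} {β c : ℕ} (hb : ∀ h ∈ B, b h ≤ β)
    (hc : β ≤ c) : ∑ h ∈ B, min c (b h) = ∑ h ∈ B, b h :=
  sum_congr rfl fun h hh => min_eq_right ((hb h hh).trans hc)

theorem jumpLength_growth {B : Finset ℕ} {b : ℕ → ℕ} {β μ ε c c' : ℕ} (hb : ∀ h ∈ B, b h ≤ β)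
    (hμ : 0 < μ) (hcc : c < c') (hlt : ∑ h ∈ B, min c (b h) < jumpLength β μ ε c) :
    ∑ h ∈ B, min c' (b h) + jumpLength β μ ε c < ∑ h ∈ B, min c (b h) + jumpLength β μ ε c' := by
  unfold jumpLength at *
  rcases Nat.lt_or_ge c β with h | h
  · rw [if_neg (by omega)] at *
    have := sum_min_growth B b hcc hlt
    omega
  · rw [sum_min_eq_of_le hb h, sum_min_eq_of_le hb (by omega), if_pos h, if_pos (by omega)]
    have := Nat.mul_lt_mul_of_pos_left hcc hμ
    omega

theorem two_mul_sum_min (b C : ℕ) (hb : b ≤ C + 1) :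
    2 * ∑ c ∈ range C, min (c + 1) b + b * b = b * (2 * C + 1) := by
  induction C generalizing b with
  | zero => interval_cases b <;> simp
  | succ C ih =>
    rcases hb.lt_or_eq with h | rfl
    · rw [sum_range_succ, min_eq_right (by omega)]
      have := ih b (by omega)
      nlinarith
    · rw [sum_congr rfl (g := fun c => c + 1) fun c hc => min_eq_left (by
        have := mem_range.1 hc; omega), sum_add_distrib]
      have := Finset.sum_range_id_mul_two (C + 1)
      simp only [sum_const, card_range, smul_eq_mul, mul_one, Nat.add_sub_cancel] at this ⊢
      nlinarith

section Layers

variable (b : ℕ → ℕ) (r C C' : ℕ)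

theorem lt_of_mem_arcsBetween {r i j h : ℕ} (hj : j < r)
    (hh : h ∈ arcsBetween r i j) : h < r := by
  unfold arcsBetween at hh
  split_ifs at hh
  · simp only [mem_Ico] at hh; omega
  · simp only [mem_union, mem_Ico, mem_range] at hh; omega

/-- Circumference of the circle in layer `c`, whose arcs have lengths `min c (b h)`. -/
abbrev layerSize (c : ℕ) : ℕ := arcStart (fun h => min c (b h)) r

/-- Class of a point of the circle in layer `c`. -/
abbrev layerClass (c n : ℕ) : ℕ := arcIndex (fun h => min c (b h)) r n

/-- Points of the forward layers `1, …, C` and of the backward layers `1, …, C'`. -/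
abbrev LayerPoint : Type :=
  (Σ c : Fin C, Fin (layerSize b r (c + 1))) ⊕ (Σ c : Fin C', Fin (layerSize b r (c + 1)))

/-- Points shifted by `o` in forward layers and by `o'` in backward layers. -/
def shiftedClass (o o' : ℕ → ℕ) : LayerPoint b r C C' → ℕ
  | .inl ⟨c, n⟩ => layerClass b r (c + 1) (n + o (c + 1))
  | .inr ⟨c, n⟩ => layerClass b r (c + 1) (n + o' (c + 1))

variable {b r C C'}

theorem card_shiftedClass_eq {i : ℕ} (hi : i < r) (o o' : ℕ → ℕ) :
    #{e : LayerPoint b r C C' | shiftedClass b r C C' o o' e = i} =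
      ∑ c ∈ range C, min (c + 1) (b i) + ∑ c ∈ range C', min (c + 1) (b i) := by
  have key : ∀ (D : ℕ) (f : ℕ → ℕ), #{e : Σ c : Fin D, Fin (layerSize b r (c + 1)) |
      layerClass b r (e.1 + 1) (e.2 + f (e.1 + 1)) = i} = ∑ c ∈ range D, min (c + 1) (b i) := by
    intro D f
    rw [← Fin.sum_univ_eq_sum_range (fun c => min (c + 1) (b i))]
    rw [card_eq_sum_card_fiberwise (f := Sigma.fst) (t := univ) (by simp)]
    refine sum_congr rfl fun c _ => ?_
    rw [← card_arcIndex_eq (m := fun h => min (c + 1) (b h)) hi (f (c + 1)), filter_filter]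
    refine card_bij' (fun e _ => e.2) (fun n hn => ⟨c, n, mem_range.1 (mem_filter.1 hn).1⟩) ?_ ?_ ?_ ?_
    · rintro ⟨c', n⟩ h
      simp only [mem_filter, mem_univ, true_and] at h
      obtain ⟨h, rfl⟩ := h
      simp only [mem_filter, mem_range]
      exact ⟨n.2, h⟩
    · intro n hn
      simpa using (mem_filter.1 hn).2
    · rintro ⟨c', n⟩ h
      simp only [mem_filter, mem_univ, true_and] at h
      obtain ⟨h, rfl⟩ := h
      rfl
    · intro n hn; rfl
  rw [card_filter, Fintype.sum_sum_type, ← key C o, ← key C' o', card_filter, card_filter]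
  rfl

theorem shiftedClass_lt (o o' : ℕ → ℕ) (e : LayerPoint b r C C') :
    shiftedClass b r C C' o o' e < r := by
  rcases e with ⟨c, n⟩ | ⟨c, n⟩ <;> exact (arcIndex_spec ((Nat.zero_le _).trans_lt n.2) _).1

theorem layer_jump_facts {c p d i j : ℕ} (hd : d < layerSize b r c) (hi : layerClass b r c p = i)
    (hj : layerClass b r c (p + d) = j) (hij : i ≠ j) :
    arcOffset (fun h => min c (b h)) r p < min c (b i) ∧
    arcOffset (fun h => min c (b h)) r (p + d) < min c (b j) ∧
    d + arcOffset (fun h => min c (b h)) r p = min c (b i) +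
      ∑ h ∈ arcsBetween r i j, min c (b h) + arcOffset (fun h => min c (b h)) r (p + d) := by
  have hr : 0 < layerSize b r c := by omega
  subst hi hj
  exact ⟨(arcIndex_spec hr _).2.2, (arcIndex_spec hr _).2.2, jump_eq hr hd hij⟩

theorem layer_point_unique {c p n n' : ℕ} (hn : n < layerSize b r c) (hn' : n' < layerSize b r c)
    (h1 : layerClass b r c (n + p) = layerClass b r c (n' + p))
    (h2 : arcOffset (fun h => min c (b h)) r (n + p) =
      arcOffset (fun h => min c (b h)) r (n' + p)) : n = n' := by
  have hr : 0 < layerSize b r c := by omega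
  have h3 := (arcIndex_spec hr (n + p)).2.1
  have h4 := (arcIndex_spec hr (n' + p)).2.1
  rw [show arcIndex _ r (n + p) = _ from h1, h2, ← h4] at h3
  have h5 := Nat.ModEq.add_right_cancel' p h3
  exact (Nat.mod_eq_of_lt hn).symm.trans (Eq.trans h5 (Nat.mod_eq_of_lt hn'))

theorem layer_eq_of_gap_eq {B : Finset ℕ} {β μ ε c c' : ℕ} (hb : ∀ h ∈ B, b h ≤ β)
    (hμ : 0 < μ) (hlt : ∑ h ∈ B, min c (b h) < jumpLength β μ ε c)
    (hlt' : ∑ h ∈ B, min c' (b h) < jumpLength β μ ε c')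
    (heq : ∑ h ∈ B, min c' (b h) + jumpLength β μ ε c =
      ∑ h ∈ B, min c (b h) + jumpLength β μ ε c') : c = c' := by
  rcases lt_trichotomy c c' with h | h | h
  · have := jumpLength_growth hb hμ h hlt; omega
  · exact h
  · have := jumpLength_growth hb hμ h hlt'; omega

/-- A forward jump from `i` to `j` and a backward jump from `j` to `i` never close up to a full
turn (after replacing the capped arcs at `i` and `j` by the full ones). -/
theorem gap_add_gap_ne {β μ ε c c' i j : ℕ} (hb : ∀ h < r, b h ≤ β) (hμ : 0 < μ)
    (hi : i < r) (hj : j < r) (hij : i ≠ j) (hcC : c ≤ C) (hcC' : c' ≤ C')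
    (hne : ∀ c c', β ≤ c → c ≤ C → β ≤ c' → c' ≤ C' →
      jumpLength β μ 0 c + jumpLength β μ ε c' ≠ arcStart b r)
    (hβ' : ∀ c', β ≤ c' → c' ≤ max C' β → μ * β + jumpLength β μ ε c' ≤ arcStart b r)
    (hβ : ∀ c ≤ C, μ * β + jumpLength β μ 0 c ≤ arcStart b r)
    (hlt : ∑ h ∈ arcsBetween r i j, min c (b h) < jumpLength β μ 0 c)
    (hlt' : ∑ h ∈ arcsBetween r j i, min c' (b h) < jumpLength β μ ε c') :
    jumpLength β μ 0 c + jumpLength β μ ε c' ≠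
      b i + b j + ∑ h ∈ arcsBetween r i j, min c (b h) +
        ∑ h ∈ arcsBetween r j i, min c' (b h) := by
  intro heq
  have hbet : ∀ i j, i < r → j < r → ∀ h ∈ arcsBetween r i j, b h ≤ β :=
    fun _ _ _ hj h hh => hb h (lt_of_mem_arcsBetween hj hh)
  have hbij := hbet i j hi hj
  have hbji := hbet j i hj hi
  have hsum := sum_arcsBetween_add b hi hj hij
  rcases Nat.lt_or_ge c β with hc | hc
  · have h1 := jumpLength_growth hbij hμ hc hlt
    rw [sum_min_eq_of_le hbij le_rfl] at h1
    have e1 : jumpLength β μ 0 β = μ * β := by simp [jumpLength]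
    rcases Nat.lt_or_ge c' β with hc' | hc'
    · have h2 := jumpLength_growth hbji hμ hc' hlt'
      rw [sum_min_eq_of_le hbji le_rfl] at h2
      have := hβ' β le_rfl (le_max_right _ _)
      omega
    · rw [sum_min_eq_of_le hbji hc'] at heq
      have := hβ' c' hc' (by omega)
      omega
  · rw [sum_min_eq_of_le hbij hc] at heq
    rcases Nat.lt_or_ge c' β with hc' | hc'
    · have e1 : ∀ c' < β, jumpLength β μ ε c' = jumpLength β μ 0 c' := by
        intro c' h; simp [jumpLength]; omega
      rw [e1 c' hc'] at hlt' heq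
      have h2 := jumpLength_growth hbji hμ hc' hlt'
      rw [sum_min_eq_of_le hbji le_rfl] at h2
      have e2 : jumpLength β μ 0 β = μ * β := by simp [jumpLength]
      have := hβ c hcC
      omega
    · rw [sum_min_eq_of_le hbji hc'] at heq
      have := hne c c' hc hcC hc' hcC'
      omega

theorem card_shiftedClass_pair_le {β μ ε i j : ℕ} (o o' p p' : ℕ → ℕ) (hb : ∀ h < r, b h ≤ β)
    (hμ : 0 < μ) (hi : i < r) (hj : j < r) (hij : i ≠ j)
    (hp : ∀ c, p c = o c + jumpLength β μ 0 c) (hp' : ∀ c, o' c = p' c + jumpLength β μ ε c)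
    (hjf : ∀ c, 1 ≤ c → c ≤ C → jumpLength β μ 0 c < layerSize b r c)
    (hjb : ∀ c, 1 ≤ c → c ≤ C' → jumpLength β μ ε c < layerSize b r c)
    (hne : ∀ c c', β ≤ c → c ≤ C → β ≤ c' → c' ≤ C' →
      jumpLength β μ 0 c + jumpLength β μ ε c' ≠ arcStart b r)
    (hβ' : ∀ c', β ≤ c' → c' ≤ max C' β → μ * β + jumpLength β μ ε c' ≤ arcStart b r)
    (hβ : ∀ c ≤ C, μ * β + jumpLength β μ 0 c ≤ arcStart b r) :
    #{e : LayerPoint b r C C' | shiftedClass b r C C' o o' e = i ∧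
      shiftedClass b r C C' p p' e = j} ≤ b i * b j := by
  have hbet : ∀ i j, i < r → j < r → ∀ h ∈ arcsBetween r i j, b h ≤ β :=
    fun _ _ _ hj h hh => hb h (lt_of_mem_arcsBetween hj hh)
  let off : ℕ → ℕ → ℕ := fun c n => arcOffset (fun h => min c (b h)) r n
  let f : LayerPoint b r C C' → ℕ × ℕ := Sum.elim
    (fun e => (b i - min ((e.1 : ℕ) + 1) (b i) + off (e.1 + 1) (e.2 + o (e.1 + 1)),
      off (e.1 + 1) (e.2 + p (e.1 + 1))))
    (fun e => (off (e.1 + 1) (e.2 + o' (e.1 + 1)),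
      b j - min ((e.1 : ℕ) + 1) (b j) + off (e.1 + 1) (e.2 + p' (e.1 + 1))))
  have fwd : ∀ (c : Fin C) (n : Fin (layerSize b r (c + 1))),
      shiftedClass b r C C' o o' (.inl ⟨c, n⟩) = i → shiftedClass b r C C' p p' (.inl ⟨c, n⟩) = j →
      off (c + 1) (n + o (c + 1)) < min ((c : ℕ) + 1) (b i) ∧
      off (c + 1) (n + p (c + 1)) < min ((c : ℕ) + 1) (b j) ∧
      jumpLength β μ 0 (c + 1) + off (c + 1) (n + o (c + 1)) = min ((c : ℕ) + 1) (b i) +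
      ∑ h ∈ arcsBetween r i j, min ((c : ℕ) + 1) (b h) + off (c + 1) (n + p (c + 1)) := by
    intro c n h1 h2
    have hp1 : (n : ℕ) + p (c + 1) = n + o (c + 1) + jumpLength β μ 0 (c + 1) := by
      rw [hp]; ring
    simp only [shiftedClass, hp1] at h1 h2
    rw [hp1]
    exact layer_jump_facts (hjf _ (by omega) (by omega)) h1 h2 hij
  have bwd : ∀ (c : Fin C') (n : Fin (layerSize b r (c + 1))),
      shiftedClass b r C C' o o' (.inr ⟨c, n⟩) = i → shiftedClass b r C C' p p' (.inr ⟨c, n⟩) = j →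
      off (c + 1) (n + p' (c + 1)) < min ((c : ℕ) + 1) (b j) ∧
      off (c + 1) (n + o' (c + 1)) < min ((c : ℕ) + 1) (b i) ∧
      jumpLength β μ ε (c + 1) + off (c + 1) (n + p' (c + 1)) = min ((c : ℕ) + 1) (b j) +
      ∑ h ∈ arcsBetween r j i, min ((c : ℕ) + 1) (b h) + off (c + 1) (n + o' (c + 1)) := by
    intro c n h1 h2
    have hp1 : (n : ℕ) + o' (c + 1) = n + p' (c + 1) + jumpLength β μ ε (c + 1) := by
      rw [hp']; ring
    simp only [shiftedClass, hp1] at h1 h2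
    rw [hp1]
    exact layer_jump_facts (hjb _ (by omega) (by omega)) h2 h1 hij.symm
  have cross : ∀ (c : Fin C) (n : Fin (layerSize b r (c + 1))) (c' : Fin C')
      (n' : Fin (layerSize b r (c' + 1))),
      shiftedClass b r C C' o o' (.inl ⟨c, n⟩) = i → shiftedClass b r C C' p p' (.inl ⟨c, n⟩) = j →
      shiftedClass b r C C' o o' (.inr ⟨c', n'⟩) = i →
      shiftedClass b r C C' p p' (.inr ⟨c', n'⟩) = j → f (.inl ⟨c, n⟩) ≠ f (.inr ⟨c', n'⟩) := by
    intro c n c' n' h1 h2 h1' h2' heq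
    have F := fwd c n h1 h2
    have G := bwd c' n' h1' h2'
    simp only [f, Sum.elim_inl, Sum.elim_inr, Prod.mk.injEq] at heq
    have := gap_add_gap_ne hb hμ hi hj hij (by omega : (c : ℕ) + 1 ≤ C)
      (by omega : (c' : ℕ) + 1 ≤ C') hne hβ' hβ (by omega) (by omega)
    have m1 := min_le_right ((c : ℕ) + 1) (b i)
    have m2 := min_le_right ((c' : ℕ) + 1) (b j)
    generalize min ((c : ℕ) + 1) (b i) = x at *
    generalize min ((c' : ℕ) + 1) (b j) = y at *
    omega
  rw [← card_range (b i), ← card_range (b j), ← card_product]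
  refine card_le_card_of_injOn f ?_ ?_
  · rintro (⟨c, n⟩ | ⟨c, n⟩) he
    · simp only [coe_filter, mem_univ, true_and, Set.mem_ofPred_eq] at he
      have F := fwd c n he.1 he.2
      simp only [f, Sum.elim_inl, coe_product, Set.mem_prod, coe_range, Set.mem_Iio]
      omega
    · simp only [coe_filter, mem_univ, true_and, Set.mem_ofPred_eq] at he
      have F := bwd c n he.1 he.2
      simp only [f, Sum.elim_inr, coe_product, Set.mem_prod, coe_range, Set.mem_Iio]
      omega
  · rintro (⟨c, n⟩ | ⟨c, n⟩) he (⟨c', n'⟩ | ⟨c', n'⟩) he' heq <;>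
      simp only [coe_filter, mem_univ, true_and, Set.mem_ofPred_eq] at he he'
    · have F := fwd c n he.1 he.2
      have F' := fwd c' n' he'.1 he'.2
      simp only [f, Sum.elim_inl, Prod.mk.injEq] at heq
      have m1 := min_le_right ((c : ℕ) + 1) (b i)
      have m2 := min_le_right ((c' : ℕ) + 1) (b i)
      have hcc := layer_eq_of_gap_eq (c := c + 1) (c' := c' + 1) (ε := 0) (hbet i j hi hj) hμ
        (by omega) (by omega) (by
          generalize min ((c : ℕ) + 1) (b i) = x at *
          generalize min ((c' : ℕ) + 1) (b i) = y at *
          omega)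
      obtain rfl : c = c' := Fin.ext (by omega)
      obtain rfl : n = n' := Fin.ext (layer_point_unique n.2 n'.2 (he.1.trans he'.1.symm)
        (Nat.add_left_cancel heq.1))
      rfl
    · exact absurd heq (cross c n c' n' he.1 he.2 he'.1 he'.2)
    · exact absurd heq.symm (cross c' n' c n he'.1 he'.2 he.1 he.2)
    · have F := bwd c n he.1 he.2
      have F' := bwd c' n' he'.1 he'.2
      simp only [f, Sum.elim_inr, Prod.mk.injEq] at heq
      have m1 := min_le_right ((c : ℕ) + 1) (b j)
      have m2 := min_le_right ((c' : ℕ) + 1) (b j)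
      have hcc := layer_eq_of_gap_eq (c := c + 1) (c' := c' + 1) (ε := ε) (hbet j i hj hi) hμ
        (by omega) (by omega) (by
          generalize min ((c : ℕ) + 1) (b j) = x at *
          generalize min ((c' : ℕ) + 1) (b j) = y at *
          omega)
      obtain rfl : c = c' := Fin.ext (by omega)
      obtain rfl : n = n' := Fin.ext (layer_point_unique n.2 n'.2 (he.2.trans he'.2.symm)
        (Nat.add_left_cancel heq.2))
      rfl

end Layers

section Layers

variable {b : ℕ → ℕ} {r C C' : ℕ}

theorem layerSize_of_le {β c : ℕ} (hb : ∀ h < r, b h ≤ β) (hc : β ≤ c) :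
    layerSize b r c = arcStart b r :=
  sum_min_eq_of_le (fun h hh => hb h (mem_range.1 hh)) hc

theorem four_mul_le_layerSize {β c : ℕ} (hb : ∀ h < r, b h ≤ β) (hN : 4 * β ≤ arcStart b r)
    (hc : c < β) : 4 * c ≤ layerSize b r c := by
  have h1 : c * arcStart b r ≤ β * layerSize b r c := by
    simp only [layerSize, arcStart, mul_sum]
    refine sum_le_sum fun h hh => ?_
    have := hb h (mem_range.1 hh)
    rcases Nat.le_total c (b h) with h' | h'
    · rw [min_eq_left h', mul_comm]; exact Nat.mul_le_mul_right c this
    · rw [min_eq_right h']; exact Nat.mul_le_mul_right _ hc.le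
  refine Nat.le_of_mul_le_mul_left (c := β) ?_ (by omega)
  nlinarith [Nat.mul_le_mul_left c hN]

theorem jumpLength_add_le_layerSize {β μ ε c : ℕ} (hb : ∀ h < r, b h ≤ β)
    (hN : 4 * β ≤ arcStart b r) (hμ : μ ≤ 2)
    (hc : β ≤ c → 2 * c + ε + β ≤ arcStart b r) :
    jumpLength β μ ε c + min c β ≤ layerSize b r c := by
  have hμc := Nat.mul_le_mul_right c hμ
  unfold jumpLength
  rcases Nat.lt_or_ge c β with h | h
  · have := four_mul_le_layerSize hb hN h
    rw [if_neg (by omega)]; omega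
  · rw [layerSize_of_le hb h, if_pos h]
    have := hc h; omega

theorem shiftedClass_ne {β μ ε : ℕ} (o o' p p' : ℕ → ℕ) (hb : ∀ h < r, b h ≤ β) (hμ : 0 < μ)
    (hp : ∀ c, p c = o c + jumpLength β μ 0 c) (hp' : ∀ c, o' c = p' c + jumpLength β μ ε c)
    (hjf : ∀ c, 1 ≤ c → c ≤ C → jumpLength β μ 0 c + min c β ≤ layerSize b r c)
    (hjb : ∀ c, 1 ≤ c → c ≤ C' → jumpLength β μ ε c + min c β ≤ layerSize b r c)
    (e : LayerPoint b r C C') :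
    shiftedClass b r C C' o o' e ≠ shiftedClass b r C C' p p' e := by
  have key : ∀ ε c n, 0 < layerSize b r c → jumpLength β μ ε c + min c β ≤ layerSize b r c →
      layerClass b r c n ≠ layerClass b r c (n + jumpLength β μ ε c) := by
    intro ε c n hpos hle
    have h1 := hb _ (arcIndex_spec hpos n).1
    have h2 : c ≤ jumpLength β μ ε c :=
      (Nat.le_mul_of_pos_left c hμ).trans (Nat.le_add_right _ _)
    refine arcIndex_ne_of_jump hpos ?_ ?_
    · exact (min_le_left _ _).trans h2
    · exact (Nat.add_le_add_left (min_le_min_left c h1) _).trans hle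
  rcases e with ⟨c, n⟩ | ⟨c, n⟩
  · simp only [shiftedClass]
    rw [hp, ← add_assoc]
    exact key 0 _ _ ((Nat.zero_le _).trans_lt n.2) (hjf _ (by omega) (by omega))
  · simp only [shiftedClass]
    rw [hp', ← add_assoc]
    exact (key ε _ _ ((Nat.zero_le _).trans_lt n.2) (hjb _ (by omega) (by omega))).symm

end Layers

theorem exists_triples (b : ℕ → ℕ) (r β κ : ℕ) (hb : ∀ h < r, b h ≤ β) (hβ : 1 ≤ β)
    (hN : 4 * β + 1 ≤ arcStart b r) (hκ : 2 * β ≤ κ + 1) (hκN : κ + 2 * β ≤ arcStart b r) :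
    ∃ (Ev : Type) (_ : Fintype Ev) (x y s : Ev → Fin r),
      ((∀ e, x e ≠ y e) ∧ (∀ e, x e ≠ s e) ∧ (∀ e, y e ≠ s e)) ∧
      ((∀ i, #{e | x e = i} + b i * b i = b i * κ) ∧
        (∀ i, #{e | y e = i} + b i * b i = b i * κ) ∧
        (∀ i, #{e | s e = i} + b i * b i = b i * κ)) ∧
      (∀ i j, #{e | x e = i ∧ y e = j} ≤ b i * b j) ∧
      (∀ i j, #{e | x e = i ∧ s e = j} ≤ b i * b j) ∧
      (∀ i j, #{e | y e = i ∧ s e = j} ≤ b i * b j) := by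
  obtain ⟨C, C', hC, hC', hCC⟩ : ∃ C C', 2 * C ≤ κ ∧ 2 * C' + 1 ≤ κ ∧ C + C' + 1 = κ :=
    ⟨κ / 2, κ - 1 - κ / 2, by omega, by omega, by omega⟩
  obtain ⟨ε, hε, hpar⟩ : ∃ ε ≤ 1, ∀ t, 2 * t + ε ≠ arcStart b r :=
    ⟨1 - arcStart b r % 2, by omega, fun t => by omega⟩
  let cls : (ℕ → ℕ) → (ℕ → ℕ) → LayerPoint b r C C' → Fin r := fun o o' e =>
    ⟨shiftedClass b r C C' o o' e, shiftedClass_lt o o' e⟩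
  have margin : ∀ o o' i, #{e | cls o o' e = i} + b i * b i = b i * κ := by
    intro o o' i
    simp only [cls, Fin.ext_iff]
    rw [card_shiftedClass_eq i.2]
    have := hb i i.2
    have h1 := two_mul_sum_min (b i) C (by omega)
    have h2 := two_mul_sum_min (b i) C' (by omega)
    rw [← hCC]
    nlinarith
  have pair : ∀ μ ε' (o o' p p' : ℕ → ℕ), 0 < μ → μ ≤ 2 → ε' ≤ 1 → (μ = 2 → ε' = ε) →
      (∀ c, p c = o c + jumpLength β μ 0 c) → (∀ c, o' c = p' c + jumpLength β μ ε' c) →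
      (∀ e, cls o o' e ≠ cls p p' e) ∧
      ∀ i j, #{e | cls o o' e = i ∧ cls p p' e = j} ≤ b i * b j := by
    intro μ ε' o o' p p' hμ hμ2 hε' hμε hp hp'
    have hjf : ∀ c, 1 ≤ c → c ≤ C → jumpLength β μ 0 c + min c β ≤ layerSize b r c :=
      fun c _ hc => jumpLength_add_le_layerSize hb (by omega) hμ2 (by omega)
    have hjb : ∀ c, 1 ≤ c → c ≤ C' → jumpLength β μ ε' c + min c β ≤ layerSize b r c :=
      fun c _ hc => jumpLength_add_le_layerSize hb (by omega) hμ2 (by omega)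
    have hne : ∀ e, cls o o' e ≠ cls p p' e := fun e he =>
      shiftedClass_ne o o' p p' hb hμ hp hp' hjf hjb e (congrArg Fin.val he)
    refine ⟨hne, fun i j => ?_⟩
    rcases eq_or_ne i j with rfl | hij
    · rw [card_eq_zero.2]
      · exact Nat.zero_le _
      · rw [filter_eq_empty_iff]
        rintro e - ⟨h1, h2⟩
        exact hne e (h1.trans h2.symm)
    simp only [cls, Fin.ext_iff]
    refine card_shiftedClass_pair_le o o' p p' hb hμ i.2 j.2 (Fin.val_ne_of_ne hij) hp hp'
      (fun c h1 h2 => ?_) (fun c h1 h2 => ?_) (fun c c' h1 h2 h3 h4 => ?_) (fun c' h1 h2 => ?_)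
      (fun c hc => ?_)
    · have := hjf c h1 h2; omega
    · have := hjb c h1 h2; omega
    · unfold jumpLength
      rw [if_pos h1, if_pos h3]
      obtain rfl | rfl : μ = 1 ∨ μ = 2 := by omega
      · omega
      · have := hpar (c + c'); rw [hμε rfl]; omega
    · unfold jumpLength
      rw [if_pos h1]
      obtain rfl | rfl : μ = 1 ∨ μ = 2 := by omega
      · omega
      · omega
    · unfold jumpLength
      obtain rfl | rfl : μ = 1 ∨ μ = 2 := by omega
      · split_ifs <;> omega
      · split_ifs <;> omega
  obtain ⟨xy, xy'⟩ := pair 1 0 (fun _ => 0) (jumpLength β 2 ε) (jumpLength β 1 0)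
    (jumpLength β 1 ε) (by omega) (by omega) (by omega) (by omega) (by simp)
    (fun c => by unfold jumpLength; split_ifs <;> omega)
  obtain ⟨xs, xs'⟩ := pair 2 ε (fun _ => 0) (jumpLength β 2 ε) (jumpLength β 2 0)
    (fun _ => 0) (by omega) (by omega) (by omega) (by omega) (by simp) (by simp)
  obtain ⟨ys, ys'⟩ := pair 1 ε (jumpLength β 1 0) (jumpLength β 1 ε) (jumpLength β 2 0)
    (fun _ => 0) (by omega) (by omega) (by omega) (by omega)
    (fun c => by unfold jumpLength; split_ifs <;> omega) (by simp)
  exact ⟨_, inferInstance, _, _, _, ⟨xy, xs, ys⟩, ⟨margin _ _, margin _ _, margin _ _⟩, xy', xs', ys'⟩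

theorem hasRealization_three_large (a r β : ℕ) (b : ℕ → ℕ) (h : Fin (3 + r) → ℕ)
    (hh₁ : ∀ p : Fin 3, h (Fin.castAdd r p) = a) (hh₂ : ∀ i : Fin r, h (Fin.natAdd 3 i) = b i)
    (hb : ∀ i < r, b i ≤ β) (hβ : 1 ≤ β) (hβa : β ≤ a)
    (hN : 2 * a + 2 * β + 1 ≤ arcStart b r) : HasRealization h := by
  obtain ⟨η, ω, κ, ha, hκ, h1, h2, hω⟩ : ∃ η ω κ, a = η + ω ∧ arcStart b r = κ + 3 * η ∧
      2 * β ≤ κ + 1 ∧ κ + 2 * β ≤ arcStart b r ∧ ω * arcStart b r ≤ 2 * (a * a) := by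
    rcases Nat.lt_or_ge (arcStart b r) (3 * a + 2 * β) with hlt | hge
    · refine ⟨(2 * a + 2) / 3, a - (2 * a + 2) / 3, arcStart b r - 3 * ((2 * a + 2) / 3), by omega,
        by omega, by omega, by omega, ?_⟩
      have h3 : 3 * (a - (2 * a + 2) / 3) ≤ a := by omega
      have := Nat.mul_le_mul h3 (by omega : arcStart b r ≤ 5 * a)
      nlinarith
    · exact ⟨a, 0, arcStart b r - 3 * a, by omega, by omega, by omega, by omega, by simp⟩
  have hsum : ∑ i : Fin r, b i = arcStart b r := Fin.sum_univ_eq_sum_range b r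
  obtain ⟨Ev, _, x, y, s, ⟨xy, xs, ys⟩, ⟨hx, hy, hs⟩, xy', xs', ys'⟩ :=
    exists_triples b r β κ hb hβ (by omega) h1 h2
  obtain ⟨F, hF₁₂, hF₁₃, hF₂₃, hF⟩ := exists_margins_of_triples a η ω κ (fun i : Fin r => b i) ha
    (hsum.trans hκ) (by rw [hsum]; exact hω) x y s xy xs ys hx hy hs xy' xs' ys'
  let φ : Fin 3 ⊕ Fin r ≃ Fin (3 + r) := finSumFinEquiv
  have hw : ∀ i, h i = Sum.elim (fun _ => a) (fun i : Fin r => b i) (φ.symm i) := by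
    intro i
    obtain ⟨i, rfl⟩ := φ.surjective i
    rw [Equiv.symm_apply_apply]
    rcases i with p | i
    · exact hh₁ p
    · exact hh₂ i
  refine hasRealization_of_margins h (fun i j l => F (φ.symm i) (φ.symm j) (φ.symm l))
    (fun i j => ?_) (fun i l => ?_) (fun j l => ?_) fun i l hne => hF _ _ (by simpa using hne)
  · rw [hw, hw, ← hF₁₂]; exact φ.symm.sum_comp fun l => F (φ.symm i) (φ.symm j) l
  · rw [hw, hw, ← hF₁₃]; exact φ.symm.sum_comp fun j => F (φ.symm i) j (φ.symm l)
  · rw [hw, hw, ← hF₂₃]; exact φ.symm.sum_comp fun i => F i (φ.symm j) (φ.symm l)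

end Realization

/-- if `3 ≤ m < k`, `h_1 = h_2 = … = h_m ≥ h_{m+1} ≥ … ≥ h_k > 0`
and `(m−1)(h_1 + h_{m+1}) < h_{m+1} + … + h_k`, then the partition
`(h_1^m h_{m+1} … h_k)`, i.e. `(h_1 h_2 … h_k)`, has a realization. -/
theorem statement3 (m k : ℕ) (h : ℕ → ℕ)
    (hm : 3 ≤ m) (hmk : m < k)
    (heq : ∀ i, 1 ≤ i → i ≤ m → h i = h 1)
    (hmono : ∀ i, m ≤ i → i < k → h (i + 1) ≤ h i)
    (hpos : ∀ i, 1 ≤ i → i ≤ k → 0 < h i)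
    (hlt : (m - 1) * (h 1 + h (m + 1)) < ∑ i ∈ Finset.Icc (m + 1) k, h i) :
    HasRealization (fun i : Fin k => h ((i : ℕ) + 1)) := by
  have step : ∀ i, 1 ≤ i → i < k → h (i + 1) ≤ h i := by
    intro i h1 h2
    rcases Nat.lt_or_ge i m with h3 | h3
    · rw [heq i h1 h3.le, heq (i + 1) (by omega) h3]
    · exact hmono i h3 h2
  obtain ⟨r, rfl⟩ : ∃ r, k = 3 + r := ⟨k - 3, by omega⟩
  have hle : ∀ i < r, h (i + 4) ≤ h 4 := by
    intro i
    induction i with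
    | zero => simp
    | succ i ih =>
      intro hi
      exact (step (i + 4) (by omega) (by omega)).trans (ih (by omega))
  have h41 : h 4 ≤ h 1 := by rw [← heq 3 (by omega) hm]; exact step 3 (by omega) (by omega)
  have hsum : arcStart (fun i => h (i + 4)) r =
      ∑ i ∈ Finset.Ico 4 (m + 1), h i + ∑ i ∈ Finset.Icc (m + 1) (3 + r), h i := by
    rw [show Finset.Icc (m + 1) (3 + r) = Finset.Ico (m + 1) (r + 4) by ext; simp; omega,
      Finset.sum_Ico_consecutive _ (by omega) (by omega), Finset.sum_Ico_eq_sum_range]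
    simp only [arcStart, Nat.add_sub_cancel, add_comm]
  refine hasRealization_three_large (h 1) r (h 4) (fun i => h (i + 4)) _ (fun p => ?_)
    (fun i => ?_) hle (hpos 4 (by omega) (by omega)) h41 ?_
  · exact heq _ (by omega) (by simp; omega)
  · simp only [Fin.val_natAdd]; congr 1; omega
  · rw [hsum]
    rcases hm.eq_or_lt with rfl | hm4
    · norm_num at hlt ⊢
      omega
    · have h4 : h 4 = h 1 := heq 4 (by omega) hm4
      have h5 : h 4 ≤ ∑ i ∈ Finset.Ico 4 (m + 1), h i :=
        Finset.single_le_sum (fun _ _ => Nat.zero_le _) (by simp; omega)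
      have h6 : 3 * h 1 ≤ (m - 1) * (h 1 + h (m + 1)) :=
        Nat.mul_le_mul (by omega) (Nat.le_add_right _ _)
      omega
end

section
/- Let P = (h_1 h_2 … h_k) be a partition with k ≥ 2, n = h_1 + … + h_k, and set t = n − h_1. Suppose t is odd, h_i ≥ h_{i+1} for all 2 ≤ i ≤ k−1, h_2 ≤ (t+1)/4, and 2h_2 ≤ h_1 ≤ t + 1 − 2h_2. Then there exists a realization of P in normal form. -/
/-- For a partition `p = (p_1 … p_k)` of `n`, `blockSet p n i` is the block
`p[i]`: the interval of `p i` consecutive elements of `Fin n` following the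
first `p_1 + … + p_{i-1}` elements. -/
def blockSet {k : ℕ} (p : Fin k → ℕ) (n : ℕ) (i : Fin k) : Finset (Fin n) :=
  Finset.univ.filter fun x =>
    (∑ j ∈ Finset.univ.filter (· < i), p j) ≤ (x : ℕ) ∧
    (x : ℕ) < ∑ j ∈ Finset.univ.filter (· ≤ i), p j

/-- `L` is a realization of the partition `p` in normal form: `L` is a latin
square and, for each `i`, the rows and columns indexed by the block `p[i]`
form a subsquare using exactly the symbols in `p[i]` (as `L` is a latin
square and the blocks have the right sizes, mapping each such cell into
`p[i]` is equivalent to this). -/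
def IsNormalFormRealization {k n : ℕ} (p : Fin k → ℕ) (L : Fin n → Fin n → Fin n) : Prop :=
  IsLatinSquare L ∧
  ∀ i : Fin k, ∀ x ∈ blockSet p n i, ∀ y ∈ blockSet p n i, L x y ∈ blockSet p n i

section Splitting

universe u

open Finset

/-- A regular bipartite multigraph has a perfect matching. -/
theorem exists_perfect_matching {E U V : Type*} [Fintype E] [Fintype U] [Fintype V]
    [DecidableEq U] [DecidableEq V] (k : ℕ) (u : E → U) (v : E → V)
    (hu : ∀ a, #{e | u e = a} = k + 1) (hv : ∀ b, #{e | v e = b} = k + 1) :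
    ∃ m : U → E, (∀ a, u (m a) = a) ∧ Function.Bijective fun a => v (m a) := by
  classical
  have hE : Fintype.card E = Fintype.card U * (k + 1) := by
    rw [← card_univ, card_eq_sum_card_fiberwise (f := u) (t := univ) (by simp)]
    simp [hu]
  have hE' : Fintype.card E = Fintype.card V * (k + 1) := by
    rw [← card_univ, card_eq_sum_card_fiberwise (f := v) (t := univ) (by simp)]
    simp [hv]
  have hUV : Fintype.card U = Fintype.card V :=
    Nat.eq_of_mul_eq_mul_right (Nat.succ_pos k) (hE.symm.trans hE')
  let nb : U → Finset V := fun a => ({e | u e = a} : Finset E).image v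
  have hall : ∀ s : Finset U, #s ≤ #(s.biUnion nb) := by
    intro s
    have h1 : #({e | u e ∈ s} : Finset E) = #s * (k + 1) := by
      rw [card_eq_sum_card_fiberwise (f := u) (t := s) (by intro e; simp)]
      rw [sum_congr rfl (g := fun _ => k + 1)]
      · simp
      · intro a ha
        rw [← hu a, filter_filter]
        congr 1
        ext e
        simp only [mem_filter, mem_univ, true_and]
        exact ⟨fun h => h.2, fun h => ⟨h ▸ ha, h⟩⟩
    have h2 : #({e | v e ∈ s.biUnion nb} : Finset E) = #(s.biUnion nb) * (k + 1) := by
      rw [card_eq_sum_card_fiberwise (f := v) (t := s.biUnion nb) (by intro e; simp)]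
      rw [sum_congr rfl (g := fun _ => k + 1)]
      · simp
      · intro a ha
        rw [← hv a, filter_filter]
        congr 1
        ext e
        simp only [mem_filter, mem_univ, true_and]
        exact ⟨fun h => h.2, fun h => ⟨h ▸ ha, h⟩⟩
    have h3 : ({e | u e ∈ s} : Finset E) ⊆ ({e | v e ∈ s.biUnion nb} : Finset E) := by
      intro e he
      simp only [mem_filter, mem_univ, true_and] at he ⊢
      exact mem_biUnion.2 ⟨u e, he, mem_image.2 ⟨e, by simp, rfl⟩⟩
    have h4 := card_le_card h3
    rw [h1, h2] at h4
    exact Nat.le_of_mul_le_mul_right h4 (Nat.succ_pos k)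
  obtain ⟨φ, hφ, hmem⟩ := (all_card_le_biUnion_card_iff_exists_injective nb).1 hall
  have hex : ∀ a, ∃ e, u e = a ∧ v e = φ a := by
    intro a
    obtain ⟨e, he, hve⟩ := mem_image.1 (hmem a)
    exact ⟨e, by simpa using he, hve⟩
  choose m hm hm' using hex
  refine ⟨m, hm, (Fintype.bijective_iff_injective_and_card _).2 ⟨?_, hUV⟩⟩
  intro a b hab
  exact hφ (by simpa [hm'] using hab)

/-- A `k`-regular bipartite multigraph has a proper edge colouring with `k` colours. -/
theorem exists_proper_edge_coloring {U V : Type u} [Fintype U] [Fintype V]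
    [DecidableEq U] [DecidableEq V] (k : ℕ) :
    ∀ {E : Type*} [Fintype E] (u : E → U) (v : E → V),
      (∀ a, #{e | u e = a} = k) → (∀ b, #{e | v e = b} = k) →
      ∃ f : E → Fin k, (∀ e e', f e = f e' → u e = u e' → e = e') ∧
        ∀ e e', f e = f e' → v e = v e' → e = e' := by
  classical
  induction k with
  | zero =>
    intro E _ u v hu hv
    have : IsEmpty E := ⟨fun e => by
      have := hu (u e)
      rw [card_eq_zero] at this
      have he : e ∈ ({e' | u e' = u e} : Finset E) := by simp
      rw [this] at he
      simp at he⟩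
    exact ⟨fun e => isEmptyElim e, fun e => isEmptyElim e, fun e => isEmptyElim e⟩
  | succ k ih =>
    intro E _ u v hu hv
    obtain ⟨m, hm, hbij⟩ := exists_perfect_matching k u v hu hv
    have key : ∀ {W : Type u} [DecidableEq W] (w : E → W) (b : W),
        #{e | w e = b} = k + 1 → (∃! a, w (m a) = b) →
        #({e | w e.1 = b} : Finset {e : E // ∀ a, m a ≠ e}) = k := by
      intro W _ w b hb hex
      obtain ⟨a, ha, hua⟩ := hex
      have h1 : (({e | w e.1 = b} : Finset {e : E // ∀ a, m a ≠ e}).map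
          (Function.Embedding.subtype _)) = ({e | w e = b} : Finset E).erase (m a) := by
        ext e
        simp only [mem_map, mem_filter, mem_univ, true_and, Function.Embedding.coe_subtype,
          Subtype.exists, exists_and_left, exists_prop, exists_eq_right_right, mem_erase]
        constructor
        · rintro ⟨h, h'⟩
          exact ⟨fun h2 => h' a h2.symm, h⟩
        · rintro ⟨h, h'⟩
          refine ⟨h', fun a' h2 => h ?_⟩
          rw [← h2, hua a' (by simp [h2, h'])]
      rw [← card_map (Function.Embedding.subtype _), h1, card_erase_of_mem (by simpa using ha), hb]
      rfl
    obtain ⟨f, hf, hf'⟩ := ih (E := {e : E // ∀ a, m a ≠ e}) (fun e => u e.1) (fun e => v e.1)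
      (fun a => key u a (hu a) ⟨a, hm a, fun a' h => by simpa [hm] using h⟩)
      (fun b => key v b (hv b) (hbij.existsUnique b))
    let F : E → Fin (k + 1) := fun e =>
      if h : ∀ a, m a ≠ e then (f ⟨e, h⟩).castSucc else Fin.last k
    have hF : ∀ {W : Type u} (w : E → W), (∀ a a', w (m a) = w (m a') → a = a') →
        (∀ e e' : {e : E // ∀ a, m a ≠ e}, f e = f e' → w e.1 = w e'.1 → e = e') →
        ∀ e e', F e = F e' → w e = w e' → e = e' := by
      intro W w h1 h2 e e' h3 h4
      by_cases he : ∀ a, m a ≠ e <;> by_cases he' : ∀ a, m a ≠ e'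
      · simp only [F, he, he', ne_eq, not_false_eq_true, implies_true, dite_true] at h3
        exact congrArg Subtype.val (h2 ⟨e, he⟩ ⟨e', he'⟩ (Fin.castSucc_injective _ h3) h4)
      · simp only [F, dif_pos he, dif_neg he'] at h3
        exact absurd h3 (Fin.castSucc_lt_last _).ne
      · simp only [F, dif_neg he, dif_pos he'] at h3
        exact absurd h3.symm (Fin.castSucc_lt_last _).ne
      · push Not at he he'
        obtain ⟨a, rfl⟩ := he
        obtain ⟨a', rfl⟩ := he'
        rw [h1 a a' h4]
    exact ⟨F, hF u (fun a a' h => by simpa [hm] using h) hf,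
      hF v (fun a a' h => hbij.1 h) hf'⟩

/-- A fibration with fibres of sizes `k * c a` refines to one with all fibres of size `k`. -/
theorem exists_fiber_refinement {E U : Type*} [Fintype E] [Fintype U] [DecidableEq U]
    (k : ℕ) (c : U → ℕ) (u : E → U) (hu : ∀ a, #{e | u e = a} = k * c a) :
    ∃ u' : E → Σ a, Fin (c a), (∀ e, (u' e).1 = u e) ∧ ∀ a, #{e | u' e = a} = k := by
  classical
  have hc : ∀ a, Nonempty ({e // u e = a} ≃ Fin (c a) × Fin k) := by
    intro a
    refine ⟨Fintype.equivOfCardEq ?_⟩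
    rw [Fintype.card_subtype, hu, Fintype.card_prod, Fintype.card_fin, Fintype.card_fin, mul_comm]
  let ψ : ∀ a, {e // u e = a} ≃ Fin (c a) × Fin k := fun a => (hc a).some
  refine ⟨fun e => ⟨u e, (ψ (u e) ⟨e, rfl⟩).1⟩, fun e => rfl, ?_⟩
  rintro ⟨a, i⟩
  have : ({e | (⟨u e, (ψ (u e) ⟨e, rfl⟩).1⟩ : Σ a, Fin (c a)) = ⟨a, i⟩} : Finset E) =
      (univ : Finset (Fin k)).image fun j => ((ψ a).symm (i, j)).1 := by
    ext e
    simp only [mem_filter, mem_univ, true_and, mem_image]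
    constructor
    · intro h
      obtain ⟨rfl, h2⟩ := Sigma.mk.inj_iff.1 h
      refine ⟨(ψ (u e) ⟨e, rfl⟩).2, ?_⟩
      rw [← eq_of_heq h2, Prod.mk.eta, Equiv.symm_apply_apply]
    · rintro ⟨j, rfl⟩
      generalize hx : (ψ a).symm (i, j) = x
      obtain ⟨e, rfl⟩ := x
      have : ψ (u e) ⟨e, rfl⟩ = (i, j) := by rw [← hx, Equiv.apply_symm_apply]
      simp [this]
  rw [this, card_image_of_injective, card_univ, Fintype.card_fin]
  intro j j' h
  simpa using (ψ a).symm.injective (Subtype.ext h)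

/-- A bipartite multigraph all of whose degrees are `k` times prescribed numbers is a union of `k`
classes in each of which the degrees are these prescribed numbers. -/
theorem exists_equitable_edge_coloring {E : Type*} {U V : Type u}
    [Fintype E] [Fintype U] [Fintype V] [DecidableEq U] [DecidableEq V] (k : ℕ) (c : U → ℕ) (d : V → ℕ) (u : E → U) (v : E → V)
    (hu : ∀ a, #{e | u e = a} = k * c a) (hv : ∀ b, #{e | v e = b} = k * d b) :
    ∃ f : E → Fin k, (∀ i a, #{e | f e = i ∧ u e = a} = c a) ∧
      ∀ i b, #{e | f e = i ∧ v e = b} = d b := by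
  classical
  obtain ⟨u', hu', hu''⟩ := exists_fiber_refinement k c u hu
  obtain ⟨v', hv', hv''⟩ := exists_fiber_refinement k d v hv
  obtain ⟨f, hf, hf'⟩ := exists_proper_edge_coloring k u' v' hu'' hv''
  have key : ∀ {W : Type u} [DecidableEq W] (w : E → W) (c : W → ℕ) (w' : E → Σ a, Fin (c a)),
      (∀ a, #{e | w e = a} = k * c a) → (∀ e, (w' e).1 = w e) →
      (∀ e e', f e = f e' → w' e = w' e' → e = e') → ∀ i a, #{e | f e = i ∧ w e = a} = c a := by
    intro W _ w c w' h1 h2 h3 i a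
    have hle : ∀ i ∈ (univ : Finset (Fin k)), #{e | f e = i ∧ w e = a} ≤ c a := by
      intro i _
      calc #{e | f e = i ∧ w e = a}
          ≤ #((univ : Finset (Fin (c a))).image (Sigma.mk (β := fun a => Fin (c a)) a)) := by
            refine card_le_card_of_injOn w' ?_ ?_
            · intro e he
              simp only [coe_filter, mem_univ, true_and, Set.mem_ofPred_eq] at he
              have : (w' e).1 = a := (h2 e).trans he.2
              subst this
              exact mem_coe.2 (mem_image.2 ⟨(w' e).2, mem_univ _, rfl⟩)
            · intro e he e' he' h
              simp only [coe_filter, mem_univ, true_and, Set.mem_ofPred_eq] at he he'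
              exact h3 e e' (he.1.trans he'.1.symm) h
        _ ≤ c a := card_image_le.trans (by simp)
    have hsum : ∑ i : Fin k, #{e | f e = i ∧ w e = a} = ∑ i : Fin k, c a := by
      rw [sum_const, card_univ, Fintype.card_fin, smul_eq_mul, ← h1 a,
        card_eq_sum_card_fiberwise (f := f) (t := univ) (by simp)]
      refine sum_congr rfl fun i _ => ?_
      rw [filter_filter]
      simp only [and_comm]
    exact (sum_eq_sum_iff_of_le hle).1 hsum i (mem_univ i)
  exact ⟨f, key u c u' hu hu' hf, key v d v' hv hv' hf'⟩

/-- In an outline array, the weighted rows can be split into rows of weight one. -/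
theorem exists_outline_splitting {E A : Type*} {B C : Type u} [Fintype E] [Fintype A]
    [Fintype B] [Fintype C]
    [DecidableEq A] [DecidableEq B] [DecidableEq C] (wa : A → ℕ) (wb : B → ℕ) (wc : C → ℕ)
    (r : E → A) (c : E → B) (s : E → C)
    (hrc : ∀ a b, #{e | r e = a ∧ c e = b} = wa a * wb b)
    (hrs : ∀ a z, #{e | r e = a ∧ s e = z} = wa a * wc z) :
    ∃ r' : E → Σ a, Fin (wa a), (∀ e, (r' e).1 = r e) ∧
      (∀ x b, #{e | r' e = x ∧ c e = b} = wb b) ∧ ∀ x z, #{e | r' e = x ∧ s e = z} = wc z := by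
  classical
  have hsub : ∀ (a : A) (p : E → Prop) [DecidablePred p],
      #({e | p e.1} : Finset {e // r e = a}) = #{e | r e = a ∧ p e} := by
    intro a p _
    rw [← card_map (Function.Embedding.subtype _)]
    congr 1
    ext e
    simp [and_comm]
  choose f hf hf' using fun a => exists_equitable_edge_coloring (E := {e // r e = a}) (wa a) wb wc
    (fun e => c e.1) (fun e => s e.1) (fun b => by rw [hsub a (fun e => c e = b), hrc])
    (fun z => by rw [hsub a (fun e => s e = z), hrs])
  have key : ∀ (a : A) (i : Fin (wa a)) (p : E → Prop) [DecidablePred p],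
      #{e | (⟨r e, f (r e) ⟨e, rfl⟩⟩ : Σ a, Fin (wa a)) = ⟨a, i⟩ ∧ p e} =
        #({e | f a e = i ∧ p e.1} : Finset {e // r e = a}) := by
    intro a i p _
    rw [← card_map (Function.Embedding.subtype _)]
    congr 1
    ext e
    simp only [mem_filter, mem_univ, true_and, mem_map, Function.Embedding.coe_subtype,
      Subtype.exists, exists_and_right, exists_eq_right]
    constructor
    · rintro ⟨h, h'⟩
      obtain ⟨rfl, h2⟩ := Sigma.mk.inj_iff.1 h
      exact ⟨⟨rfl, eq_of_heq h2⟩, h'⟩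
    · rintro ⟨⟨rfl, h2⟩, h'⟩
      exact ⟨by rw [h2], h'⟩
  refine ⟨fun e => ⟨r e, f (r e) ⟨e, rfl⟩⟩, fun e => rfl, ?_, ?_⟩
  · rintro ⟨a, i⟩ b
    rw [key a i (fun e => c e = b), hf]
  · rintro ⟨a, i⟩ z
    rw [key a i (fun e => s e = z), hf']

/-- Every outline square is the amalgamation of a latin square. -/
theorem exists_latin_of_outline {G : Type*} [Fintype G] [DecidableEq G] (w : G → ℕ)
    (O : G → G → G → ℕ) (h₃ : ∀ a b, ∑ z, O a b z = w a * w b)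
    (h₂ : ∀ a z, ∑ b, O a b z = w a * w z) (h₁ : ∀ b z, ∑ a, O a b z = w b * w z) :
    ∃ L : (Σ a, Fin (w a)) → (Σ a, Fin (w a)) → (Σ a, Fin (w a)),
      (∀ x, Function.Bijective fun y => L x y) ∧ (∀ y, Function.Bijective fun x => L x y) ∧
      ∀ x y, O x.1 y.1 (L x y).1 ≠ 0 := by
  classical
  let E := Σ p : G × G × G, Fin (O p.1 p.2.1 p.2.2)
  have hcard : ∀ (p : G × G × G → Prop) [DecidablePred p],
      #({e | p e.1} : Finset E) = ∑ a, ∑ b, ∑ z, if p (a, b, z) then O a b z else 0 := by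
    intro p _
    have : ({e | p e.1} : Finset E) = ({q | p q} : Finset (G × G × G)).sigma fun _ => univ := by
      ext ⟨q, i⟩
      rw [mem_sigma]
      simp
    rw [this, card_sigma, sum_filter, Fintype.sum_prod_type]
    simp [Fintype.sum_prod_type]
  obtain ⟨r, hr, hrc, hrs⟩ := exists_outline_splitting (E := E) w w w (fun e => e.1.1)
    (fun e => e.1.2.1) (fun e => e.1.2.2)
    (fun a b => by
      rw [hcard (fun p => p.1 = a ∧ p.2.1 = b), ← h₃ a b,
        Fintype.sum_eq_single a (fun x hx => by simp [hx]),
        Fintype.sum_eq_single b (fun x hx => by simp [hx])]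
      simp)
    (fun a z => by
      rw [hcard (fun p => p.1 = a ∧ p.2.2 = z), ← h₂ a z,
        Fintype.sum_eq_single a (fun x hx => by simp [hx])]
      simp)
  obtain ⟨c, hc, hcr, hcs⟩ := exists_outline_splitting (E := E) w (fun _ => 1) w
    (fun e => e.1.2.1) r (fun e => e.1.2.2)
    (fun b x => by rw [mul_one, ← hrc x b]; simp only [and_comm])
    (fun b z => by
      rw [hcard (fun p => p.2.1 = b ∧ p.2.2 = z), ← h₁ b z]
      refine sum_congr rfl fun a _ => ?_
      rw [Fintype.sum_eq_single b (fun x hx => by simp [hx])]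
      simp)
  obtain ⟨s, hs, hsr, hsc⟩ := exists_outline_splitting (E := E) w (fun _ => 1) (fun _ => 1)
    (fun e => e.1.2.2) r c
    (fun z x => by rw [mul_one, ← hrs x z]; simp only [and_comm])
    (fun z y => by rw [mul_one, ← hcs y z]; simp only [and_comm])
  have hex : ∀ x y, ∃ e, c e = y ∧ r e = x := by
    intro x y
    obtain ⟨e, he⟩ := card_pos.1 ((hcr y x).symm ▸ Nat.one_pos)
    exact ⟨e, by simpa using he⟩
  choose e hec her using hex
  have huniq : ∀ {X : Type _} {p : X → Prop} [Fintype X] [DecidablePred p], #{x | p x} = 1 →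
      ∀ x x', p x → p x' → x = x' := by
    intro X p _ _ h x x' hx hx'
    exact card_le_one.1 h.le x (by simpa using hx) x' (by simpa using hx')
  refine ⟨fun x y => s (e x y), fun x => ?_, fun y => ?_, fun x y => ?_⟩
  · refine Finite.injective_iff_bijective.1 fun y y' h => ?_
    have := huniq (hsr (s (e x y)) x) (e x y) (e x y') ⟨rfl, her x y⟩ ⟨h.symm, her x y'⟩
    rw [← hec x y, this, hec]
  · refine Finite.injective_iff_bijective.1 fun x x' h => ?_
    have := huniq (hsc (s (e x y)) y) (e x y) (e x' y) ⟨rfl, hec x y⟩ ⟨h.symm, hec x' y⟩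
    rw [← her x y, this, her]
  · have h1 : x.1 = (e x y).1.1 := by rw [← hr, her]
    have h2 : y.1 = (e x y).1.2.1 := by rw [← hc, hec]
    rw [h1, h2, hs]
    exact (Fin.pos (e x y).2).ne'

/-- The outline array obtained from an array `N` of small groups of sizes `g` by adding one group
of size `m` and filling up. -/
def outlineExtension {q : ℕ} (g : Fin q → ℕ) (m : ℕ) (N : Fin q → Fin q → Fin q → ℕ) :
    Fin (q + 1) → Fin (q + 1) → Fin (q + 1) → ℕ :=
  Fin.cons
    (Fin.cons (Fin.cons (m * m) fun _ => 0)
      fun b => Fin.cons 0 fun z => g b * g z - ∑ a, N a b z)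
    fun a => Fin.cons (Fin.cons 0 fun z => g a * g z - ∑ b, N a b z)
      fun b => Fin.cons (g a * g b - ∑ z, N a b z) fun z => N a b z

theorem sum_mul_sub {q : ℕ} (g : Fin q → ℕ) (m r c : ℕ) (hm : ∑ i, g i = m + r) (S : Fin q → ℕ)
    (hS : ∀ i, S i ≤ c * g i) (hsum : ∑ i, S i = c * r) : ∑ i, (c * g i - S i) = c * m := by
  have h1 : ∑ i, (c * g i - S i) + ∑ i, S i = c * (m + r) := by
    rw [← sum_add_distrib, ← hm, mul_sum]
    exact sum_congr rfl fun i _ => Nat.sub_add_cancel (hS i)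
  rw [hsum, mul_add] at h1
  omega

/-- A partial outline array on small groups, regular of degree `r`, extends to a latin square with
one further group of size `m`, in which every group carries a subsquare. -/
theorem exists_latin_of_partial_outline {q : ℕ} (g : Fin q → ℕ) (m r : ℕ)
    (N : Fin q → Fin q → Fin q → ℕ) (hm : ∑ i, g i = m + r)
    (h₃ : ∀ a b, ∑ z, N a b z ≤ g a * g b) (h₂ : ∀ a z, ∑ b, N a b z ≤ g a * g z)
    (h₁ : ∀ b z, ∑ a, N a b z ≤ g b * g z)
    (r₁ : ∀ a, ∑ b, ∑ z, N a b z = g a * r) (r₂ : ∀ b, ∑ a, ∑ z, N a b z = g b * r)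
    (r₃ : ∀ z, ∑ a, ∑ b, N a b z = g z * r)
    (hN : ∀ a, N a a a = g a * g a) :
    ∃ L : (Σ a : Fin (q + 1), Fin ((Fin.cons m g : Fin (q + 1) → ℕ) a)) →
        (Σ a : Fin (q + 1), Fin ((Fin.cons m g : Fin (q + 1) → ℕ) a)) →
        (Σ a : Fin (q + 1), Fin ((Fin.cons m g : Fin (q + 1) → ℕ) a)),
      (∀ x, Function.Bijective fun y => L x y) ∧ (∀ y, Function.Bijective fun x => L x y) ∧
      ∀ x y, x.1 = y.1 → (L x y).1 = x.1 := by
  have e₃ : ∀ a b, ∑ z, outlineExtension g m N a b z =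
      (Fin.cons m g : Fin (q + 1) → ℕ) a * (Fin.cons m g : Fin (q + 1) → ℕ) b := by
    intro a b
    refine Fin.cases ?_ (fun a => ?_) a <;> refine Fin.cases ?_ (fun b => ?_) b <;>
      simp only [outlineExtension, Fin.sum_univ_succ, Fin.cons_zero, Fin.cons_succ]
    · simp
    · rw [zero_add, sum_mul_sub g m r (g b) hm _ (fun z => h₁ b z)
        (by rw [sum_comm, r₂]), mul_comm]
    · rw [zero_add, sum_mul_sub g m r (g a) hm _ (fun z => h₂ a z) (by rw [sum_comm, r₁])]
    · exact Nat.sub_add_cancel (h₃ a b)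
  have e₂ : ∀ a z, ∑ b, outlineExtension g m N a b z =
      (Fin.cons m g : Fin (q + 1) → ℕ) a * (Fin.cons m g : Fin (q + 1) → ℕ) z := by
    intro a z
    refine Fin.cases ?_ (fun a => ?_) a <;> refine Fin.cases ?_ (fun z => ?_) z <;>
      simp only [outlineExtension, Fin.sum_univ_succ, Fin.cons_zero, Fin.cons_succ]
    · simp
    · simp_rw [mul_comm (g _) (g z)]
      rw [zero_add, sum_mul_sub g m r (g z) hm _ (fun b => by rw [mul_comm]; exact h₁ b z)
        (by rw [sum_comm, r₃]), mul_comm]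
    · rw [zero_add, sum_mul_sub g m r (g a) hm _ (fun b => h₃ a b) (by rw [r₁])]
    · exact Nat.sub_add_cancel (h₂ a z)
  have e₁ : ∀ b z, ∑ a, outlineExtension g m N a b z =
      (Fin.cons m g : Fin (q + 1) → ℕ) b * (Fin.cons m g : Fin (q + 1) → ℕ) z := by
    intro b z
    refine Fin.cases ?_ (fun b => ?_) b <;> refine Fin.cases ?_ (fun z => ?_) z <;>
      simp only [outlineExtension, Fin.sum_univ_succ, Fin.cons_zero, Fin.cons_succ]
    · simp
    · simp_rw [mul_comm (g _) (g z)]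
      rw [zero_add, sum_mul_sub g m r (g z) hm _ (fun a => by rw [mul_comm]; exact h₂ a z)
        (by rw [r₃]), mul_comm]
    · simp_rw [mul_comm (g _) (g b)]
      rw [zero_add, sum_mul_sub g m r (g b) hm _ (fun a => by rw [mul_comm]; exact h₃ a b)
        (by rw [r₂])]
    · exact Nat.sub_add_cancel (h₁ b z)
  obtain ⟨L, hL, hL', hO⟩ := exists_latin_of_outline _ _ e₃ e₂ e₁
  refine ⟨L, hL, hL', fun x y hxy => ?_⟩
  have hdiag : ∀ a, outlineExtension g m N a a a =
      (Fin.cons m g : Fin (q + 1) → ℕ) a * (Fin.cons m g : Fin (q + 1) → ℕ) a := by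
    intro a
    refine Fin.cases ?_ (fun a => ?_) a <;>
      simp only [outlineExtension, Fin.cons_zero, Fin.cons_succ, hN]
  by_contra hne
  have h1 := hO x y
  rw [← hxy] at h1
  have h2 := e₃ x.1 x.1
  rw [← hdiag, ← add_sum_erase _ _ (mem_univ x.1)] at h2
  have h3 := single_le_sum (f := fun z => outlineExtension g m N x.1 x.1 z)
    (fun _ _ => Nat.zero_le _) (mem_erase.2 ⟨hne, mem_univ (L x y).1⟩)
  omega

end Splitting

section Circle

open Finset

/-- The group containing the point `x`, when points are cut into consecutive groups of sizes `n`. -/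
def groupOf {q : ℕ} (n : Fin q → ℕ) (x : Fin (∑ i, n i)) : Fin q :=
  (finSigmaFinEquiv.symm x).1

theorem groupOf_eq_iff {q : ℕ} (n : Fin q → ℕ) (x : Fin (∑ i, n i)) (I : Fin q) :
    groupOf n x = I ↔ ∑ j ∈ Iio I, n j ≤ (x : ℕ) ∧ (x : ℕ) < ∑ j ∈ Iio I, n j + n I := by
  have hpre : ∀ J : Fin q, ∑ j : Fin J, n (Fin.castLE J.2.le j) = ∑ j ∈ Iio J, n j := by
    intro J
    refine sum_bij (fun j _ => Fin.castLE J.2.le j) ?_ ?_ ?_ ?_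
    · intro j _
      simp only [mem_Iio, Fin.lt_def, Fin.val_castLE]
      exact j.2
    · intro j _ j' _ h
      exact Fin.castLE_injective _ h
    · intro j hj
      exact ⟨⟨j, Fin.lt_def.1 (mem_Iio.1 hj)⟩, mem_univ _, rfl⟩
    · intro j _
      rfl
  have hx : ∑ j ∈ Iio (groupOf n x), n j ≤ (x : ℕ) ∧
      (x : ℕ) < ∑ j ∈ Iio (groupOf n x), n j + n (groupOf n x) := by
    have h1 : (x : ℕ) = ∑ j ∈ Iio (groupOf n x), n j + (finSigmaFinEquiv.symm x).2 := by
      conv_lhs => rw [← finSigmaFinEquiv.apply_symm_apply x, finSigmaFinEquiv_apply]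
      rw [hpre]
      rfl
    have h2 : ((finSigmaFinEquiv.symm x).2 : ℕ) < n (groupOf n x) := (finSigmaFinEquiv.symm x).2.2
    omega
  have hmono : ∀ A B : Fin q, A < B → ∑ j ∈ Iio A, n j + n A ≤ ∑ j ∈ Iio B, n j := by
    intro A B hAB
    have : ∑ j ∈ Iio A, n j + n A = ∑ j ∈ Iic A, n j := by
      rw [← Iio_insert, sum_insert (by simp), add_comm]
    rw [this]
    exact sum_le_sum_of_subset fun j hj => mem_Iio.2 ((mem_Iic.1 hj).trans_lt hAB)
  constructor
  · rintro rfl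
    exact hx
  · rintro ⟨h1, h2⟩
    rcases lt_trichotomy (groupOf n x) I with h | h | h
    · have := hmono _ _ h
      omega
    · exact h
    · have := hmono _ _ h
      omega

theorem sum_Iio_add_sum_Ioo {q : ℕ} (n : Fin q → ℕ) {I J : Fin q} (h : I < J) :
    ∑ j ∈ Iio J, n j = ∑ j ∈ Iio I, n j + n I + ∑ j ∈ Ioo I J, n j := by
  have : Iio J = insert I (Iio I) ∪ Ioo I J := by
    ext j
    simp only [mem_Iio, mem_union, mem_insert, mem_Ioo, Fin.lt_def, Fin.ext_iff] at h ⊢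
    omega
  rw [this, sum_union, sum_insert (by simp)]
  · ring
  · rw [disjoint_left]
    intro j
    simp only [mem_Iio, mem_insert, mem_Ioo, Fin.lt_def, Fin.ext_iff]
    omega

theorem card_groupOf_eq {q : ℕ} (n : Fin q → ℕ) (I : Fin q) :
    #{x | groupOf n x = I} = n I := by
  have : ({x | groupOf n x = I} : Finset (Fin (∑ i, n i))) =
      (univ : Finset (Fin (n I))).image fun i => finSigmaFinEquiv ⟨I, i⟩ := by
    ext x
    simp only [mem_filter, mem_univ, true_and, mem_image]
    constructor
    · rintro rfl
      exact ⟨(finSigmaFinEquiv.symm x).2, finSigmaFinEquiv.apply_symm_apply x⟩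
    · rintro ⟨i, rfl⟩
      rw [groupOf, Equiv.symm_apply_apply]
  rw [this, card_image_of_injective, card_univ, Fintype.card_fin]
  intro i j h
  simpa using h

/-- Rotation of a circle of `T` points by `δ`. -/
def rotate {T : ℕ} (δ : ℕ) (x : Fin T) : Fin T := ⟨(x + δ) % T, Nat.mod_lt _ x.pos⟩

theorem rotate_cases {T δ : ℕ} (hδ : δ ≤ T) (x : Fin T) :
    ((rotate δ x : Fin T) : ℕ) = x + δ ∨ ((rotate δ x : Fin T) : ℕ) + T = x + δ := by
  have hx := x.2
  unfold rotate
  rcases lt_or_ge (x + δ) T with h | h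
  · exact .inl (Nat.mod_eq_of_lt h)
  · right
    simp only
    rw [Nat.mod_eq_sub_mod h, Nat.mod_eq_of_lt (by omega)]
    omega

theorem rotate_rotate_sub {T δ : ℕ} (hδ : δ ≤ T) (x : Fin T) : rotate (T - δ) (rotate δ x) = x := by
  have h1 := rotate_cases hδ x
  have h2 := rotate_cases (Nat.sub_le T δ) (rotate δ x)
  have := x.2
  have := (rotate δ x).2
  have := (rotate (T - δ) (rotate δ x)).2
  ext
  omega

theorem rotate_rotate {T δ ε : ℕ} (hδ : δ ≤ T) (hε : ε ≤ T) (h : 2 * δ = ε ∨ 2 * δ = ε + T)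
    (x : Fin T) : rotate δ (rotate δ x) = rotate ε x := by
  have h1 := rotate_cases hδ x
  have h2 := rotate_cases hδ (rotate δ x)
  have h3 := rotate_cases hε x
  have := x.2
  have := (rotate δ x).2
  have := (rotate δ (rotate δ x)).2
  have := (rotate ε x).2
  ext
  omega

theorem rotate_bijective {T δ : ℕ} (hδ : δ ≤ T) : Function.Bijective (rotate (T := T) δ) :=
  Finite.injective_iff_bijective.1 (Function.LeftInverse.injective (rotate_rotate_sub hδ))

/-- The number of points of group `I` that rotation by `δ` takes to group `J`. -/
def pairCount {q : ℕ} (n : Fin q → ℕ) (δ : ℕ) (I J : Fin q) : ℕ :=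
  #{x | groupOf n x = I ∧ groupOf n (rotate δ x) = J}

/-- The number of points of group `I` that rotations by `δ` take to groups `J` and `K`. -/
def tripleCount {q : ℕ} (n : Fin q → ℕ) (δ : ℕ) (I J K : Fin q) : ℕ :=
  #{x | groupOf n x = I ∧ groupOf n (rotate δ x) = J ∧ groupOf n (rotate δ (rotate δ x)) = K}

theorem sum_card_filter_and_eq {X Y : Type*} [Fintype X] [Fintype Y] [DecidableEq Y]
    (p : X → Prop) [DecidablePred p] (f : X → Y) : ∑ y, #{x | p x ∧ f x = y} = #{x | p x} := by
  rw [card_eq_sum_card_fiberwise (f := f) (s := ({x | p x} : Finset X)) (t := univ) (by simp)]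
  simp only [filter_filter]

theorem card_filter_comp {X : Type*} [Fintype X] (f : X → X) (hf : Function.Bijective f)
    (p : X → Prop) [DecidablePred p] : #{x | p (f x)} = #{x | p x} := by
  refine card_bij (fun x _ => f x) ?_ ?_ ?_
  · intro x hx
    simpa using hx
  · intro x _ y _ h
    exact hf.1 h
  · intro y hy
    obtain ⟨x, rfl⟩ := hf.2 y
    exact ⟨x, by simpa using hy, rfl⟩

theorem sum_pairCount_right {q : ℕ} (n : Fin q → ℕ) (δ : ℕ) (I : Fin q) :
    ∑ J, pairCount n δ I J = n I := by
  rw [← card_groupOf_eq n I]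
  exact sum_card_filter_and_eq (fun x => groupOf n x = I) fun x => groupOf n (rotate δ x)

theorem sum_pairCount_left {q : ℕ} (n : Fin q → ℕ) {δ : ℕ} (hδ : δ ≤ ∑ i, n i) (J : Fin q) :
    ∑ I, pairCount n δ I J = n J := by
  have h := card_filter_comp _ (rotate_bijective hδ) (fun x => groupOf n x = J)
  rw [card_groupOf_eq n J] at h
  rw [← h, ← sum_card_filter_and_eq _ (groupOf n)]
  simp only [pairCount, and_comm]

theorem sum_tripleCount_right {q : ℕ} (n : Fin q → ℕ) (δ : ℕ) (I J : Fin q) :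
    ∑ K, tripleCount n δ I J K = pairCount n δ I J := by
  rw [pairCount, ← sum_card_filter_and_eq _ fun x => groupOf n (rotate δ (rotate δ x))]
  simp only [tripleCount, and_assoc]

theorem sum_tripleCount_middle {q : ℕ} (n : Fin q → ℕ) {δ ε : ℕ} (hδ : δ ≤ ∑ i, n i)
    (hε : ε ≤ ∑ i, n i) (h : 2 * δ = ε ∨ 2 * δ = ε + ∑ i, n i) (I K : Fin q) :
    ∑ J, tripleCount n δ I J K = pairCount n ε I K := by
  rw [pairCount, ← sum_card_filter_and_eq _ fun x => groupOf n (rotate δ x)]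
  simp only [tripleCount, rotate_rotate hδ hε h, and_left_comm, and_comm]

theorem sum_tripleCount_left {q : ℕ} (n : Fin q → ℕ) {δ : ℕ} (hδ : δ ≤ ∑ i, n i) (J K : Fin q) :
    ∑ I, tripleCount n δ I J K = pairCount n δ J K := by
  have h := card_filter_comp _ (rotate_bijective hδ)
    (fun x => groupOf n x = J ∧ groupOf n (rotate δ x) = K)
  rw [pairCount, ← h, ← sum_card_filter_and_eq _ (groupOf n)]
  simp only [tripleCount, and_comm]

theorem pairCount_swap {q : ℕ} (n : Fin q → ℕ) {δ : ℕ} (hδ : δ ≤ ∑ i, n i) (I J : Fin q) :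
    pairCount n δ I J = pairCount n (∑ i, n i - δ) J I := by
  have h := card_filter_comp _ (rotate_bijective hδ)
    (fun x => groupOf n x = J ∧ groupOf n (rotate (∑ i, n i - δ) x) = I)
  rw [pairCount, pairCount, ← h]
  simp only [rotate_rotate_sub hδ, and_comm]

theorem pairCount_self {q : ℕ} (n : Fin q → ℕ) {δ : ℕ} (I : Fin q) (h1 : n I ≤ δ)
    (h2 : δ + n I ≤ ∑ i, n i) : pairCount n δ I I = 0 := by
  rw [pairCount, card_eq_zero, filter_eq_empty_iff]
  rintro x - ⟨hx, hy⟩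
  rw [groupOf_eq_iff] at hx hy
  have := rotate_cases (by omega : δ ≤ ∑ i, n i) x
  omega

theorem rotate_of_groupOf_lt {q : ℕ} (n : Fin q → ℕ) {δ : ℕ} (hδ : δ ≤ ∑ i, n i) {I J : Fin q}
    (hIJ : I < J) (x : Fin (∑ i, n i)) (hx : groupOf n x = I) (hy : groupOf n (rotate δ x) = J) :
    ∃ i j, i < n I ∧ j < n J ∧
      (x : ℕ) = ∑ l ∈ Iio I, n l + i ∧
      (x : ℕ) + δ = ∑ l ∈ Iio I, n l + n I + ∑ l ∈ Ioo I J, n l + j := by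
  rw [groupOf_eq_iff] at hx hy
  rw [sum_Iio_add_sum_Ioo n hIJ] at hy
  have h1 := rotate_cases hδ x
  have h2 := (rotate δ x).2
  refine ⟨x - ∑ l ∈ Iio I, n l,
    x + δ - (∑ l ∈ Iio I, n l + n I + ∑ l ∈ Ioo I J, n l), ?_, ?_, ?_, ?_⟩ <;> omega

/-- Bound for pairs of groups by one antidiagonal of a rectangle, counted from the inner corner. -/
theorem pairCount_le_of_lt {q : ℕ} (n : Fin q → ℕ) {δ a b : ℕ} (hδ : δ ≤ ∑ i, n i) {I J : Fin q}
    (hIJ : I < J) (ha : n I ≤ a) (hb : n J ≤ b) :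
    pairCount n δ I J ≤
      #{z ∈ range a ×ˢ range b | z.1 + z.2 + 1 + ∑ l ∈ Ioo I J, n l = δ} := by
  refine card_le_card_of_injOn (fun x => (∑ l ∈ Iio I, n l + n I - 1 - x,
    x + δ - (∑ l ∈ Iio I, n l + n I + ∑ l ∈ Ioo I J, n l))) ?_ ?_
  · intro x hx
    simp only [coe_filter, mem_univ, true_and, Set.mem_ofPred_eq] at hx
    obtain ⟨i, j, hi, hj, h1, h2⟩ := rotate_of_groupOf_lt n hδ hIJ x hx.1 hx.2
    simp only [coe_filter, mem_product, mem_range, Set.mem_ofPred_eq]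
    omega
  · intro x hx y hy hxy
    simp only [coe_filter, mem_univ, true_and, Set.mem_ofPred_eq] at hx hy
    obtain ⟨i, j, hi, hj, h1, h2⟩ := rotate_of_groupOf_lt n hδ hIJ x hx.1 hx.2
    obtain ⟨i', j', hi', hj', h1', h2'⟩ := rotate_of_groupOf_lt n hδ hIJ y hy.1 hy.2
    have := congrArg Prod.fst hxy
    simp only at this
    ext
    omega

/-- Bound for pairs of groups by one antidiagonal of a rectangle, counted from the outer corner. -/
theorem pairCount_le_of_lt' {q : ℕ} (n : Fin q → ℕ) {δ a b : ℕ} (hδ : δ ≤ ∑ i, n i) {I J : Fin q}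
    (hIJ : I < J) (ha : n I ≤ a) (hb : n J ≤ b) :
    pairCount n δ I J ≤
      #{z ∈ range a ×ˢ range b |
        z.1 + z.2 + 1 + (n I + n J + ∑ l ∈ Ioo I J, n l) = a + b + δ} := by
  refine card_le_card_of_injOn (fun x => (a - 1 - (x - ∑ l ∈ Iio I, n l),
    b - n J + (x + δ - (∑ l ∈ Iio I, n l + n I + ∑ l ∈ Ioo I J, n l)))) ?_ ?_
  · intro x hx
    simp only [coe_filter, mem_univ, true_and, Set.mem_ofPred_eq] at hx
    obtain ⟨i, j, hi, hj, h1, h2⟩ := rotate_of_groupOf_lt n hδ hIJ x hx.1 hx.2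
    simp only [coe_filter, mem_product, mem_range, Set.mem_ofPred_eq]
    omega
  · intro x hx y hy hxy
    simp only [coe_filter, mem_univ, true_and, Set.mem_ofPred_eq] at hx hy
    obtain ⟨i, j, hi, hj, h1, h2⟩ := rotate_of_groupOf_lt n hδ hIJ x hx.1 hx.2
    obtain ⟨i', j', hi', hj', h1', h2'⟩ := rotate_of_groupOf_lt n hδ hIJ y hy.1 hy.2
    have := congrArg Prod.fst hxy
    simp only at this
    ext
    omega

/-- The group sizes `g` truncated at `e`. -/
def truncate {q : ℕ} (g : Fin q → ℕ) (e : ℕ) : Fin q → ℕ := fun i => min (g i) e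

theorem truncate_eq_self {q : ℕ} {g : Fin q → ℕ} {h : ℕ} (hg : ∀ i, g i ≤ h) : truncate g h = g :=
  funext fun i => min_eq_left (hg i)

theorem mul_sum_truncate_le {q : ℕ} (g : Fin q → ℕ) (s : Finset (Fin q)) {e f : ℕ} (hef : e ≤ f) :
    e * ∑ i ∈ s, truncate g f i ≤ f * ∑ i ∈ s, truncate g e i := by
  rw [mul_sum, mul_sum]
  refine sum_le_sum fun i _ => ?_
  simp only [truncate]
  rcases le_total (g i) e with h1 | h1
  · rw [min_eq_left h1, min_eq_left (h1.trans hef)]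
    exact Nat.mul_le_mul_right _ hef
  · rw [min_eq_right h1, mul_comm f]
    exact Nat.mul_le_mul_left _ (min_le_right _ _)

/-- By concavity, once `e ↦ c * e - ∑ min (g i) e` is positive, it is strictly increasing. -/
theorem sum_truncate_add_lt {q : ℕ} (g : Fin q → ℕ) (s : Finset (Fin q)) {c e f : ℕ} (hef : e < f)
    (h : ∑ i ∈ s, truncate g e i < c * e) :
    ∑ i ∈ s, truncate g f i + c * e < ∑ i ∈ s, truncate g e i + c * f := by
  have h1 := mul_sum_truncate_le g s hef.le
  generalize ∑ i ∈ s, truncate g f i = y at *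
  generalize ∑ i ∈ s, truncate g e i = x at *
  have he : 0 < e := Nat.pos_of_ne_zero (by rintro rfl; simp at h)
  obtain ⟨d, rfl⟩ : ∃ d, f = e + d := ⟨f - e, by omega⟩
  have hd : 0 < d := by omega
  have h2 : e * (y + c * e) < e * (x + c * (e + d)) := by
    have : d * x < d * (c * e) := Nat.mul_lt_mul_of_pos_left h hd
    nlinarith
  exact Nat.lt_of_mul_lt_mul_left h2

theorem sum_card_le_card_of_pairwiseDisjoint {ι α : Type*} [DecidableEq α] (s : Finset ι)
    (A : Finset α) (S : ι → Finset α) (hsub : ∀ i ∈ s, S i ⊆ A)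
    (hdis : ∀ i ∈ s, ∀ j ∈ s, ∀ z, z ∈ S i → z ∈ S j → i = j) : ∑ i ∈ s, #(S i) ≤ #A := by
  rw [← card_biUnion]
  · exact card_le_card (biUnion_subset.2 hsub)
  · intro i hi j hj hij
    exact disjoint_left.2 fun z hz hz' => hij (hdis i hi j hj z hz hz')

theorem sum_pairCount_le_of_lt {q : ℕ} (g : Fin q → ℕ) (h c : ℕ) (Φ : Finset ℕ)
    {I J : Fin q} (hIJ : I < J) (hg : ∀ i, g i ≤ h) (hc : 2 * (c * h) ≤ ∑ i, g i + 1)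
    (hΦ : ∀ φ ∈ Φ, c * h ≤ φ ∧ φ + c * h ≤ ∑ i, g i)
    (hT : ∀ e ∈ Ico 1 h, c * e ≤ ∑ i, truncate g e i) :
    ∑ e ∈ Ico 1 h, pairCount (truncate g e) (c * e) I J +
      ∑ e ∈ Ico 1 h, pairCount (truncate g e) (∑ i, truncate g e i - c * e) I J +
      ∑ φ ∈ Φ, pairCount g φ I J ≤ g I * g J := by
  set R := range (g I) ×ˢ range (g J) with hR
  set s := univ \ insert I (insert J (Ioo I J)) with hs
  have htotal : ∀ n : Fin q → ℕ,
      ∑ i, n i = ∑ i ∈ s, n i + (n I + (n J + ∑ i ∈ Ioo I J, n i)) := by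
    intro n
    rw [← sum_sdiff (subset_univ (insert I (insert J (Ioo I J)))), sum_insert, sum_insert]
    · simp
    · simp [hIJ.ne]
  have htr : ∀ e i, truncate g e i ≤ g i := fun e i => min_le_left _ _
  have hgt := htotal g
  have hMh : ∀ s : Finset (Fin q), ∑ i ∈ s, truncate g h i = ∑ i ∈ s, g i := by
    rw [truncate_eq_self hg]
    exact fun _ => rfl
  have b1 : ∑ e ∈ Ico 1 h, pairCount (truncate g e) (c * e) I J ≤
      #{z ∈ R | z.1 + z.2 + 1 + ∑ l ∈ Ioo I J, g l < c * h} := by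
    refine (sum_le_sum fun e he => pairCount_le_of_lt (truncate g e) (hT e he) hIJ
      (htr e I) (htr e J)).trans (sum_card_le_card_of_pairwiseDisjoint _ _ _ ?_ ?_)
    · intro e he z hz
      rw [mem_filter] at hz ⊢
      have := sum_truncate_add_lt g (Ioo I J) (c := c) (mem_Ico.1 he).2 (by omega)
      rw [hMh] at this
      exact ⟨hz.1, by omega⟩
    · intro e he f hf z hz hz'
      rw [mem_filter] at hz hz'
      rcases lt_trichotomy e f with hlt | heq | hlt
      · have := sum_truncate_add_lt g (Ioo I J) (c := c) hlt (by omega)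
        omega
      · exact heq
      · have := sum_truncate_add_lt g (Ioo I J) (c := c) hlt (by omega)
        omega
  have b2 : ∑ e ∈ Ico 1 h, pairCount (truncate g e) (∑ i, truncate g e i - c * e) I J ≤
      #{z ∈ R | ∑ i, g i < z.1 + z.2 + 1 + ∑ l ∈ Ioo I J, g l + c * h} := by
    refine (sum_le_sum fun e he => pairCount_le_of_lt' (truncate g e) (Nat.sub_le _ _) hIJ
      (htr e I) (htr e J)).trans (sum_card_le_card_of_pairwiseDisjoint _ _ _ ?_ ?_)
    · intro e he z hz
      have h1 := hT e he
      have h2 := htotal (truncate g e)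
      rw [mem_filter, mem_product, mem_range, mem_range] at hz
      rw [mem_filter, hR, mem_product, mem_range, mem_range]
      have := sum_truncate_add_lt g s (c := c) (mem_Ico.1 he).2 (by omega)
      rw [hMh] at this
      exact ⟨hz.1, by omega⟩
    · intro e he f hf z hz hz'
      have h1 := hT e he
      have h2 := htotal (truncate g e)
      have h1' := hT f hf
      have h2' := htotal (truncate g f)
      rw [mem_filter, mem_product, mem_range, mem_range] at hz hz'
      rcases lt_trichotomy e f with hlt | heq | hlt
      · have := sum_truncate_add_lt g s (c := c) hlt (by omega)
        omega
      · exact heq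
      · have := sum_truncate_add_lt g s (c := c) hlt (by omega)
        omega
  have b3 : ∑ φ ∈ Φ, pairCount g φ I J ≤
      #{z ∈ R | c * h ≤ z.1 + z.2 + 1 + ∑ l ∈ Ioo I J, g l ∧
        z.1 + z.2 + 1 + ∑ l ∈ Ioo I J, g l + c * h ≤ ∑ i, g i} := by
    refine (sum_le_sum fun φ hφ => pairCount_le_of_lt g (δ := φ) (by have := hΦ φ hφ; omega) hIJ
      le_rfl le_rfl).trans (sum_card_le_card_of_pairwiseDisjoint _ _ _ ?_ ?_)
    · intro φ hφ z hz
      have := hΦ φ hφ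
      rw [mem_filter] at hz ⊢
      exact ⟨hz.1, by omega⟩
    · intro φ hφ ψ hψ z hz hz'
      rw [mem_filter] at hz hz'
      omega
  refine (add_le_add (add_le_add b1 b2) b3).trans ?_
  rw [← card_union_of_disjoint, ← card_union_of_disjoint]
  · refine (card_le_card (t := R) ?_).trans (by simp [hR])
    simp only [union_subset_iff, filter_subset, and_self]
  · rw [disjoint_left]
    intro z hz
    simp only [mem_union, mem_filter] at hz ⊢
    omega
  · rw [disjoint_left]
    intro z hz
    simp only [mem_filter] at hz ⊢
    omega

/-- Two different groups are joined by no more rotations than they have pairs of points. -/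
theorem sum_pairCount_le {q : ℕ} (g : Fin q → ℕ) (h c : ℕ) (Φ : Finset ℕ)
    {I J : Fin q} (hIJ : I ≠ J) (hg : ∀ i, g i ≤ h) (hc : 2 * (c * h) ≤ ∑ i, g i + 1)
    (hΦ : ∀ φ ∈ Φ, c * h ≤ φ ∧ φ + c * h ≤ ∑ i, g i)
    (hT : ∀ e ∈ Ico 1 h, c * e ≤ ∑ i, truncate g e i) :
    ∑ e ∈ Ico 1 h, pairCount (truncate g e) (c * e) I J +
      ∑ e ∈ Ico 1 h, pairCount (truncate g e) (∑ i, truncate g e i - c * e) I J +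
      ∑ φ ∈ Φ, pairCount g φ I J ≤ g I * g J := by
  rcases lt_or_gt_of_ne hIJ with hlt | hlt
  · exact sum_pairCount_le_of_lt g h c Φ hlt hg hc hΦ hT
  have key := sum_pairCount_le_of_lt g h c (Φ.image fun φ => ∑ i, g i - φ) hlt hg hc
    (by
      intro φ hφ
      obtain ⟨ψ, hψ, rfl⟩ := mem_image.1 hφ
      have := hΦ ψ hψ
      omega) hT
  rw [sum_image] at key
  · rw [mul_comm, add_comm (∑ e ∈ Ico 1 h, pairCount (truncate g e) (c * e) I J)]
    convert key using 3
    · refine sum_congr rfl fun e he => ?_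
      rw [pairCount_swap _ (Nat.sub_le _ _), Nat.sub_sub_self (hT e he)]
    · exact sum_congr rfl fun e he => pairCount_swap _ (hT e he) I J
    · rename_i φ hφ
      exact pairCount_swap g (by have := hΦ φ hφ; omega) I J
  · intro φ hφ ψ hψ h1
    have := hΦ φ hφ
    have := hΦ ψ hψ
    simp only at h1
    omega

end Circle

section Construction

open Finset

theorem sq_add_sum_min (a h : ℕ) (hah : a ≤ h) :
    a * a + ∑ e ∈ Ico 1 h, min a e + ∑ e ∈ Ico 1 h, min a e + a = a * (2 * h) := by
  induction h, hah using Nat.le_induction with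
  | base =>
    have h1 : ∑ e ∈ Ico 1 a, min a e = ∑ e ∈ range a, e := by
      rw [range_eq_Ico]
      rcases Nat.eq_zero_or_pos a with rfl | ha
      · simp
      · rw [sum_eq_sum_Ico_succ_bot ha, zero_add, zero_add]
        exact sum_congr rfl fun e he => min_eq_right (mem_Ico.1 he).2.le
    have h2 := sum_range_id_mul_two a
    rw [h1]
    rcases a with _ | a
    · simp
    · rw [Nat.add_sub_cancel] at h2
      nlinarith
  | succ h hah ih =>
    rcases Nat.eq_zero_or_pos h with rfl | hh
    · obtain rfl : a = 0 := by omega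
      simp
    · rw [sum_Ico_succ_top hh, min_eq_left hah]
      linarith

/-- Half of `φ` modulo an odd number `t`. -/
def halfMod (t φ : ℕ) : ℕ := if φ % 2 = 0 then φ / 2 else (φ + t) / 2

theorem two_mul_halfMod {t : ℕ} (ht : Odd t) (φ : ℕ) :
    2 * halfMod t φ = φ ∨ 2 * halfMod t φ = φ + t := by
  obtain ⟨k, rfl⟩ := ht
  unfold halfMod
  split_ifs <;> omega

/-- The outline array of the small groups: the subsquares, two rotations of every proper truncation
of the groups and rotations of the groups themselves. -/
def rotationArray {q : ℕ} (g : Fin q → ℕ) (h : ℕ) (Φ : Finset ℕ) (a b z : Fin q) : ℕ :=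
  (if a = b ∧ b = z then g a * g a else 0) +
    (∑ e ∈ Ico 1 h, tripleCount (truncate g e) e a b z +
      ∑ e ∈ Ico 1 h, tripleCount (truncate g e) (∑ i, truncate g e i - e) a b z +
      ∑ φ ∈ Φ, tripleCount g (halfMod (∑ i, g i) φ) a b z)

theorem exists_latin_of_bounds {q : ℕ} (g : Fin q → ℕ) (h m r : ℕ) (hg : ∀ i, g i ≤ h)
    (hpos : 0 < h) (hodd : Odd (∑ i, g i)) (hm : ∑ i, g i = m + r)
    (h4 : 4 * h ≤ ∑ i, g i + 1) (hr : 2 * h ≤ r + 1) (hmh : 2 * h ≤ m) :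
    ∃ L : (Σ a : Fin (q + 1), Fin ((Fin.cons m g : Fin (q + 1) → ℕ) a)) →
        (Σ a : Fin (q + 1), Fin ((Fin.cons m g : Fin (q + 1) → ℕ) a)) →
        (Σ a : Fin (q + 1), Fin ((Fin.cons m g : Fin (q + 1) → ℕ) a)),
      (∀ x, Function.Bijective fun y => L x y) ∧ (∀ y, Function.Bijective fun x => L x y) ∧
      ∀ x y, x.1 = y.1 → (L x y).1 = x.1 := by
  obtain ⟨Φ, hΦsub, hΦcard⟩ := exists_subset_card_eq
    (s := Icc (2 * h) (∑ i, g i - 2 * h)) (n := r + 1 - 2 * h) (by rw [Nat.card_Icc]; omega)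
  have hΦ : ∀ φ ∈ Φ, 2 * h ≤ φ ∧ φ + 2 * h ≤ ∑ i, g i := by
    intro φ hφ
    have := mem_Icc.1 (hΦsub hφ)
    omega
  have hhalf : ∀ φ ∈ Φ, h ≤ halfMod (∑ i, g i) φ ∧ halfMod (∑ i, g i) φ + h ≤ ∑ i, g i := by
    intro φ hφ
    have := hΦ φ hφ
    have := two_mul_halfMod hodd φ
    omega
  have hinj : Set.InjOn (halfMod (∑ i, g i)) Φ := by
    intro φ hφ ψ hψ he
    have := hΦ φ hφ
    have := hΦ ψ hψ
    have := two_mul_halfMod hodd φ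
    have := two_mul_halfMod hodd ψ
    omega
  have hT : ∀ e ∈ Ico 1 h, 3 * e ≤ ∑ i, truncate g e i := by
    intro e he
    have h1 := mul_sum_truncate_le g univ (mem_Ico.1 he).2.le
    rw [truncate_eq_self hg] at h1
    have h2 : 3 * h ≤ ∑ i, g i := by omega
    have h3 : h * (3 * e) ≤ h * ∑ i, truncate g e i := by nlinarith
    exact Nat.le_of_mul_le_mul_left h3 hpos
  have htr : ∀ e i, truncate g e i ≤ e := fun e i => min_le_right _ _
  have bound₁ : ∀ a b, (if a = b then g a * g a else 0) +
      (∑ e ∈ Ico 1 h, pairCount (truncate g e) e a b +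
        ∑ e ∈ Ico 1 h, pairCount (truncate g e) (∑ i, truncate g e i - e) a b +
        ∑ φ ∈ Φ, pairCount g (halfMod (∑ i, g i) φ) a b) ≤ g a * g b := by
    intro a b
    split_ifs with hab
    · subst hab
      rw [sum_eq_zero, sum_eq_zero, sum_eq_zero]
      · simp
      · exact fun φ hφ => pairCount_self _ _ ((hg a).trans (hhalf φ hφ).1)
          (by have := hhalf φ hφ; have := hg a; omega)
      · intro e he
        have := hT e he
        have := htr e a
        exact pairCount_self _ _ (by omega) (by omega)
      · intro e he
        have := hT e he
        have := htr e a
        exact pairCount_self _ _ (by omega) (by omega)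
    · have := sum_pairCount_le g h 1 (Φ.image (halfMod (∑ i, g i))) hab hg (by omega)
        (by
          intro δ hδ
          obtain ⟨φ, hφ, rfl⟩ := mem_image.1 hδ
          simpa using hhalf φ hφ)
        (fun e he => by have := hT e he; omega)
      rw [sum_image hinj] at this
      simpa using this
  have bound₂ : ∀ a b, (if a = b then g a * g a else 0) +
      (∑ e ∈ Ico 1 h, pairCount (truncate g e) (2 * e) a b +
        ∑ e ∈ Ico 1 h, pairCount (truncate g e) (∑ i, truncate g e i - 2 * e) a b +
        ∑ φ ∈ Φ, pairCount g φ a b) ≤ g a * g b := by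
    intro a b
    split_ifs with hab
    · subst hab
      rw [sum_eq_zero, sum_eq_zero, sum_eq_zero]
      · simp
      · intro φ hφ
        have := hΦ φ hφ
        have := hg a
        exact pairCount_self _ _ (by omega) (by omega)
      · intro e he
        have := hT e he
        have := htr e a
        exact pairCount_self _ _ (by omega) (by omega)
      · intro e he
        have := hT e he
        have := htr e a
        exact pairCount_self _ _ (by omega) (by omega)
    · have := sum_pairCount_le g h 2 Φ hab hg (by omega) hΦ
        (fun e he => by have := hT e he; omega)
      simpa using this
  have hle : ∀ e ∈ Ico 1 h, e ≤ ∑ i, truncate g e i := fun e he => by have := hT e he; omega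
  have hhalf' : ∀ φ ∈ Φ, halfMod (∑ i, g i) φ ≤ ∑ i, g i :=
    fun φ hφ => by have := hhalf φ hφ; omega
  have e₃ : ∀ a b, ∑ z, rotationArray g h Φ a b z = (if a = b then g a * g a else 0) +
      (∑ e ∈ Ico 1 h, pairCount (truncate g e) e a b +
        ∑ e ∈ Ico 1 h, pairCount (truncate g e) (∑ i, truncate g e i - e) a b +
        ∑ φ ∈ Φ, pairCount g (halfMod (∑ i, g i) φ) a b) := by
    intro a b
    simp only [rotationArray, sum_add_distrib]
    rw [sum_comm, sum_comm (s := univ), sum_comm (s := univ)]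
    simp only [sum_tripleCount_right]
    congr 1
    split_ifs with hab <;> simp [hab]
  have e₂ : ∀ a z, ∑ b, rotationArray g h Φ a b z = (if a = z then g a * g a else 0) +
      (∑ e ∈ Ico 1 h, pairCount (truncate g e) (2 * e) a z +
        ∑ e ∈ Ico 1 h, pairCount (truncate g e) (∑ i, truncate g e i - 2 * e) a z +
        ∑ φ ∈ Φ, pairCount g φ a z) := by
    intro a z
    simp only [rotationArray, sum_add_distrib]
    rw [sum_comm, sum_comm (s := univ), sum_comm (s := univ)]
    congr 1
    · simp [ite_and]
    · congr 1
      · congr 1 <;> refine sum_congr rfl fun e he => ?_ <;> have := hT e he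
        · exact sum_tripleCount_middle _ (by omega) (by omega) (.inl rfl) a z
        · exact sum_tripleCount_middle _ (by omega) (by omega) (.inr (by omega)) a z
      · refine sum_congr rfl fun φ hφ => ?_
        exact sum_tripleCount_middle _ (hhalf' φ hφ) (by have := hΦ φ hφ; omega)
          (two_mul_halfMod hodd φ) a z
  have e₁ : ∀ b z, ∑ a, rotationArray g h Φ a b z = (if b = z then g b * g b else 0) +
      (∑ e ∈ Ico 1 h, pairCount (truncate g e) e b z +
        ∑ e ∈ Ico 1 h, pairCount (truncate g e) (∑ i, truncate g e i - e) b z +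
        ∑ φ ∈ Φ, pairCount g (halfMod (∑ i, g i) φ) b z) := by
    intro b z
    simp only [rotationArray, sum_add_distrib]
    rw [sum_comm, sum_comm (s := univ), sum_comm (s := univ)]
    congr 1
    · simp [ite_and]
    · congr 1
      · congr 1 <;> refine sum_congr rfl fun e he => ?_
        · exact sum_tripleCount_left _ (hle e he) b z
        · exact sum_tripleCount_left _ (Nat.sub_le _ _) b z
      · exact sum_congr rfl fun φ hφ => sum_tripleCount_left _ (hhalf' φ hφ) b z
  have hdeg : ∀ a, g a * g a + (∑ e ∈ Ico 1 h, truncate g e a + ∑ e ∈ Ico 1 h, truncate g e a +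
      ∑ φ ∈ Φ, g a) = g a * r := by
    intro a
    have h1 := sq_add_sum_min (g a) h (hg a)
    have h2 : r + 1 = 2 * h + #Φ := by omega
    have h3 : g a * r + g a = g a * (2 * h) + g a * #Φ := by rw [← mul_add, ← h2]; ring
    simp only [truncate, sum_const, smul_eq_mul]
    rw [mul_comm #Φ]
    omega
  refine exists_latin_of_partial_outline g m r (rotationArray g h Φ) hm
    (fun a b => (e₃ a b).trans_le (bound₁ a b)) (fun a z => (e₂ a z).trans_le (bound₂ a z))
    (fun b z => (e₁ b z).trans_le (bound₁ b z)) (fun a => ?_) (fun b => ?_) (fun z => ?_)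
    fun a => le_antisymm ?_ ?_
  · simp only [e₃, sum_add_distrib]
    rw [sum_comm (s := univ), sum_comm (s := univ), sum_comm (s := univ), ← hdeg a]
    simp [sum_pairCount_right]
  · simp only [e₃, sum_add_distrib]
    rw [sum_comm (s := univ), sum_comm (s := univ), sum_comm (s := univ), ← hdeg b]
    congr 1
    · simp
    · congr 1
      · congr 1 <;> refine sum_congr rfl fun e he => ?_
        · exact sum_pairCount_left _ (hle e he) b
        · exact sum_pairCount_left _ (Nat.sub_le _ _) b
      · exact sum_congr rfl fun φ hφ => sum_pairCount_left _ (hhalf' φ hφ) b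
  · rw [sum_comm]
    simp only [e₁, sum_add_distrib]
    rw [sum_comm (s := univ), sum_comm (s := univ), sum_comm (s := univ), ← hdeg z]
    congr 1
    · simp
    · congr 1
      · congr 1 <;> refine sum_congr rfl fun e he => ?_
        · exact sum_pairCount_left _ (hle e he) z
        · exact sum_pairCount_left _ (Nat.sub_le _ _) z
      · exact sum_congr rfl fun φ hφ => sum_pairCount_left _ (hhalf' φ hφ) z
  · exact (single_le_sum (f := fun z => rotationArray g h Φ a a z) (fun _ _ => Nat.zero_le _)
      (mem_univ a)).trans ((e₃ a a).trans_le (bound₁ a a))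
  · simp [rotationArray]

theorem mem_blockSet_iff {k : ℕ} (p : Fin k → ℕ) (i : Fin k) (x : Fin (∑ j, p j)) :
    x ∈ blockSet p (∑ j, p j) i ↔ groupOf p x = i := by
  have h1 : (univ.filter (· < i) : Finset (Fin k)) = Iio i := by ext; simp
  have h2 : (univ.filter (· ≤ i) : Finset (Fin k)) = insert i (Iio i) := by
    ext j
    simp [le_iff_eq_or_lt]
  rw [groupOf_eq_iff, blockSet, mem_filter, h1, h2, sum_insert (by simp), add_comm (p i)]
  simp

/-- A latin square on a disjoint union of groups with a subsquare on each group gives a realization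
in normal form. -/
theorem exists_isNormalFormRealization {k : ℕ} (p : Fin k → ℕ)
    (hL : ∃ L : (Σ a, Fin (p a)) → (Σ a, Fin (p a)) → (Σ a, Fin (p a)),
      (∀ x, Function.Bijective fun y => L x y) ∧ (∀ y, Function.Bijective fun x => L x y) ∧
      ∀ x y, x.1 = y.1 → (L x y).1 = x.1) :
    ∃ L : Fin (∑ i, p i) → Fin (∑ i, p i) → Fin (∑ i, p i), IsNormalFormRealization p L := by
  obtain ⟨L, h1, h2, h3⟩ := hL
  refine ⟨fun x y => finSigmaFinEquiv (L (finSigmaFinEquiv.symm x) (finSigmaFinEquiv.symm y)),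
    ⟨fun x => ?_, fun y => ?_⟩, fun i x hx y hy => ?_⟩
  · exact finSigmaFinEquiv.bijective.comp ((h1 _).comp finSigmaFinEquiv.symm.bijective)
  · exact finSigmaFinEquiv.bijective.comp ((h2 (finSigmaFinEquiv.symm y)).comp
      finSigmaFinEquiv.symm.bijective)
  · rw [mem_blockSet_iff] at hx hy ⊢
    rw [groupOf, Equiv.symm_apply_apply]
    exact (h3 _ _ (hx.trans hy.symm)).trans hx

end Construction

/-- let `P = (h_1 … h_k)` with `k ≥ 2`, `n = h_1 + … + h_k` and
`t = n − h_1`.  If `t` is odd, `h_i ≥ h_{i+1}` for `2 ≤ i ≤ k − 1`,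
`h_2 ≤ (t+1)/4` and `2 h_2 ≤ h_1 ≤ t + 1 − 2 h_2`, then there exists a
realization of `P` in normal form. -/
theorem statement4 (k : ℕ) (h : ℕ → ℕ) (hk : 2 ≤ k)
    (hpos : ∀ i, 1 ≤ i → i ≤ k → 0 < h i)
    (hmono : ∀ i, 2 ≤ i → i ≤ k - 1 → h (i + 1) ≤ h i)
    (hodd : Odd ((∑ i ∈ Finset.Icc 1 k, h i) - h 1))
    (h2b : 4 * h 2 ≤ ((∑ i ∈ Finset.Icc 1 k, h i) - h 1) + 1)
    (h1lb : 2 * h 2 ≤ h 1)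
    (h1ub : h 1 + 2 * h 2 ≤ ((∑ i ∈ Finset.Icc 1 k, h i) - h 1) + 1) :
    ∃ L : Fin (∑ i : Fin k, h ((i : ℕ) + 1)) → Fin (∑ i : Fin k, h ((i : ℕ) + 1)) →
        Fin (∑ i : Fin k, h ((i : ℕ) + 1)),
      IsNormalFormRealization (fun i : Fin k => h ((i : ℕ) + 1)) L := by
  obtain ⟨q, rfl⟩ : ∃ q, k = q + 1 := ⟨k - 1, by omega⟩
  have hsum : (∑ i ∈ Finset.Icc 1 (q + 1), h i) - h 1 = ∑ i : Fin q, h (i + 2) := by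
    have : ∑ i ∈ Finset.Icc 1 (q + 1), h i = ∑ i ∈ Finset.range (q + 1), h (i + 1) := by
      rw [Finset.range_eq_Ico, Finset.sum_Ico_add' h 0 (q + 1) 1]
      rfl
    rw [this, Finset.sum_range_succ', Nat.add_sub_cancel, Finset.sum_range]
  rw [hsum] at hodd h2b h1ub
  have hle : ∀ i, i < q → h (i + 2) ≤ h 2 := by
    intro i
    induction i with
    | zero => exact fun _ => le_rfl
    | succ i ih => exact fun hi => (hmono (i + 2) (by omega) (by omega)).trans (ih (by omega))
  have hcons : (fun i : Fin (q + 1) => h ((i : ℕ) + 1)) =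
      Fin.cons (h 1) fun i : Fin q => h (i + 2) := by
    funext i
    refine Fin.cases rfl (fun i => ?_) i
    simp
  have h2pos := hpos 2 (by omega) (by omega)
  have hlatin := exists_latin_of_bounds (fun i : Fin q => h (i + 2)) (h 2) (h 1)
    (∑ i : Fin q, h (i + 2) - h 1) (fun i => hle i i.2) h2pos hodd (by omega) h2b (by omega) h1lb
  rw [← hcons] at hlatin
  exact exists_isNormalFormRealization _ hlatin
end

section
/- Let P = (h_1 h_2 h_3 h_4 … h_k) be a partition where h_1 = h_2 = h_3, h_4 ≥ h_5 ≥ … ≥ h_k > 0, r = h_4 + h_5 + … + h_k is odd, h_4 ≤ (r+1)/4, and 2h_4 ≤ 3h_1 ≤ r + 1 − 2h_4. Then there exists an outline square O associated to P such that O(i,i) consists of h_i^2 copies of symbol i for each i ∈ {1,…,k}, and additionally O(1,2) and O(2,1) each consist of h_1^2 copies of symbol 3, O(1,3) and O(3,1) each consist of h_1^2 copies of symbol 2, and O(2,3) and O(3,2) each consist of h_1^2 copies of symbol 1. -/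
/-- An outline rectangle associated to partitions `(p, q, r)` (of a common `n`):
a `u × v` array `O` of multisets with elements from `{1,…,t}` (encoded as
`Fin t`) such that the cell `O i j` contains exactly `p i * q j` elements
(with multiplicity), each symbol `l` occurs exactly `p i * r l` times in row
`i`, and each symbol `l` occurs exactly `q j * r l` times in column `j`.
When `p = q = r` it is an outline square associated to `p`. -/
def IsOutlineRectangle {u v t : ℕ} (p : Fin u → ℕ) (q : Fin v → ℕ) (r : Fin t → ℕ)
    (O : Fin u → Fin v → Multiset (Fin t)) : Prop :=
  (∀ i j, Multiset.card (O i j) = p i * q j) ∧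
  (∀ i l, ∑ j, (O i j).count l = p i * r l) ∧
  (∀ j l, ∑ i, (O i j).count l = q j * r l)

/-- An outline square associated to the partition `p`. -/
def IsOutlineSquare {k : ℕ} (p : Fin k → ℕ) (O : Fin k → Fin k → Multiset (Fin k)) : Prop :=
  IsOutlineRectangle p p p O

/-- If every fibre of `ρ` over `i` has `n * R i` elements, `ρ` lifts to a map onto
`Σ i, Fin (R i)` all of whose fibres have `n` elements. -/
theorem exists_lift_card_fiber {E ι : Type*} [Fintype E] [DecidableEq ι]
    (ρ : E → ι) (n : ℕ) (R : ι → ℕ) (hρ : ∀ i, Fintype.card {e // ρ e = i} = n * R i) :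
    ∃ ρ' : E → Σ i, Fin (R i), (∀ e, (ρ' e).1 = ρ e) ∧
      ∀ c, Fintype.card {e // ρ' e = c} = n := by
  have key : ∀ i, Nonempty ({e // ρ e = i} ≃ Fin n × Fin (R i)) := fun i =>
    ⟨Fintype.equivOfCardEq (by simp [hρ])⟩
  have f := fun i => (key i).some
  refine ⟨fun e => ⟨ρ e, (f (ρ e) ⟨e, rfl⟩).2⟩, fun e => rfl, ?_⟩
  rintro ⟨i, c⟩
  have hmem : ∀ e, (⟨ρ e, (f (ρ e) ⟨e, rfl⟩).2⟩ : Σ i, Fin (R i)) = ⟨i, c⟩ ↔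
      ∃ h : ρ e = i, (f i ⟨e, h⟩).2 = c := by
    intro e
    constructor
    · intro h
      obtain ⟨h1, h2⟩ := Sigma.mk.inj_iff.1 h
      subst h1
      exact ⟨rfl, eq_of_heq h2⟩
    · rintro ⟨h1, h2⟩
      subst h1
      rw [h2]
  refine (Fintype.card_congr ?_).trans (Fintype.card_fin n)
  refine
    { toFun := fun e => (f i ⟨e.1, ((hmem e.1).1 e.2).1⟩).1
      invFun := fun a => ⟨((f i).symm (a, c)).1,
        (hmem _).2 ⟨((f i).symm (a, c)).2, by simp⟩⟩
      left_inv := ?_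
      right_inv := ?_ }
  · rintro ⟨e, he⟩
    obtain ⟨h1, h2⟩ := (hmem e).1 he
    apply Subtype.ext
    have : ((f i ⟨e, h1⟩).1, c) = f i ⟨e, h1⟩ := Prod.ext rfl h2.symm
    simp [this]
  · intro a
    simp

/-- The preimage of `S` under a map all of whose fibres have `n` elements has `n * |S|` elements. -/
theorem card_filter_mem_of_card_fiber {E A : Type*} [Fintype E] [DecidableEq A]
    {τ : E → A} {n : ℕ} (hτ : ∀ c, Fintype.card {e // τ e = c} = n) (S : Finset A) :
    (Finset.univ.filter fun e => τ e ∈ S).card = n * S.card := by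
  rw [Finset.card_eq_sum_card_fiberwise (f := τ) (t := S) (by intro e; simp), mul_comm,
    ← smul_eq_mul, ← Finset.sum_const]
  refine Finset.sum_congr rfl fun c hc => ?_
  rw [← hτ c, Fintype.card_subtype]
  congr 1
  ext e
  simp only [Finset.mem_filter, Finset.mem_univ, true_and]
  exact ⟨fun h => h.2, fun h => ⟨h ▸ hc, h⟩⟩

/-- A natural matrix whose row and column sums are all divisible by `n` dominates a natural
matrix whose row and column sums are the quotients. -/
theorem exists_le_matrix_sum_eq {ι κ : Type*} [Fintype ι] [Fintype κ] [DecidableEq ι]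
    [DecidableEq κ] (M : ι → κ → ℕ) (R : ι → ℕ) (C : κ → ℕ) (n : ℕ) (hn : 0 < n)
    (hR : ∀ i, ∑ j, M i j = n * R i) (hC : ∀ j, ∑ i, M i j = n * C j) :
    ∃ N : ι → κ → ℕ, (∀ i j, N i j ≤ M i j) ∧ (∀ i, ∑ j, N i j = R i) ∧
      ∀ j, ∑ i, N i j = C j := by
  classical
  let E := Σ p : ι × κ, Fin (M p.1 p.2)
  have hcard : ∀ (P : ι × κ → Prop) [DecidablePred P],
      Fintype.card {e : E // P e.1} = ∑ i, ∑ j, if P (i, j) then M i j else 0 := by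
    intro P _
    rw [Fintype.card_subtype, Finset.card_filter, Fintype.sum_sigma, Fintype.sum_prod_type]
    refine Finset.sum_congr rfl fun i _ => Finset.sum_congr rfl fun j _ => ?_
    by_cases h : P (i, j) <;> simp [h]
  obtain ⟨ρ, hρ, hρc⟩ := exists_lift_card_fiber (fun e : E => e.1.1) n R (by
    intro i
    rw [hcard (fun p => p.1 = i), ← hR i, Finset.sum_eq_single i] <;> simp +contextual)
  obtain ⟨σ, hσ, hσc⟩ := exists_lift_card_fiber (fun e : E => e.1.2) n C (by
    intro j
    rw [hcard (fun p => p.2 = j), ← hC j]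
    simp)
  let nb : (Σ i, Fin (R i)) → Finset (Σ j, Fin (C j)) := fun p =>
    (Finset.univ.filter fun e => ρ e = p).image σ
  obtain ⟨f, hfi, hf⟩ := (Finset.all_card_le_biUnion_card_iff_exists_injective nb).1 (by
    intro S
    refine Nat.le_of_mul_le_mul_left ?_ hn
    rw [← card_filter_mem_of_card_fiber hρc, ← card_filter_mem_of_card_fiber hσc]
    refine Finset.card_le_card fun e he => ?_
    simp only [Finset.mem_filter, Finset.mem_univ, true_and, Finset.mem_biUnion, nb,
      Finset.mem_image] at he ⊢
    exact ⟨ρ e, he, e, rfl, rfl⟩)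
  have hcards : Fintype.card (Σ i, Fin (R i)) = Fintype.card (Σ j, Fin (C j)) := by
    have h1 := card_filter_mem_of_card_fiber hρc Finset.univ
    have h2 := card_filter_mem_of_card_fiber hσc Finset.univ
    simp only [Finset.mem_univ, Finset.filter_true] at h1 h2
    exact Nat.eq_of_mul_eq_mul_left hn (h1.symm.trans h2)
  have hfb : Function.Bijective f := (Fintype.bijective_iff_injective_and_card f).2 ⟨hfi, hcards⟩
  have hex : ∀ p, ∃ e, ρ e = p ∧ σ e = f p := by
    intro p
    simpa [nb] using hf p
  choose ε hε1 hε2 using hex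
  refine ⟨fun i j => (Finset.univ.filter fun p => p.1 = i ∧ (f p).1 = j).card, ?_, ?_, ?_⟩
  · intro i j
    have h1 : (Finset.univ.filter fun e : E => e.1 = (i, j)).card = M i j := by
      rw [← Fintype.card_subtype, hcard (fun p => p = (i, j)), Finset.sum_eq_single i,
        Finset.sum_eq_single j] <;> simp +contextual
    rw [← h1]
    refine Finset.card_le_card_of_injOn ε ?_ ?_
    · intro p hp
      simp only [Finset.coe_filter, Finset.mem_univ, true_and, Set.mem_ofPred_eq] at hp ⊢
      refine Prod.ext ?_ ?_
      · rw [← hρ, hε1, hp.1]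
      · rw [← hσ, hε2, hp.2]
    · intro p _ q _ hpq
      rw [← hε1 p, hpq, hε1]
  · intro i
    have : (Finset.univ.filter fun p : Σ i, Fin (R i) => p.1 = i).card = R i := by
      rw [Finset.card_filter, Fintype.sum_sigma, Finset.sum_eq_single i] <;> simp +contextual
    rw [← this, Finset.card_eq_sum_card_fiberwise (f := fun p => (f p).1) (t := Finset.univ)
      (by intro e; simp)]
    simp only [Finset.filter_filter]
  · intro j
    have : (Finset.univ.filter fun p : Σ j, Fin (C j) => p.1 = j).card = C j := by
      rw [Finset.card_filter, Fintype.sum_sigma, Finset.sum_eq_single j] <;> simp +contextual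
    have h2 : (Finset.univ.filter fun p => (f p).1 = j).card = C j := by
      rw [← this]
      refine Finset.card_bijective f hfb ?_
      simp
    rw [← h2, Finset.card_eq_sum_card_fiberwise (f := fun p => p.1) (t := Finset.univ)
      (by intro e; simp)]
    simp only [Finset.filter_filter, and_comm]

/-- A natural matrix whose row and column sums are all divisible by `n` is a sum of `n` natural
matrices with equal row and column sums. -/
theorem exists_matrix_decomposition {ι κ : Type*} [Fintype ι] [Fintype κ] [DecidableEq ι]
    [DecidableEq κ] (R : ι → ℕ) (C : κ → ℕ) (n : ℕ) : ∀ M : ι → κ → ℕ,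
    (∀ i, ∑ j, M i j = n * R i) → (∀ j, ∑ i, M i j = n * C j) →
    ∃ N : Fin n → ι → κ → ℕ, (∀ i j, ∑ q, N q i j = M i j) ∧
      (∀ q i, ∑ j, N q i j = R i) ∧ ∀ q j, ∑ i, N q i j = C j := by
  induction n with
  | zero =>
    intro M hR hC
    refine ⟨fun q => q.elim0, fun i j => ?_, fun q => q.elim0, fun q => q.elim0⟩
    have := hR i
    simp only [zero_mul, Finset.sum_eq_zero_iff, Finset.mem_univ, true_imp_iff] at this
    simp [this j]
  | succ n ih =>
    intro M hR hC
    obtain ⟨N, hle, hNR, hNC⟩ := exists_le_matrix_sum_eq M R C (n + 1) n.succ_pos hR hC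
    obtain ⟨N', h1, h2, h3⟩ := ih (fun i j => M i j - N i j)
      (fun i => by
        rw [Finset.sum_tsub_distrib _ fun j _ => hle i j, hR, hNR, add_mul, one_mul,
          Nat.add_sub_cancel])
      (fun j => by
        rw [Finset.sum_tsub_distrib _ fun i _ => hle i j, hC, hNC, add_mul, one_mul,
          Nat.add_sub_cancel])
    refine ⟨Fin.cons N N', fun i j => ?_, fun q => ?_, fun q => ?_⟩
    · rw [Fin.sum_univ_succ]
      simp [h1, hle i j]
    · refine Fin.cases ?_ (fun q => ?_) q
      · simpa using hNR
      · simpa using h2 q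
    · refine Fin.cases ?_ (fun q => ?_) q
      · simpa using hNC
      · simpa using h3 q

/-- In the coordinates `e`, stepping forward inside an interval increases the position. -/
def IsIntervalCoordinates {m r : ℕ} {g : Fin m → ℕ} (e : ZMod r ≃ Σ i, Fin (g i)) : Prop :=
  ∀ v (n : ℕ), ((e v).2 : ℕ) + n < g (e v).1 →
    (e (v + n)).1 = (e v).1 ∧ ((e (v + n)).2 : ℕ) = (e v).2 + n

theorem ZMod.finEquiv_apply_eq_natCast {n : ℕ} [NeZero n] (x : Fin n) :
    ZMod.finEquiv n x = ((x : ℕ) : ZMod n) := by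
  cases n with
  | zero => exact absurd rfl (NeZero.ne 0)
  | succ n => exact (Fin.cast_val_eq_self x).symm

/-- Cyclic coordinates: `ZMod (∑ i, g i)` cut into consecutive intervals of lengths `g i`. -/
theorem exists_interval_coordinates {m : ℕ} (g : Fin m → ℕ) [NeZero (∑ i, g i)] :
    ∃ e : ZMod (∑ i, g i) ≃ Σ i, Fin (g i), IsIntervalCoordinates e := by
  let e := (finSigmaFinEquiv (n := g)).trans (ZMod.finEquiv (∑ i, g i)).toEquiv
  have he : ∀ k, e k = ((∑ i : Fin k.1, g (Fin.castLE k.1.2.le i) + k.2 : ℕ) : ZMod _) := by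
    intro k
    rw [← finSigmaFinEquiv_apply]
    change ZMod.finEquiv _ (finSigmaFinEquiv k) = _
    exact ZMod.finEquiv_apply_eq_natCast _
  refine ⟨e.symm, fun v n h => ?_⟩
  obtain ⟨⟨i, c⟩, rfl⟩ := e.surjective v
  rw [Equiv.symm_apply_apply] at h ⊢
  have : e ⟨i, c⟩ + n = e ⟨i, ⟨c + n, h⟩⟩ := by
    rw [he, he]
    push_cast
    ring
  rw [this, Equiv.symm_apply_apply]
  exact ⟨rfl, rfl⟩

theorem ZMod.natCast_inj_of_lt {r a b : ℕ} (h : (a : ZMod r) = b) (ha : a < r) (hb : b < r) :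
    a = b := by
  rw [ZMod.natCast_eq_natCast_iff'] at h
  rwa [Nat.mod_eq_of_lt ha, Nat.mod_eq_of_lt hb] at h

section Interval

variable {m r : ℕ} {g : Fin m → ℕ} {e : ZMod r ≃ Σ i, Fin (g i)}

theorem interval_coordinates_ext {v w : ZMod r} (h1 : (e v).1 = (e w).1)
    (h2 : ((e v).2 : ℕ) = (e w).2) : v = w := by
  apply e.injective
  generalize e v = a at *
  generalize e w = b at *
  obtain ⟨i, a⟩ := a
  obtain ⟨j, b⟩ := b
  obtain rfl : i = j := h1
  obtain rfl : a = b := Fin.ext h2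
  rfl

theorem IsIntervalCoordinates.sub (he : IsIntervalCoordinates e) {v : ZMod r} {n : ℕ}
    (h : n ≤ (e v).2) :
    (e (v - n)).1 = (e v).1 ∧ ((e (v - n)).2 : ℕ) = (e v).2 - n := by
  have hlt := (e v).2.2
  have hs : e (e.symm ⟨(e v).1, ⟨(e v).2 - n, by omega⟩⟩) =
    ⟨(e v).1, ⟨(e v).2 - n, by omega⟩⟩ := e.apply_symm_apply _
  generalize e.symm ⟨(e v).1, ⟨(e v).2 - n, by omega⟩⟩ = u at hs
  have h1 : (e u).1 = (e v).1 := by rw [hs]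
  have h2 : ((e u).2 : ℕ) = (e v).2 - n := by rw [hs]
  have h3 := he u n (by have := congrArg g h1; omega)
  have h4 : u + n = v := interval_coordinates_ext (e := e) (by rw [h3.1, h1]) (by omega)
  rw [← h4, add_sub_cancel_right, h4]
  exact ⟨h1, h2⟩

/-- A short step that ends in the interval where it started did not leave it. -/
theorem IsIntervalCoordinates.lt_of_eq (he : IsIntervalCoordinates e) {G : ℕ}
    (hG : ∀ i, g i ≤ G) {v : ZMod r} {n : ℕ} (hn : n + G ≤ r) (h : (e (v + n)).1 = (e v).1) :
    ((e v).2 : ℕ) + n < g (e v).1 := by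
  have hv := (e v).2.2
  have hw : ((e (v + n)).2 : ℕ) < g (e v).1 := by
    rw [← h]; exact (e (v + n)).2.2
  have hGv := hG (e v).1
  rcases le_total ((e v).2 : ℕ) (e (v + n)).2 with hle | hle
  · obtain ⟨t, ht⟩ := Nat.exists_eq_add_of_le hle
    obtain ⟨h1, h2⟩ := he v t (by omega)
    have h3 : v + t = v + n :=
      interval_coordinates_ext (e := e) (by rw [h1, h]) (by omega)
    have := ZMod.natCast_inj_of_lt (add_left_cancel h3) (by omega) (by omega)
    omega
  · obtain ⟨t, ht⟩ := Nat.exists_eq_add_of_le hle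
    obtain ⟨h1, h2⟩ := he (v + n) t (by have := congrArg g h; omega)
    have h3 : v + n + t = v :=
      interval_coordinates_ext (e := e) (by rw [h1, h]) (by omega)
    have h4 : ((n + t : ℕ) : ZMod r) = (0 : ℕ) := by
      push_cast
      exact add_left_cancel (a := v) (by rw [← add_assoc, h3, add_zero])
    have := ZMod.natCast_inj_of_lt h4 (by omega) (by omega)
    omega

/-- Data of a triple `(v - d, v, v + max (g j) d)` of points, `v` being at position `< d` of its
interval `j`. -/
abbrev ShortTriple (e : ZMod r ≃ Σ i, Fin (g i)) (G : ℕ) : Type :=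
  {w : ZMod r × Fin G // ((e w.1).2 : ℕ) < w.2}

namespace ShortTriple

variable {G : ℕ}

def left (w : ShortTriple e G) : ZMod r := w.1.1 - ((w.1.2 : ℕ) : ZMod r)

def mid (w : ShortTriple e G) : ZMod r := w.1.1

/-- The point of the interval of `mid` lying `d` steps before `right`. -/
def mid' (w : ShortTriple e G) : ZMod r := w.1.1 + ((g (e w.1.1).1 - w.1.2 : ℕ) : ZMod r)

/-- The distance from `left` to `right`. -/
def span (w : ShortTriple e G) : ℕ := w.1.2 + max (g (e w.1.1).1) w.1.2

def right (w : ShortTriple e G) : ZMod r := w.1.1 + ((max (g (e w.1.1).1) w.1.2 : ℕ) : ZMod r)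

theorem mid_eq (w : ShortTriple e G) : w.mid = w.left + (w.1.2 : ℕ) := by
  simp [mid, left]

theorem right_eq (w : ShortTriple e G) : w.right = w.mid' + (w.1.2 : ℕ) := by
  rw [right, mid', add_assoc, ← Nat.cast_add]
  congr 2
  omega

theorem right_eq_left_add (w : ShortTriple e G) : w.right = w.left + (w.span : ℕ) := by
  rw [right, left, span]
  push_cast
  ring

theorem mid'_coordinates (he : IsIntervalCoordinates e) (w : ShortTriple e G) :
    (e w.mid').1 = (e w.mid).1 ∧
      ((e w.mid').2 : ℕ) = (e w.mid).2 + (g (e w.mid).1 - w.1.2) := by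
  have h1 := w.2
  have h2 := (e w.1.1).2.2
  exact he w.1.1 _ (by omega)

theorem left_far (he : IsIntervalCoordinates e) (w : ShortTriple e G) :
    g (e w.left).1 ≤ (e w.left).2 + w.1.2 := by
  by_contra! h
  have h1 := (he _ _ h).2
  rw [← mid_eq] at h1
  have h2 : ((e w.mid).2 : ℕ) < w.1.2 := w.2
  omega

theorem left_ne_mid (he : IsIntervalCoordinates e) (hG : ∀ i, g i ≤ G) (hr : 4 * G ≤ r + 1)
    (w : ShortTriple e G) : (e w.left).1 ≠ (e w.mid).1 := by
  intro h
  have hd := w.1.2.2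
  rw [mid_eq] at h
  have := he.lt_of_eq hG (by omega) h.symm
  have := w.left_far he
  omega

theorem mid_ne_right (he : IsIntervalCoordinates e) (hG : ∀ i, g i ≤ G) (hr : 4 * G ≤ r + 1)
    (w : ShortTriple e G) : (e w.mid).1 ≠ (e w.right).1 := by
  intro h
  have hd := w.1.2.2
  have h1 := hG (e w.1.1).1
  have := he.lt_of_eq hG (v := w.1.1) (n := max (g (e w.1.1).1) w.1.2) (by omega) h.symm
  omega

theorem span_le (hG : ∀ i, g i ≤ G) (w : ShortTriple e G) : w.span < 2 * G := by
  have hd := w.1.2.2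
  have h1 := hG (e w.1.1).1
  unfold span
  omega

theorem left_ne_right (he : IsIntervalCoordinates e) (hG : ∀ i, g i ≤ G) (hr : 4 * G ≤ r + 1)
    (w : ShortTriple e G) : (e w.left).1 ≠ (e w.right).1 := by
  intro h
  have hd := w.1.2.2
  have h1 := w.span_le hG
  rw [right_eq_left_add] at h
  have := he.lt_of_eq hG (by omega) h.symm
  have := w.left_far he
  have h2 : w.span = w.1.2 + max (g (e w.1.1).1) w.1.2 := rfl
  omega

theorem right_near (he : IsIntervalCoordinates e) (hG : ∀ i, g i ≤ G) (hr : 4 * G ≤ r + 1)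
    (w : ShortTriple e G) : ((e w.right).2 : ℕ) < w.1.2 := by
  by_contra! h
  have h1 := (he.sub h).1
  rw [right_eq, add_sub_cancel_right, ← right_eq, (w.mid'_coordinates he).1] at h1
  exact w.mid_ne_right he hG hr h1

theorem ext_of_mid {w w' : ShortTriple e G} (h1 : w.mid = w'.mid)
    (h2 : (w.1.2 : ℕ) = w'.1.2) : w = w' :=
  Subtype.ext (Prod.ext h1 (Fin.ext h2))

theorem ext_of_mid' (he : IsIntervalCoordinates e) {w w' : ShortTriple e G}
    (h1 : w.mid' = w'.mid') (h2 : (w.1.2 : ℕ) = w'.1.2) : w = w' := by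
  refine ext_of_mid ?_ h2
  obtain ⟨h3, h4⟩ := w.mid'_coordinates he
  obtain ⟨h5, h6⟩ := w'.mid'_coordinates he
  rw [h1] at h3 h4
  have h7 := h3.symm.trans h5
  refine interval_coordinates_ext (e := e) h7 ?_
  have := congrArg g h7
  omega

theorem pos (w : ShortTriple e G) : 0 < (w.1.2 : ℕ) := (Nat.zero_le _).trans_lt w.2

/-- For a fixed left end, the span increases strictly with the step. -/
theorem span_lt_span (he : IsIntervalCoordinates e) {w w' : ShortTriple e G}
    (h : w.left = w'.left) (hlt : (w.1.2 : ℕ) < w'.1.2) : w.span < w'.span := by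
  obtain ⟨k, hk⟩ := Nat.exists_eq_add_of_lt hlt
  have hmid : w'.1.1 = w.1.1 + ((k + 1 : ℕ) : ZMod r) := by
    have h1 := w.mid_eq
    have h2 := w'.mid_eq
    unfold mid at h1 h2
    rw [h1, h2, h, hk]
    push_cast
    ring
  have hw := w.2
  unfold span
  by_cases hin : ((e w.1.1).2 : ℕ) + (k + 1) < g (e w.1.1).1
  · rw [hmid, (he _ _ hin).1]
    omega
  · have h3 := (e w.1.1).2.2
    omega

theorem ext_of_left_right (he : IsIntervalCoordinates e) (hG : ∀ i, g i ≤ G)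
    (hr : 4 * G ≤ r + 1) {w w' : ShortTriple e G}
    (h1 : w.left = w'.left) (h2 : w.right = w'.right) : w = w' := by
  have hs := w.span_le hG
  have hs' := w'.span_le hG
  rw [right_eq_left_add, right_eq_left_add, h1] at h2
  have h3 := ZMod.natCast_inj_of_lt (add_left_cancel h2) (by omega) (by omega)
  have h4 : (w.1.2 : ℕ) = w'.1.2 := by
    rcases lt_trichotomy (w.1.2 : ℕ) w'.1.2 with h | h | h
    · exact absurd h3 (span_lt_span he h1 h).ne
    · exact h
    · exact absurd h3 (span_lt_span he h1.symm h).ne'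
  refine ext_of_mid ?_ h4
  rw [mid_eq, mid_eq, h1, h4]

theorem card_filter_coordinates [NeZero r] (e : ZMod r ≃ Σ i, Fin (g i)) (G : ℕ) (i : Fin m)
    (P : ℕ → ℕ → Prop) [∀ a b, Decidable (P a b)] :
    (Finset.univ.filter fun x : ZMod r × Fin G => (e x.1).1 = i ∧ P (e x.1).2 x.2).card =
      ∑ c ∈ Finset.range (g i), ((Finset.range G).filter fun d => P c d).card := by
  rw [Finset.card_filter, Fintype.sum_prod_type, ← e.symm.sum_comp, Fintype.sum_sigma,
    Finset.sum_eq_single i, ← Fin.sum_univ_eq_sum_range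
      (fun c => ((Finset.range G).filter fun d => P c d).card)]
  · refine Finset.sum_congr rfl fun c _ => ?_
    rw [Finset.card_filter, ← Fin.sum_univ_eq_sum_range (fun d => if P c d then 1 else 0)]
    refine Finset.sum_congr rfl fun d _ => ?_
    rw [Equiv.apply_symm_apply]
    simp
  · intro j _ hj
    simp [hj]
  · simp

theorem card_filter_subtype {α : Type*} [Fintype α] (p q : α → Prop) [DecidablePred p]
    [DecidablePred q] :
    (Finset.univ.filter fun x : {x // p x} => q x).card =
      (Finset.univ.filter fun x => q x ∧ p x).card := by
  rw [← Fintype.card_subtype, ← Fintype.card_subtype]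
  exact Fintype.card_congr ((Equiv.subtypeSubtypeEquivSubtypeInter p q).trans
    (Equiv.subtypeEquivRight fun _ => and_comm))

theorem card_mid_eq [NeZero r] (i : Fin m) :
    (Finset.univ.filter fun w : ShortTriple e G => (e w.mid).1 = i).card =
      ∑ c ∈ Finset.range (g i), (G - 1 - c) := by
  refine (card_filter_subtype _ (fun x : ZMod r × Fin G => (e x.1).1 = i)).trans ?_
  rw [card_filter_coordinates e G i (fun c d => c < d)]
  refine Finset.sum_congr rfl fun c _ => ?_
  rw [show (Finset.range G).filter (fun d => c < d) = Finset.Ico (c + 1) G by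
    ext d; simp; omega, Nat.card_Ico]
  omega

theorem card_right_eq [NeZero r] (he : IsIntervalCoordinates e) (hG : ∀ i, g i ≤ G)
    (hr : 4 * G ≤ r + 1) (i : Fin m) :
    (Finset.univ.filter fun w : ShortTriple e G => (e w.right).1 = i).card =
      ∑ c ∈ Finset.range (g i), (G - 1 - c) := by
  rw [← card_mid_eq (e := e)]
  let φ : ShortTriple e G → ShortTriple e G :=
    fun w => ⟨(w.right, w.1.2), w.right_near he hG hr⟩
  refine Finset.card_bijective φ (Finite.injective_iff_bijective.1 fun w w' h => ?_)
    fun w => ?_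
  swap
  · rw [Finset.mem_filter, Finset.mem_filter]
    exact and_congr (by simp) Iff.rfl
  have h1 : w.right = w'.right := congrArg (fun u => u.1.1) h
  have h2 : (w.1.2 : ℕ) = w'.1.2 := congrArg (fun u => (u.1.2 : ℕ)) h
  refine ext_of_mid' he ?_ h2
  rw [right_eq, right_eq, h2] at h1
  exact add_right_cancel h1

theorem card_left_eq [NeZero r] (he : IsIntervalCoordinates e) (hG : ∀ i, g i ≤ G)
    (i : Fin m) :
    (Finset.univ.filter fun w : ShortTriple e G => (e w.left).1 = i).card =
      ∑ c ∈ Finset.range (g i), (G - 1 - c) := by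
  have h := card_filter_coordinates e G i (fun c d => g i ≤ c + d)
  have h1 : ∀ c ∈ Finset.range (g i), ((Finset.range G).filter fun d => g i ≤ c + d).card =
      G - 1 - (g i - 1 - c) := by
    intro c hc
    have := hG i
    rw [Finset.mem_range] at hc
    rw [show (Finset.range G).filter (fun d => g i ≤ c + d) = Finset.Ico (g i - c) G by
      ext d; simp; omega, Nat.card_Ico]
    omega
  rw [Finset.sum_congr rfl h1, Finset.sum_range_reflect (fun c => G - 1 - c)] at h
  rw [← h]
  refine Finset.card_bij (fun w _ => (w.left, w.1.2)) ?_ ?_ ?_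
  · intro w hw
    simp only [Finset.mem_filter, Finset.mem_univ, true_and] at hw ⊢
    exact ⟨hw, hw ▸ w.left_far he⟩
  · intro w _ w' _ hww
    obtain ⟨h2, h3⟩ := Prod.mk.inj hww
    refine ext_of_mid ?_ (congrArg Fin.val h3)
    rw [mid_eq, mid_eq, h2, h3]
  · rintro ⟨x, d⟩ hx
    simp only [Finset.mem_filter, Finset.mem_univ, true_and] at hx
    have hlt : ((e (x + (d : ℕ))).2 : ℕ) < d := by
      by_contra! hle
      obtain ⟨h2, h3⟩ := he.sub hle
      rw [add_sub_cancel_right] at h2 h3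
      have h4 := (e (x + (d : ℕ))).2.2
      have h5 := congrArg g (h2.symm.trans hx.1)
      omega
    have hleft : left (⟨(x + (d : ℕ), d), hlt⟩ : ShortTriple e G) = x := by simp [left]
    exact ⟨⟨(x + (d : ℕ), d), hlt⟩, by simp [hleft, hx.1], by simp [hleft]⟩

end ShortTriple

end Interval

theorem two_mul_sum_range_sub {n G : ℕ} (h : n ≤ G) :
    2 * ∑ c ∈ Finset.range n, (G - 1 - c) = n * (2 * G - 1 - n) := by
  have h1 := Finset.sum_range_reflect (fun c => G - 1 - c) n
  rw [two_mul]
  nth_rewrite 2 [← h1]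
  rw [← Finset.sum_add_distrib, ← smul_eq_mul, ← Finset.card_range n, ← Finset.sum_const,
    Finset.card_range]
  refine Finset.sum_congr rfl fun c hc => ?_
  rw [Finset.mem_range] at hc
  omega

theorem card_filter_sum_type {α β : Type*} [Fintype α] [Fintype β] (P : α ⊕ β → Prop)
    [DecidablePred P] :
    (Finset.univ.filter P).card = (Finset.univ.filter fun a => P (Sum.inl a)).card +
      (Finset.univ.filter fun b => P (Sum.inr b)).card := by
  simp only [Finset.card_filter, Fintype.sum_sum_type]

theorem card_filter_shift {r m : ℕ} [NeZero r] {g : Fin m → ℕ} (e : ZMod r ≃ Σ i, Fin (g i))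
    {n : ℕ} (f : Fin n → ZMod r) (i : Fin m) :
    (Finset.univ.filter fun x : ZMod r × Fin n => (e (x.1 + f x.2)).1 = i).card = n * g i := by
  have h : ∀ a : ZMod r, ∑ v, (if (e (v + a)).1 = i then 1 else 0) = g i := by
    intro a
    refine (Fintype.sum_equiv (Equiv.addRight a) (fun v => if (e (v + a)).1 = i then 1 else 0)
      (fun v => if (e v).1 = i then 1 else 0) fun _ => rfl).trans ?_
    rw [← e.symm.sum_comp, Fintype.sum_sigma, Finset.sum_eq_single i]
    · simp
    · intro j _ hj
      simp [hj]
    · simp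
  rw [Finset.card_filter, Fintype.sum_prod_type, Finset.sum_comm]
  simp [h]

theorem card_filter_le_of_injective {r m : ℕ} [NeZero r] {g : Fin m → ℕ}
    (e : ZMod r ≃ Σ i, Fin (g i)) {τ : Type*} [Fintype τ] {φ : τ → ZMod r × ZMod r}
    (hφ : Function.Injective φ) {X Y : τ → Fin m} (hX : ∀ t, (e (φ t).1).1 = X t)
    (hY : ∀ t, (e (φ t).2).1 = Y t) (i j : Fin m) :
    (Finset.univ.filter fun t => X t = i ∧ Y t = j).card ≤ g i * g j := by
  have hc : ∀ i, (Finset.univ.filter fun v => (e v).1 = i).card = g i := by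
    intro i
    rw [Finset.card_filter, ← e.symm.sum_comp, Fintype.sum_sigma, Finset.sum_eq_single i]
    · simp
    · intro j _ hj
      simp [hj]
    · simp
  rw [← hc i, ← hc j, ← Finset.card_product]
  refine Finset.card_le_card_of_injOn φ ?_ hφ.injOn
  intro t ht
  simpa [hX, hY] using ht

/-- Families of triples of blocks with prescribed degrees and bounded codegrees. -/
theorem exists_block_triples {m : ℕ} (g : Fin m → ℕ) (G B : ℕ) (hG : ∀ i, g i ≤ G)
    (hGpos : 0 < G) (hodd : Odd (∑ i, g i)) (hr : 4 * G ≤ ∑ i, g i + 1) (hB : 2 * G ≤ B + 1)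
    (hB' : B + 2 * G ≤ ∑ i, g i) :
    ∃ (τ : Type) (_ : Fintype τ) (X Y Z : τ → Fin m),
      (∀ t, X t ≠ Y t ∧ X t ≠ Z t ∧ Y t ≠ Z t) ∧
      (∀ i j, (Finset.univ.filter fun t => X t = i ∧ Y t = j).card ≤ g i * g j) ∧
      (∀ i j, (Finset.univ.filter fun t => X t = i ∧ Z t = j).card ≤ g i * g j) ∧
      (∀ i j, (Finset.univ.filter fun t => Y t = i ∧ Z t = j).card ≤ g i * g j) ∧
      (∀ i, (Finset.univ.filter fun t => X t = i).card = g i * (B - g i)) ∧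
      (∀ i, (Finset.univ.filter fun t => Y t = i).card = g i * (B - g i)) ∧
      (∀ i, (Finset.univ.filter fun t => Z t = i).card = g i * (B - g i)) := by
  have : NeZero (∑ i, g i) := ⟨by omega⟩
  obtain ⟨e, he⟩ := exists_interval_coordinates g
  generalize hrdef : ∑ i, g i = r at *
  have hhalf : ∀ t : Fin (B + 1 - 2 * G), ∃ h : ℕ, 2 * h = 2 * G + t ∨ 2 * h = 2 * G + t + r := by
    intro t
    obtain ⟨s, hs⟩ := hodd
    rcases Nat.even_or_odd' (t : ℕ) with ⟨u, hu | hu⟩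
    · exact ⟨G + u, by omega⟩
    · exact ⟨G + u + s + 1, by omega⟩
  choose η hη using hhalf
  have hηcast : ∀ t, (η t : ZMod r) + η t = ((2 * G + t : ℕ) : ZMod r) := by
    intro t
    rw [← Nat.cast_add, ← two_mul]
    rcases hη t with h | h <;> rw [h]
    rw [Nat.cast_add _ r, ZMod.natCast_self, add_zero]
  -- the long triples are `(v, v + η t, v + 2 * η t)`
  let S := ShortTriple e G
  let U := ZMod r × Fin (B + 1 - 2 * G)
  have hUt : ∀ u : U, 2 * G + (u.2 : ℕ) + 2 * G ≤ r := fun u => by omega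
  have hηG : ∀ t, η t + G ≤ r ∧ G ≤ η t := fun t => by have := hη t; omega
  have hfar : ∀ (v : ZMod r) (n : ℕ), G ≤ n → n + G ≤ r → (e v).1 ≠ (e (v + n)).1 := by
    intro v n h1 h2 h3
    have := he.lt_of_eq hG h2 h3.symm
    have := hG (e v).1
    omega
  have hUinj : ∀ t t' : Fin (B + 1 - 2 * G),
      ((2 * G + t : ℕ) : ZMod r) = ((2 * G + t' : ℕ) : ZMod r) → t = t' := by
    intro t t' h
    have := ZMod.natCast_inj_of_lt h (by omega) (by omega)
    exact Fin.ext (by omega)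
  have hUinj' : ∀ t t', (η t : ZMod r) = η t' → t = t' := by
    intro t t' h
    refine hUinj _ _ ?_
    rw [← hηcast, ← hηcast, h]
  -- residues of short steps, of their opposites, and of long steps are pairwise distinct
  have hopp : ∀ a b : ℕ, 0 < a → a < 2 * G → b < 2 * G → (a : ZMod r) ≠ -(b : ZMod r) := by
    intro a b h1 h2 h3 h
    have h4 : ((a + b : ℕ) : ZMod r) = (0 : ℕ) := by
      push_cast
      rw [h, neg_add_cancel]
    have := ZMod.natCast_inj_of_lt h4 (by omega) (by omega)
    omega
  have hlong : ∀ (a : ℕ) (t : Fin (B + 1 - 2 * G)), a < 2 * G →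
      (a : ZMod r) ≠ ((2 * G + t : ℕ) : ZMod r) := by
    intro a t h1 h
    have := ZMod.natCast_inj_of_lt h (by omega) (by omega)
    omega
  have hlong' : ∀ (a : ℕ) (t : Fin (B + 1 - 2 * G)), a < 2 * G →
      -(a : ZMod r) ≠ ((2 * G + t : ℕ) : ZMod r) := by
    intro a t h1 h
    have h4 : ((a + (2 * G + t) : ℕ) : ZMod r) = (0 : ℕ) := by
      rw [Nat.cast_add, ← h, add_neg_cancel, Nat.cast_zero]
    have := ZMod.natCast_inj_of_lt h4 (by omega) (by omega)
    omega
  have hshort : ∀ (d : Fin G) (t : Fin (B + 1 - 2 * G)), ((d : ℕ) : ZMod r) ≠ η t := by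
    intro d t h
    refine hlong (d + d) t (by omega) ?_
    rw [Nat.cast_add, h, hηcast]
  have hshort' : ∀ (d : Fin G) (t : Fin (B + 1 - 2 * G)), -((d : ℕ) : ZMod r) ≠ η t := by
    intro d t h
    refine hlong' (d + d) t (by omega) ?_
    rw [Nat.cast_add, neg_add, h, hηcast]
  have hdinj : ∀ d d' : Fin G, ((d : ℕ) : ZMod r) = (d' : ℕ) → (d : ℕ) = d' := fun d d' h =>
    ZMod.natCast_inj_of_lt h (by omega) (by omega)
  have hdeg : ∀ i, ∑ c ∈ Finset.range (g i), (G - 1 - c) +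
      ∑ c ∈ Finset.range (g i), (G - 1 - c) + (B + 1 - 2 * G) * g i = g i * (B - g i) := by
    intro i
    have := hG i
    rw [← two_mul, two_mul_sum_range_sub this, mul_comm _ (g i), ← mul_add]
    congr 1
    omega
  -- in the three maps below, each pair has a difference identifying its kind
  let φ₁ : (S ⊕ S) ⊕ U → ZMod r × ZMod r :=
    Sum.elim (Sum.elim (fun w => (w.left, w.left + (w.1.2 : ℕ)))
      (fun w => (w.right, w.right + -((w.1.2 : ℕ) : ZMod r)))) fun u => (u.1, u.1 + η u.2)
  let φ₂ : (S ⊕ S) ⊕ U → ZMod r × ZMod r :=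
    Sum.elim (Sum.elim (fun w => (w.left, w.left + (w.span : ℕ)))
      (fun w => (w.right, w.right + -((w.span : ℕ) : ZMod r))))
      fun u => (u.1, u.1 + ((2 * G + u.2 : ℕ) : ZMod r))
  let φ₃ : (S ⊕ S) ⊕ U → ZMod r × ZMod r :=
    Sum.elim (Sum.elim (fun w => (w.mid', w.mid' + (w.1.2 : ℕ)))
      (fun w => (w.mid, w.mid + -((w.1.2 : ℕ) : ZMod r))))
      fun u => (u.1 + η u.2, u.1 + η u.2 + η u.2)
  have hpair : ∀ {a b c d : ZMod r}, (a, a + b) = (c, c + d) → a = c ∧ b = d := by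
    intro a b c d h
    obtain ⟨rfl, h⟩ := Prod.mk.inj h
    exact ⟨rfl, add_left_cancel h⟩
  have hφ₁ : Function.Injective φ₁ := by
    refine Function.Injective.sumElim (Function.Injective.sumElim ?_ ?_ ?_) ?_ ?_
    · intro w w' h
      obtain ⟨h1, h2⟩ := hpair h
      refine ShortTriple.ext_of_mid ?_ (hdinj _ _ h2)
      rw [ShortTriple.mid_eq, ShortTriple.mid_eq, h1, h2]
    · intro w w' h
      obtain ⟨h1, h2⟩ := hpair h
      have h3 := neg_inj.1 h2
      refine ShortTriple.ext_of_mid' he ?_ (hdinj _ _ h3)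
      rw [ShortTriple.right_eq, ShortTriple.right_eq, h3] at h1
      exact add_right_cancel h1
    · intro w w' h
      exact hopp _ _ w.pos (by omega) (by omega) (hpair h).2
    · intro u u' h
      obtain ⟨h1, h2⟩ := hpair h
      exact Prod.ext h1 (hUinj' _ _ h2)
    · rintro (w | w) u h
      · exact hshort _ _ (hpair h).2
      · exact hshort' _ _ (hpair h).2
  have hφ₂ : Function.Injective φ₂ := by
    have hinv : ∀ w : S, w.left = w.right + -((w.span : ℕ) : ZMod r) := by
      intro w
      rw [w.right_eq_left_add]
      ring
    refine Function.Injective.sumElim (Function.Injective.sumElim ?_ ?_ ?_) ?_ ?_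
    · intro w w' h
      obtain ⟨h1, h2⟩ := hpair h
      refine ShortTriple.ext_of_left_right he hG hr h1 ?_
      rw [ShortTriple.right_eq_left_add, ShortTriple.right_eq_left_add, h1, h2]
    · intro w w' h
      obtain ⟨h1, h2⟩ := hpair h
      refine ShortTriple.ext_of_left_right he hG hr ?_ h1
      rw [hinv, hinv, h1, h2]
    · intro w w' h
      have hpos : 0 < w.span := Nat.add_pos_left w.pos _
      exact hopp _ _ hpos (w.span_le hG) (w'.span_le hG) (hpair h).2
    · intro u u' h
      obtain ⟨h1, h2⟩ := hpair h
      exact Prod.ext h1 (hUinj _ _ h2)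
    · rintro (w | w) u h
      · exact hlong _ _ (w.span_le hG) (hpair h).2
      · exact hlong' _ _ (w.span_le hG) (hpair h).2
  have hφ₃ : Function.Injective φ₃ := by
    refine Function.Injective.sumElim (Function.Injective.sumElim ?_ ?_ ?_) ?_ ?_
    · intro w w' h
      obtain ⟨h1, h2⟩ := hpair h
      exact ShortTriple.ext_of_mid' he h1 (hdinj _ _ h2)
    · intro w w' h
      obtain ⟨h1, h2⟩ := hpair h
      exact ShortTriple.ext_of_mid h1 (hdinj _ _ (neg_inj.1 h2))
    · intro w w' h
      exact hopp _ _ w.pos (by omega) (by omega) (hpair h).2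
    · intro u u' h
      obtain ⟨h1, h2⟩ := hpair h
      rw [h2] at h1
      exact Prod.ext (add_right_cancel h1) (hUinj' _ _ h2)
    · rintro (w | w) u h
      · exact hshort _ _ (hpair h).2
      · exact hshort' _ _ (hpair h).2
  let X : (S ⊕ S) ⊕ U → Fin m := Sum.elim (Sum.elim (fun w => (e w.left).1)
    fun w => (e w.right).1) fun u => (e u.1).1
  let Y : (S ⊕ S) ⊕ U → Fin m := Sum.elim (Sum.elim (fun w => (e w.mid).1)
    fun w => (e w.mid).1) fun u => (e (u.1 + η u.2)).1
  let Z : (S ⊕ S) ⊕ U → Fin m := Sum.elim (Sum.elim (fun w => (e w.right).1)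
    fun w => (e w.left).1) fun u => (e (u.1 + η u.2 + η u.2)).1
  have hmid' : ∀ w : S, w.right + -((w.1.2 : ℕ) : ZMod r) = w.mid' := by
    intro w
    rw [w.right_eq]
    ring
  have hleft : ∀ w : S, w.mid + -((w.1.2 : ℕ) : ZMod r) = w.left := by
    intro w
    rw [w.mid_eq]
    ring
  have hleft' : ∀ w : S, w.right + -((w.span : ℕ) : ZMod r) = w.left := by
    intro w
    rw [w.right_eq_left_add]
    ring
  refine ⟨(S ⊕ S) ⊕ U, inferInstance, X, Y, Z, ?_, card_filter_le_of_injective e hφ₁ ?_ ?_,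
    card_filter_le_of_injective e hφ₂ ?_ ?_, card_filter_le_of_injective e hφ₃ ?_ ?_, ?_, ?_, ?_⟩
  · rintro ((w | w) | u)
    · exact ⟨w.left_ne_mid he hG hr, w.left_ne_right he hG hr, w.mid_ne_right he hG hr⟩
    · exact ⟨(w.mid_ne_right he hG hr).symm, (w.left_ne_right he hG hr).symm,
        (w.left_ne_mid he hG hr).symm⟩
    · refine ⟨hfar _ _ (hηG _).2 (hηG _).1, ?_, hfar _ _ (hηG _).2 (hηG _).1⟩
      have h := hfar u.1 (2 * G + u.2) (by omega) (by have := hUt u; omega)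
      rw [← hηcast, ← add_assoc] at h
      exact h
  · rintro ((w | w) | u) <;> rfl
  · rintro ((w | w) | u)
    · exact congrArg (fun v => (e v).1) w.mid_eq.symm
    · exact (congrArg (fun v => (e v).1) (hmid' w)).trans (w.mid'_coordinates he).1
    · rfl
  · rintro ((w | w) | u) <;> rfl
  · rintro ((w | w) | u)
    · exact congrArg (fun v => (e v).1) w.right_eq_left_add.symm
    · exact congrArg (fun v => (e v).1) (hleft' w)
    · refine congrArg (fun v => (e v).1) ?_
      change u.1 + _ = u.1 + _ + _
      rw [← hηcast, add_assoc]
  · rintro ((w | w) | u)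
    · exact (w.mid'_coordinates he).1
    · rfl
    · rfl
  · rintro ((w | w) | u)
    · exact congrArg (fun v => (e v).1) w.right_eq.symm
    · exact congrArg (fun v => (e v).1) (hleft w)
    · rfl
  · intro i
    rw [card_filter_sum_type, card_filter_sum_type, ← hdeg i]
    refine congrArg₂ _ (congrArg₂ _ (ShortTriple.card_left_eq he hG i)
      (ShortTriple.card_right_eq he hG hr i)) ?_
    have h := card_filter_shift e (fun _ : Fin (B + 1 - 2 * G) => 0) i
    simp only [add_zero] at h
    exact h
  · intro i
    rw [card_filter_sum_type, card_filter_sum_type, ← hdeg i]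
    exact congrArg₂ _ (congrArg₂ _ (ShortTriple.card_mid_eq i) (ShortTriple.card_mid_eq i))
      (card_filter_shift e (fun t => (η t : ZMod r)) i)
  · intro i
    rw [card_filter_sum_type, card_filter_sum_type, ← hdeg i]
    refine congrArg₂ _ (congrArg₂ _ (ShortTriple.card_right_eq he hG hr i)
      (ShortTriple.card_left_eq he hG i)) ?_
    have h := card_filter_shift e (fun t => (η t : ZMod r) + η t) i
    simp only [← add_assoc] at h
    exact h

/-- The multiset with prescribed multiplicities `f`. -/
def multisetOfCounts {ι : Type*} [Fintype ι] (f : ι → ℕ) : Multiset ι :=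
  ∑ l, Multiset.replicate (f l) l

theorem count_multisetOfCounts {ι : Type*} [Fintype ι] [DecidableEq ι] (f : ι → ℕ) (l : ι) :
    (multisetOfCounts f).count l = f l := by
  simp [multisetOfCounts, Multiset.count_sum', Multiset.count_replicate]

theorem card_multisetOfCounts {ι : Type*} [Fintype ι] (f : ι → ℕ) :
    Multiset.card (multisetOfCounts f) = ∑ l, f l := by
  simp [multisetOfCounts]

theorem multisetOfCounts_eq_replicate {ι : Type*} [Fintype ι] [DecidableEq ι] {f : ι → ℕ}
    {n : ℕ} {a : ι} (h : ∀ l, f l = if a = l then n else 0) :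
    multisetOfCounts f = Multiset.replicate n a := by
  ext l
  rw [count_multisetOfCounts, h, Multiset.count_replicate]

/-- The completion of a matrix of codegrees `w` by entries outside the blocks on the diagonal,
split into three equal parts. -/
theorem exists_complement_split {m : ℕ} (g : Fin m → ℕ) (a B : ℕ) (hB : B + 3 * a = ∑ i, g i)
    (hgB : ∀ i, g i ≤ B) (w : Fin m → Fin m → ℕ) (hw : ∀ i j, w i j ≤ g i * g j)
    (hdiag : ∀ i, w i i = 0) (hrow : ∀ i, ∑ j, w i j = g i * (B - g i))
    (hcol : ∀ j, ∑ i, w i j = g j * (B - g j)) :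
    ∃ N : Fin 3 → Fin m → Fin m → ℕ,
      (∀ i j, ∑ q, N q i j + (w i j + if i = j then g i ^ 2 else 0) = g i * g j) ∧
      (∀ q i, ∑ j, N q i j = a * g i) ∧ ∀ q j, ∑ i, N q i j = a * g j := by
  have hle : ∀ i j, w i j + (if i = j then g i ^ 2 else 0) ≤ g i * g j := by
    intro i j
    by_cases h : i = j
    · subst h
      simp [hdiag, sq]
    · simpa [h] using hw i j
  have harith : ∀ i, (g i * ∑ j, g j) - (g i * (B - g i) + g i ^ 2) = 3 * (a * g i) := by
    intro i
    rw [← hB, sq, ← mul_add, Nat.sub_add_cancel (hgB i), ← Nat.mul_sub, Nat.add_sub_cancel_left]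
    ring
  obtain ⟨N, h1, h2, h3⟩ := exists_matrix_decomposition (fun i => a * g i) (fun i => a * g i) 3
    (fun i j => g i * g j - (w i j + if i = j then g i ^ 2 else 0))
    (fun i => by
      rw [Finset.sum_tsub_distrib _ fun j _ => hle i j, ← harith i, Finset.sum_add_distrib, hrow,
        Finset.mul_sum]
      simp)
    (fun j => by
      rw [Finset.sum_tsub_distrib _ fun i _ => hle i j, ← harith j, Finset.sum_add_distrib, hcol,
        ← Finset.sum_mul, mul_comm]
      simp)
  exact ⟨N, fun i j => by rw [h1, Nat.sub_add_cancel (hle i j)], h2, h3⟩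

/-- The multiplicities of an outline square with diagonal blocks, three of which, of equal order
`a`, span a common subsquare. -/
theorem exists_outline_counts {m : ℕ} (g : Fin m → ℕ) (G a : ℕ) (hG : ∀ i, g i ≤ G)
    (hGpos : 0 < G) (hodd : Odd (∑ i, g i)) (hr : 4 * G ≤ ∑ i, g i + 1) (ha : 2 * G ≤ 3 * a)
    (ha' : 3 * a + 2 * G ≤ ∑ i, g i + 1) :
    ∃ C : Fin 3 ⊕ Fin m → Fin 3 ⊕ Fin m → Fin 3 ⊕ Fin m → ℕ,
      (∀ i j, ∑ l, C i j l = Sum.elim (fun _ => a) g i * Sum.elim (fun _ => a) g j) ∧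
      (∀ i l, ∑ j, C i j l = Sum.elim (fun _ => a) g i * Sum.elim (fun _ => a) g l) ∧
      (∀ j l, ∑ i, C i j l = Sum.elim (fun _ => a) g j * Sum.elim (fun _ => a) g l) ∧
      (∀ i l, C (Sum.inr i) (Sum.inr i) l = if Sum.inr i = l then g i ^ 2 else 0) ∧
      ∀ p q l, C (Sum.inl p) (Sum.inl q) l = if Sum.inl (-(p + q)) = l then a ^ 2 else 0 := by
  obtain ⟨B, hB⟩ : ∃ B, B + 3 * a = ∑ i, g i := ⟨∑ i, g i - 3 * a, by omega⟩
  obtain ⟨τ, _, X, Y, Z, hne, hXY, hXZ, hYZ, hX, hY, hZ⟩ :=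
    exists_block_triples g G B hG hGpos hodd hr (by omega) (by omega)
  have hgB : ∀ i, g i ≤ B := fun i => by have := hG i; omega
  have hsum : ∀ (P : τ → Prop) [DecidablePred P] (V : τ → Fin m),
      ∑ j, (Finset.univ.filter fun t => P t ∧ V t = j).card = (Finset.univ.filter P).card := by
    intro P _ V
    rw [Finset.card_eq_sum_card_fiberwise (f := V) (t := Finset.univ) (by intro e; simp)]
    simp only [Finset.filter_filter]
  have hzero : ∀ (V W : τ → Fin m), (∀ t, V t ≠ W t) → ∀ i,
      (Finset.univ.filter fun t => V t = i ∧ W t = i).card = 0 := by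
    intro V W h i
    rw [Finset.card_eq_zero, Finset.filter_eq_empty_iff]
    exact fun t _ ht => h t (ht.1.trans ht.2.symm)
  have hsplit : ∀ (V W : τ → Fin m), (∀ t, V t ≠ W t) →
      (∀ i j, (Finset.univ.filter fun t => V t = i ∧ W t = j).card ≤ g i * g j) →
      (∀ i, (Finset.univ.filter fun t => V t = i).card = g i * (B - g i)) →
      (∀ i, (Finset.univ.filter fun t => W t = i).card = g i * (B - g i)) →
      _ := fun V W h1 h2 h3 h4 =>
    exists_complement_split g a B hB hgB
      (fun i j => (Finset.univ.filter fun t => V t = i ∧ W t = j).card) h2 (hzero V W h1)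
      (fun i => by rw [hsum, h3]) (fun j => by
        rw [← h4 j, ← hsum _ V]
        refine Finset.sum_congr rfl fun i _ => ?_
        congr 1
        ext t
        simp only [Finset.mem_filter, and_comm])
  obtain ⟨N₁, h11, h12, h13⟩ := hsplit X Y (fun t => (hne t).1) hXY hX hY
  obtain ⟨N₂, h21, h22, h23⟩ := hsplit X Z (fun t => (hne t).2.1) hXZ hX hZ
  obtain ⟨N₃, h31, h32, h33⟩ := hsplit Y Z (fun t => (hne t).2.2) hYZ hY hZ
  let c : Fin m → Fin m → Fin m → ℕ := fun i j l =>
    (Finset.univ.filter fun t => X t = i ∧ Y t = j ∧ Z t = l).card +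
      if i = j ∧ j = l then g i ^ 2 else 0
  have hc₁ : ∀ i j, ∑ l, c i j l = (Finset.univ.filter fun t => X t = i ∧ Y t = j).card +
      if i = j then g i ^ 2 else 0 := by
    intro i j
    rw [Finset.sum_add_distrib, ← hsum _ Z]
    simp only [and_assoc]
    by_cases h : i = j <;> simp [h]
  have hc₂ : ∀ i l, ∑ j, c i j l = (Finset.univ.filter fun t => X t = i ∧ Z t = l).card +
      if i = l then g i ^ 2 else 0 := by
    intro i l
    rw [Finset.sum_add_distrib, ← hsum _ Y]
    congr 1
    · refine Finset.sum_congr rfl fun j _ => ?_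
      congr 1
      ext t
      simp only [Finset.mem_filter]
      tauto
    · rw [Finset.sum_eq_single i] <;> simp +contextual [eq_comm]
  have hc₃ : ∀ j l, ∑ i, c i j l = (Finset.univ.filter fun t => Y t = j ∧ Z t = l).card +
      if j = l then g j ^ 2 else 0 := by
    intro j l
    rw [Finset.sum_add_distrib, ← hsum _ X]
    congr 1
    · refine Finset.sum_congr rfl fun i _ => ?_
      congr 1
      ext t
      simp only [Finset.mem_filter]
      tauto
    · rw [Finset.sum_eq_single j] <;> simp +contextual
  have hdiag : ∀ i l, c i i l = if i = l then g i ^ 2 else 0 := by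
    intro i l
    have h0 : (Finset.univ.filter fun t => X t = i ∧ Y t = i ∧ Z t = l).card = 0 := by
      rw [Finset.card_eq_zero, Finset.filter_eq_empty_iff]
      exact fun t _ ht => (hne t).1 (ht.1.trans ht.2.1.symm)
    simp [c, h0]
  have hN₁ : ∀ q i, N₁ q i i = 0 := by
    intro q i
    have h := h11 i i
    rw [hzero X Y fun t => (hne t).1] at h
    simp only [if_true, sq, zero_add, Nat.add_eq_right, Finset.sum_eq_zero_iff] at h
    exact h q (Finset.mem_univ q)
  let C : Fin 3 ⊕ Fin m → Fin 3 ⊕ Fin m → Fin 3 ⊕ Fin m → ℕ := fun i j l =>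
    match i, j, l with
    | Sum.inl p, Sum.inl q, Sum.inl s => if -(p + q) = s then a ^ 2 else 0
    | Sum.inl _, Sum.inl _, Sum.inr _ => 0
    | Sum.inl _, Sum.inr _, Sum.inl _ => 0
    | Sum.inr _, Sum.inl _, Sum.inl _ => 0
    | Sum.inr i, Sum.inr j, Sum.inl s => N₁ s i j
    | Sum.inr i, Sum.inl s, Sum.inr l => N₂ s i l
    | Sum.inl s, Sum.inr j, Sum.inr l => N₃ s j l
    | Sum.inr i, Sum.inr j, Sum.inr l => c i j l
  have hcyc₁ : ∀ p s : Fin 3, ∑ q, (if -(p + q) = s then a ^ 2 else 0) = a * a := by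
    intro p s
    have hinv : ∀ p q : Fin 3, -(p + -(p + q)) = q := by decide
    rw [Finset.sum_eq_single (-(p + s)), if_pos (hinv p s), sq]
    · intro q _ hq
      exact if_neg fun h => hq (by rw [← h, hinv])
    · simp
  have hcyc₂ : ∀ q s : Fin 3, ∑ p, (if -(p + q) = s then a ^ 2 else 0) = a * a := by
    intro q s
    simpa only [add_comm] using hcyc₁ q s
  refine ⟨C, ?_, ?_, ?_, ?_, ?_⟩
  · rintro (p | i) (q | j) <;> rw [Fintype.sum_sum_type]
    · simp [C, sq]
    · simpa [C] using h32 p j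
    · simpa [C, mul_comm] using h22 q i
    · simpa [C, hc₁] using h11 i j
  · rintro (p | i) (s | l) <;> rw [Fintype.sum_sum_type]
    · simpa [C] using hcyc₁ p s
    · simpa [C] using h33 p l
    · simpa [C, mul_comm] using h12 s i
    · simpa [C, hc₂] using h21 i l
  · rintro (q | j) (s | l) <;> rw [Fintype.sum_sum_type]
    · simpa [C] using hcyc₂ q s
    · simpa [C] using h23 q l
    · simpa [C, mul_comm] using h13 s j
    · simpa [C, hc₃] using h31 j l
  · rintro i (s | l)
    · simp [C, hN₁]
    · simp [C, hdiag]
  · rintro p q (s | l) <;> simp [C]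

/-- odd case: for `P = (h_1 h_2 h_3 h_4 … h_k)` with
`h_1 = h_2 = h_3`, `h_4 ≥ … ≥ h_k > 0`, `r = h_4 + … + h_k` odd,
`h_4 ≤ (r+1)/4` and `2 h_4 ≤ 3 h_1 ≤ r + 1 − 2 h_4`, there is an outline
square `O` associated to `P` with `O(i,i)` consisting of `h_i ^ 2` copies of
symbol `i` for every `i`, `O(1,2)` and `O(2,1)` each consisting of `h_1 ^ 2`
copies of symbol `3`, `O(1,3)` and `O(3,1)` of `h_1 ^ 2` copies of symbol `2`,
and `O(2,3)` and `O(3,2)` of `h_1 ^ 2` copies of symbol `1`.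
(Symbols are 1-based in the paper, 0-based as elements of `Fin k` here.) -/
theorem statement5 (k : ℕ) (h : ℕ → ℕ) (hk : 4 ≤ k)
    (h12 : h 1 = h 2) (h23 : h 2 = h 3)
    (hmono : ∀ i, 4 ≤ i → i < k → h (i + 1) ≤ h i)
    (hpos : ∀ i, 1 ≤ i → i ≤ k → 0 < h i)
    (hodd : Odd (∑ i ∈ Finset.Icc 4 k, h i))
    (h4b : 4 * h 4 ≤ (∑ i ∈ Finset.Icc 4 k, h i) + 1)
    (hlb : 2 * h 4 ≤ 3 * h 1)
    (hub : 3 * h 1 + 2 * h 4 ≤ (∑ i ∈ Finset.Icc 4 k, h i) + 1) :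
    ∃ O : Fin k → Fin k → Multiset (Fin k),
      IsOutlineSquare (fun i : Fin k => h ((i : ℕ) + 1)) O ∧
      (∀ i : Fin k, O i i = Multiset.replicate (h ((i : ℕ) + 1) ^ 2) i) ∧
      O ⟨0, by omega⟩ ⟨1, by omega⟩ = Multiset.replicate (h 1 ^ 2) ⟨2, by omega⟩ ∧
      O ⟨1, by omega⟩ ⟨0, by omega⟩ = Multiset.replicate (h 1 ^ 2) ⟨2, by omega⟩ ∧
      O ⟨0, by omega⟩ ⟨2, by omega⟩ = Multiset.replicate (h 1 ^ 2) ⟨1, by omega⟩ ∧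
      O ⟨2, by omega⟩ ⟨0, by omega⟩ = Multiset.replicate (h 1 ^ 2) ⟨1, by omega⟩ ∧
      O ⟨1, by omega⟩ ⟨2, by omega⟩ = Multiset.replicate (h 1 ^ 2) ⟨0, by omega⟩ ∧
      O ⟨2, by omega⟩ ⟨1, by omega⟩ = Multiset.replicate (h 1 ^ 2) ⟨0, by omega⟩ := by
  obtain ⟨m, rfl⟩ : ∃ m, k = 3 + m := ⟨k - 3, by omega⟩
  let g : Fin m → ℕ := fun i => h (i + 4)
  have hsum : ∑ i ∈ Finset.Icc 4 (3 + m), h i = ∑ i, g i := by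
    rw [Fin.sum_univ_eq_sum_range (fun i => h (i + 4)) m, Finset.range_eq_Ico,
      Finset.sum_Ico_add' h 0 m 4]
    refine Finset.sum_congr ?_ fun _ _ => rfl
    ext i
    simp only [Finset.mem_Icc, Finset.mem_Ico]
    omega
  have hanti : ∀ n, n < m → h (n + 4) ≤ h 4 := by
    intro n
    induction n with
    | zero => intro _; simp
    | succ n ih =>
      intro hn
      have h1 := hmono (n + 4) (by omega) (by omega)
      rw [show n + 1 + 4 = n + 4 + 1 by ring]
      exact h1.trans (ih (by omega))
  rw [hsum] at hodd h4b hub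
  obtain ⟨C, hC₁, hC₂, hC₃, hdiag, hsub⟩ := exists_outline_counts g (h 4) (h 1)
    (fun i => hanti i i.2) (hpos 4 (by omega) hk) hodd h4b hlb hub
  let E : Fin 3 ⊕ Fin m ≃ Fin (3 + m) := finSumFinEquiv
  have hsize : ∀ i, h ((i : Fin (3 + m)) + 1) = Sum.elim (fun _ => h 1) g (E.symm i) := by
    intro i
    obtain ⟨x, rfl⟩ := E.surjective i
    rw [E.symm_apply_apply]
    rcases x with p | i
    · fin_cases p
      · rfl
      · exact h12.symm
      · exact (h12.trans h23).symm
    · simp [E, g, add_comm, add_left_comm]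
  have hcell : ∀ p q s : Fin 3, -(p + q) = s →
      multisetOfCounts (fun l => C (E.symm (E (Sum.inl p))) (E.symm (E (Sum.inl q))) (E.symm l)) =
        Multiset.replicate (h 1 ^ 2) (E (Sum.inl s)) := by
    intro p q s hs
    refine multisetOfCounts_eq_replicate fun l => ?_
    rw [E.symm_apply_apply, E.symm_apply_apply, hsub, hs]
    simp only [E.eq_symm_apply]
  refine ⟨fun i j => multisetOfCounts fun l => C (E.symm i) (E.symm j) (E.symm l),
    ⟨fun i j => ?_, fun i l => ?_, fun j l => ?_⟩, fun i => ?_, hcell 0 1 2 rfl, hcell 1 0 2 rfl,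
    hcell 0 2 1 rfl, hcell 2 0 1 rfl, hcell 1 2 0 rfl, hcell 2 1 0 rfl⟩
  · rw [card_multisetOfCounts, E.symm.sum_comp (fun l => C _ _ l), hC₁]
    simp only [hsize]
  · simp only [count_multisetOfCounts, hsize]
    rw [E.symm.sum_comp (fun j => C _ j _), hC₂]
  · simp only [count_multisetOfCounts, hsize]
    rw [E.symm.sum_comp (fun i => C i _ _), hC₃]
  · obtain ⟨x, rfl⟩ := E.surjective i
    rw [hsize, E.symm_apply_apply]
    rcases x with p | i
    · have hp : -(p + p) = p := by revert p; decide
      exact hcell p p p hp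
    · refine multisetOfCounts_eq_replicate fun l => ?_
      rw [E.symm_apply_apply, hdiag]
      simp only [E.eq_symm_apply, Sum.elim_inr]
end
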